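/- Let p be a prime, q a power of p, and k = 𝔽_q((s)) a local field of characteristic p. Let F = k((π)) and let D be a central division F-algebra of period p^n. Then deg(D) = p^n, and there exists a tower of field extensions F = E_0 ⊂ E_1 ⊂ ⋯ ⊂ E_n with [E_i : E_{i−1}] = p for each i, such that E_n splits D (i.e. D ⊗_F E_n ≅ M_{p^n}(E_n)) and, equipping each E_i with the unique extension of the π-adic valuation, each residue field extension l_i/l_{i−1} has degree p and is either an Artin–Schreier extension or a purely inseparable extension; in particular the residue field of E_n has degree p^n over k. -/

import Mathlib

open scoped TensorProduct

noncomputable section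

/-- `A` is a central simple algebra over the field `K`: it is a finite-dimensional
associative unital `K`-algebra which is simple and has center exactly `K`. -/
def IsCSA (K A : Type) [Field K] [Ring A] [Algebra K A] : Prop :=
  Subalgebra.center K A = ⊥ ∧ IsSimpleRing A ∧ FiniteDimensional K A

/-- `A` is split over `K`, i.e. isomorphic to a matrix algebra over `K`;
equivalently, its Brauer class is trivial (its index is `1`). -/
def IsSplit (K A : Type) [Field K] [Ring A] [Algebra K A] : Prop :=
  ∃ n : ℕ, 0 < n ∧ Nonempty (A ≃ₐ[K] Matrix (Fin n) (Fin n) K)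

/-- `A` and `B` are Brauer (Morita) equivalent over `K`:
`M_n(A) ≅ M_m(B)` for some `n, m > 0`. -/
def BrEquiv (K A B : Type) [Field K] [Ring A] [Algebra K A] [Ring B] [Algebra K B] : Prop :=
  ∃ n m : ℕ, 0 < n ∧ 0 < m ∧
    Nonempty (Matrix (Fin n) (Fin n) A ≃ₐ[K] Matrix (Fin m) (Fin m) B)

/-- The period of (the Brauer class of) `A`: the least `n > 0` such that the `n`-fold
tensor power of `A` over `K` is split. -/
def period (K A : Type) [Field K] [Ring A] [Algebra K A] : ℕ :=
  sInf {n : ℕ | 0 < n ∧ IsSplit K (⨂[K] _ : Fin n, A)}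

/-- The index of (the Brauer class of) `A`: the degree of the division algebra `D`
with `A ≅ M_r(D)` (Artin--Wedderburn), i.e. the square root of `dim_K D`. -/
def index (K A : Type) [Field K] [Ring A] [Algebra K A] : ℕ :=
  sInf {d : ℕ | ∃ (D : Type) (_ : DivisionRing D) (_ : Algebra K D) (r : ℕ), 0 < r ∧
    Nonempty (A ≃ₐ[K] Matrix (Fin r) (Fin r) D) ∧ Module.finrank K D = d ^ 2}

/-- The subfield `k^p` of `p`-th powers of a field `k` (of characteristic `p`). -/
def pthPowers (k : Type) [Field k] (p : ℕ) : Subfield k :=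
  Subfield.closure (Set.range fun x : k => x ^ p)

/-- `[k : k^p]`, the degree of `k` over its subfield of `p`-th powers. -/
def pDegree (k : Type) [Field k] (p : ℕ) : ℕ :=
  Module.finrank (pthPowers k p) k


/-- (Helper instance: the base-field module structure on an intermediate field; this is
defeq to the Mathlib instance but stated so that instance search succeeds over
`LaurentSeries`.) -/
instance intermediateFieldModule {K L : Type} [Field K] [Field L] [Algebra K L]
    (S : IntermediateField K L) : Module K S :=
  inferInstanceAs (Module K S.toSubalgebra)

/-- The residue field extension `l₂/l₁` attached to an inclusion of (valuation) subrings
`O₁ ⊆ O₂` of `L` has degree `p` and is either an Artin–Schreier extension or a purely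
inseparable extension.  The embedding `φ : l₁ → l₂` is required to be compatible with
the inclusion `O₁ ⊆ O₂`. -/
def ResidueStep (p : ℕ) {L : Type} [Field L] (O₁ O₂ : Subring L) : Prop :=
  ∃ (_ : IsLocalRing O₁) (_ : IsLocalRing O₂)
    (φ : IsLocalRing.ResidueField O₁ →+* IsLocalRing.ResidueField O₂),
    (∀ (x : O₁) (y : O₂), (x : L) = (y : L) →
      φ (IsLocalRing.residue _ x) = IsLocalRing.residue _ y) ∧
    (letI := φ.toAlgebra
     Module.finrank (IsLocalRing.ResidueField O₁) (IsLocalRing.ResidueField O₂) = p) ∧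
    ((∀ x : IsLocalRing.ResidueField O₂, x ^ p ∈ φ.range) ∨
     (∃ α : IsLocalRing.ResidueField O₂, α ∉ φ.range ∧ α ^ p - α ∈ φ.range))

namespace Tower

section Galois
variable {E Ω : Type} [Field E] [Field Ω] [Algebra E Ω] 

/-- a function on the automorphism group depending only on the action on a finite set -/
def Smooth {E Ω : Type} [Field E] [Field Ω] [Algebra E Ω] {X : Type*} (f : (Ω ≃ₐ[E] Ω) → X) : Prop :=
  ∃ S : Set Ω, S.Finite ∧ ∀ σ τ : Ω ≃ₐ[E] Ω, (∀ x ∈ S, σ x = τ x) → f σ = f τ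

lemma Smooth.const {X : Type*} (c : X) : Smooth (E := E) (Ω := Ω) (fun _ => c) :=
  ⟨∅, Set.finite_empty, fun _ _ _ => rfl⟩

lemma Smooth.eval (x : Ω) : Smooth (E := E) (Ω := Ω) (fun σ => σ x) :=
  ⟨{x}, Set.finite_singleton x, fun _ _ h => h x rfl⟩

lemma Smooth.comp {X Y : Type*} {f : (Ω ≃ₐ[E] Ω) → X} (hf : Smooth f) (g : X → Y) :
    Smooth (fun σ => g (f σ)) := by
  obtain ⟨S, hS, h⟩ := hf
  exact ⟨S, hS, fun σ τ hst => by simp only [h σ τ hst]⟩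

lemma Smooth.comp₂ {X Y Z : Type*} {f : (Ω ≃ₐ[E] Ω) → X} (hf : Smooth f)
    {f' : (Ω ≃ₐ[E] Ω) → Y} (hf' : Smooth f') (g : X → Y → Z) :
    Smooth (fun σ => g (f σ) (f' σ)) := by
  obtain ⟨S, hS, h⟩ := hf
  obtain ⟨S', hS', h'⟩ := hf'
  refine ⟨S ∪ S', hS.union hS', fun σ τ hst => ?_⟩
  simp only [h σ τ (fun x hx => hst x (Or.inl hx)), h' σ τ (fun x hx => hst x (Or.inr hx))]

variable [IsAlgClosure E Ω]

lemma isAlgE (E Ω : Type) [Field E] [Field Ω] [Algebra E Ω] [IsAlgClosure E Ω] :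
    Algebra.IsAlgebraic E Ω := IsAlgClosure.isAlgebraic

lemma isAlgClosedE (E Ω : Type) [Field E] [Field Ω] [Algebra E Ω] [IsAlgClosure E Ω] :
    IsAlgClosed Ω := IsAlgClosure.isAlgClosed E

lemma exists_pow_sep (p : ℕ) [Fact p.Prime] [CharP E p] (x : Ω) :
    ∃ N : ℕ, IsSeparable E (x ^ p ^ N) := by
  haveI := isAlgE E Ω
  haveI : ExpChar E p := ExpChar.prime Fact.out
  haveI : ExpChar (separableClosure E Ω) p := expChar_of_injective_algebraMap (algebraMap E _).injective p
  obtain ⟨N, y, hy⟩ := IsPurelyInseparable.pow_mem (separableClosure E Ω) p x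
  refine ⟨N, ?_⟩
  rw [← hy]
  exact mem_separableClosure_iff.mp y.2

lemma Smooth.exists_galois (p : ℕ) [Fact p.Prime] [CharP E p] {X : Type*} {f : (Ω ≃ₐ[E] Ω) → X}
    (hf : Smooth f) : ∃ M : IntermediateField E Ω, FiniteDimensional E M ∧ IsGalois E M ∧
      ∀ σ τ : Ω ≃ₐ[E] Ω, (∀ x ∈ M, σ x = τ x) → f σ = f τ := by
  obtain ⟨S, hS, h⟩ := hf
  haveI := isAlgE E Ω
  haveI := isAlgClosedE E Ω
  haveI : CharP Ω p := charP_of_injective_algebraMap (algebraMap E Ω).injective p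
  haveI : ExpChar Ω p := ExpChar.prime Fact.out
  choose N hN using fun x : Ω => exists_pow_sep (E := E) p x
  let S' : Set Ω := (fun x => x ^ p ^ N x) '' S
  have hS' : S'.Finite := hS.image _
  haveI : Finite S' := hS'
  let M0 := IntermediateField.adjoin E S'
  haveI hfin : FiniteDimensional E M0 :=
    IntermediateField.finiteDimensional_adjoin (fun x _ => Algebra.IsIntegral.isIntegral x)
  have hsep : Algebra.IsSeparable E M0 := by
    rw [IntermediateField.isSeparable_adjoin_iff_isSeparable]
    rintro _ ⟨x, hx, rfl⟩
    exact hN x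
  let M := IntermediateField.normalClosure E M0 Ω
  have hM0 : M0 ≤ M := IntermediateField.le_normalClosure M0
  have hMfin : FiniteDimensional E M := normalClosure.is_finiteDimensional E M0 Ω
  have hMn : Normal E M := normalClosure.normal E M0 Ω
  have hMs : M ≤ separableClosure E Ω := by
    have := IntermediateField.normalClosure_mono M0 (separableClosure E Ω) (le_separableClosure E Ω M0)
    rwa [separableClosure.normalClosure_eq_self] at this
  have hMsep : Algebra.IsSeparable E M := (le_separableClosure_iff E Ω M).mp hMs
  refine ⟨M, hMfin, ⟨⟩, fun σ τ hst => h σ τ fun x hx => ?_⟩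
  have h1 : x ^ p ^ N x ∈ M := hM0 (IntermediateField.subset_adjoin E S' ⟨x, hx, rfl⟩)
  have h2 := hst _ h1
  rw [map_pow, map_pow] at h2
  exact iterateFrobenius_inj Ω p (N x) (by simpa [iterateFrobenius_def] using h2)

/-- fixed separable elements are in the base -/
lemma mem_base_of_fixed {x : Ω} (hs : IsSeparable E x) (hx : ∀ σ : Ω ≃ₐ[E] Ω, σ x = x) :
    ∃ e : E, algebraMap E Ω e = x := by
  haveI := isAlgE E Ω
  haveI := isAlgClosedE E Ω
  have hinteg : IsIntegral E x := Algebra.IsIntegral.isIntegral x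
  have hroots : ∀ y ∈ ((minpoly E x).aroots Ω), y = x := by
    intro y hy
    have hy' := (Polynomial.mem_aroots.mp hy).2
    obtain ⟨σ, hσ⟩ := minpoly.exists_algEquiv_of_root (Algebra.IsAlgebraic.isAlgebraic (R := E) x) hy'
    rw [← hσ]; exact σ.injective (by rw [hσ, hx])
  have hspl : ((minpoly E x).map (algebraMap E Ω)).Splits := IsAlgClosed.splits _
  have hnd : ((minpoly E x).aroots Ω).Nodup :=
    Polynomial.nodup_roots (Polynomial.Separable.map hs)
  have hcard : ((minpoly E x).aroots Ω).card = (minpoly E x).natDegree := by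
    rw [Polynomial.aroots, ← hspl.natDegree_eq_card_roots, Polynomial.natDegree_map]
  have hle : ((minpoly E x).aroots Ω).card ≤ 1 := by
    have : ((minpoly E x).aroots Ω) ≤ {x} := by
      rw [Multiset.le_iff_subset hnd]
      intro y hy
      simp [hroots y hy]
    simpa using Multiset.card_le_card this
  have hdeg : (minpoly E x).natDegree = 1 := by
    have := minpoly.natDegree_pos hinteg
    omega
  have := (minpoly.natDegree_eq_one_iff).mp hdeg
  obtain ⟨e, he⟩ := this
  exact ⟨e, he⟩

/-- additive Hilbert 90 -/
lemma add_h90 (p : ℕ) [Fact p.Prime] [CharP E p] {h : (Ω ≃ₐ[E] Ω) → Ω} (hs : Smooth h)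
    (hc : ∀ σ τ, h (σ * τ) = h σ + σ (h τ)) (K : AddSubgroup Ω)
    (hK : ∀ σ, ∀ m, IsSeparable E m → h σ * m ∈ K) :
    ∃ b ∈ K, ∀ σ, h σ = σ b - b := by
  haveI := isAlgE E Ω
  haveI := isAlgClosedE E Ω
  obtain ⟨M, hMf, hMg, hM⟩ := hs.exists_galois p
  obtain ⟨t, ht⟩ := Algebra.trace_surjective E M 1
  let L : (M ≃ₐ[E] M) → (Ω ≃ₐ[E] Ω) := fun g => g.liftNormal Ω
  have hL : ∀ g (x : M), L g (x : Ω) = (g x : M) := fun g x => AlgEquiv.liftNormal_commutes g Ω x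
  let R : (Ω ≃ₐ[E] Ω) → (M ≃ₐ[E] M) := fun σ => AlgEquiv.restrictNormalHom M σ
  have hR : ∀ σ (x : M), ((R σ x : M) : Ω) = σ x := fun σ x => AlgEquiv.restrictNormal_commutes σ M x
  have htr : ∑ g : M ≃ₐ[E] M, ((g t : M) : Ω) = 1 := by
    have := trace_eq_sum_automorphisms (K := E) (L := M) t
    rw [ht, map_one] at this
    have h2 := congrArg (fun x : M => (x : Ω)) this
    simpa using h2.symm
  refine ⟨-∑ g : M ≃ₐ[E] M, h (L g) * ((g t : M) : Ω), K.neg_mem (K.sum_mem fun g _ => hK _ _ ?_), ?_⟩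
  · have : IsSeparable E (g t) := Algebra.IsSeparable.isSeparable E (g t)
    exact this.map M.val M.val.injective 
  · intro σ
    have key : σ (∑ g : M ≃ₐ[E] M, h (L g) * ((g t : M) : Ω)) =
        (∑ g : M ≃ₐ[E] M, h (L g) * ((g t : M) : Ω)) - h σ := by
      rw [map_sum]
      have : ∀ g : M ≃ₐ[E] M, σ (h (L g) * ((g t : M) : Ω)) =
          h (L (R σ * g)) * (((R σ * g) t : M) : Ω) - h σ * (((R σ * g) t : M) : Ω) := by
        intro g
        have h1 : h (L (R σ * g)) = h (σ * L g) := by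
          apply hM
          intro x hx
          rw [hL _ ⟨x, hx⟩, AlgEquiv.mul_apply, AlgEquiv.mul_apply, hR, ← hL g ⟨x, hx⟩]
        rw [h1, hc, map_mul, AlgEquiv.mul_apply, hR]
        ring
      simp_rw [this]
      rw [Finset.sum_sub_distrib, ← Finset.mul_sum]
      have e1 := Equiv.sum_comp (Equiv.mulLeft (R σ)) (fun g : M ≃ₐ[E] M => h (L g) * ((g t : M) : Ω))
      have e2 := Equiv.sum_comp (Equiv.mulLeft (R σ)) (fun g : M ≃ₐ[E] M => ((g t : M) : Ω))
      simp only [Equiv.coe_mulLeft] at e1 e2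
      rw [e1, e2, htr, mul_one]
    rw [map_neg, key]
    ring

/-- Hilbert 90 for `GL_r`. -/
lemma gl_h90 (p : ℕ) [Fact p.Prime] [CharP E p] {ι : Type} [Fintype ι] [DecidableEq ι]
    {W : (Ω ≃ₐ[E] Ω) → Matrix ι ι Ω} (hs : Smooth W)
    (hinv : ∀ σ, IsUnit (W σ))
    (hsep : ∀ σ i j, IsSeparable E (W σ i j))
    (hc : ∀ σ τ, W (σ * τ) = W σ * (W τ).map σ) :
    ∃ Q : Matrix ι ι Ω, IsUnit Q ∧ (∀ i j, IsSeparable E (Q i j)) ∧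
      ∀ σ, W σ * Q.map σ = Q := by
  haveI := isAlgE E Ω
  haveI := isAlgClosedE E Ω
  obtain ⟨M, hMf, hMg, hM⟩ := hs.exists_galois p
  let L : (M ≃ₐ[E] M) → (Ω ≃ₐ[E] Ω) := fun g => g.liftNormal Ω
  have hL : ∀ g (x : M), L g (x : Ω) = (g x : M) := fun g x => AlgEquiv.liftNormal_commutes g Ω x
  let R : (Ω ≃ₐ[E] Ω) → (M ≃ₐ[E] M) := fun σ => AlgEquiv.restrictNormalHom M σ
  have hR : ∀ σ (x : M), ((R σ x : M) : Ω) = σ x := fun σ x => AlgEquiv.restrictNormal_commutes σ M x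
  let P : M × ι → (ι → Ω) := fun mj i => ∑ g : M ≃ₐ[E] M, W (L g) i mj.2 * ((g mj.1 : M) : Ω)
  have hP : ∀ σ mj, (W σ).mulVec (fun i => σ (P mj i)) = P mj := by
    intro σ mj
    funext i
    simp only [P, Matrix.mulVec, dotProduct, map_sum, map_mul]
    simp_rw [Finset.mul_sum]
    rw [Finset.sum_comm]
    have e1 := Equiv.sum_comp (Equiv.mulLeft (R σ))
      (fun g : M ≃ₐ[E] M => W (L g) i mj.2 * ((g mj.1 : M) : Ω))
    rw [← e1]
    refine Finset.sum_congr rfl fun g _ => ?_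
    have h1 : W (L (R σ * g)) = W (σ * L g) := by
      apply hM
      intro x hx
      rw [hL _ ⟨x, hx⟩, AlgEquiv.mul_apply, AlgEquiv.mul_apply, hR, ← hL g ⟨x, hx⟩]
    simp only [Equiv.coe_mulLeft, AlgEquiv.mul_apply]
    rw [h1, hc, Matrix.mul_apply, Finset.sum_mul]
    refine Finset.sum_congr rfl fun k _ => ?_
    rw [hR, Matrix.map_apply, mul_assoc]
  have hspan : Submodule.span Ω (Set.range P) = ⊤ := by
    by_contra hne
    obtain ⟨φ, hφ0, hφ⟩ := Submodule.exists_dual_map_eq_bot_of_lt_top (lt_top_iff_ne_top.mpr hne) inferInstance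
    have hφP : ∀ mj, φ (P mj) = 0 := fun mj => by
      have : φ (P mj) ∈ Submodule.map φ (Submodule.span Ω (Set.range P)) :=
        Submodule.mem_map_of_mem (Submodule.subset_span ⟨mj, rfl⟩)
      rw [hφ] at this
      simpa using this
    have hcol : ∀ g j, φ (fun i => W (L g) i j) = 0 := by
      intro g j
      have hli := linearIndependent_algHom_toLinearMap E M Ω
      have hli2 := hli.comp (fun g : M ≃ₐ[E] M => (M.val.comp g.toAlgHom)) (by
        intro a b hab
        ext x
        exact congrArg (fun f => f x) hab)
      rw [Fintype.linearIndependent_iff] at hli2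
      refine hli2 (fun g => φ (fun i => W (L g) i j)) ?_ g
      ext m
      have := hφP (m, j)
      have hsum : P (m, j) = ∑ g : M ≃ₐ[E] M, ((g m : M) : Ω) • (fun i => W (L g) i j) := by
        funext i
        simp [P, mul_comm]
      rw [hsum, map_sum] at this
      simp only [map_smul, smul_eq_mul] at this
      simp only [LinearMap.sum_apply, LinearMap.smul_apply, smul_eq_mul, LinearMap.zero_apply]
      rw [← this]
      refine Finset.sum_congr rfl fun g _ => ?_
      rw [mul_comm]
      rfl
    apply hφ0
    have hu := hinv (L 1)
    obtain ⟨V, hV⟩ := hu.exists_right_inv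
    apply LinearMap.pi_ext'
    intro i
    ext
    simp only [LinearMap.coe_comp, LinearMap.coe_single, Function.comp_apply, LinearMap.zero_apply]
    have : (Pi.single i 1 : ι → Ω) = ∑ j, V j i • (fun i' => W (L 1) i' j) := by
      funext i'
      have := congrFun (congrFun hV i') i
      rw [Matrix.mul_apply] at this
      simp only [Finset.sum_apply, Pi.smul_apply, smul_eq_mul]
      rw [Pi.single_apply]
      rw [Matrix.one_apply] at this
      rw [← this]
      refine Finset.sum_congr rfl fun j _ => mul_comm _ _
    rw [this, map_sum]
    simp [hcol]
  obtain ⟨s, hsub, hs1, hs2⟩ := exists_linearIndependent Ω (Set.range P)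
  rw [hspan] at hs1
  let B : Module.Basis s Ω (ι → Ω) := Module.Basis.mk hs2 (by rw [Subtype.range_coe, hs1])
  have hBfin : Finite s := Module.Finite.finite_basis B
  haveI := Fintype.ofFinite s
  have hcard : Fintype.card s = Fintype.card ι := by
    rw [← Module.finrank_eq_card_basis B, Module.finrank_fintype_fun_eq_card]
  let e : ι ≃ s := Fintype.equivOfCardEq hcard.symm
  choose mj hmj using fun x : s => hsub x.2
  let Q : Matrix ι ι Ω := Matrix.of fun i j => P (mj (e j)) i
  refine ⟨Q, ?_, ?_, ?_⟩
  · have hli : LinearIndependent Ω Q.col := by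
      have : Q.col = (fun x : s => (x : ι → Ω)) ∘ e := by
        funext j i
        simp only [Q, Matrix.col, Matrix.transpose, Matrix.of_apply, Function.comp]
        rw [hmj]
      rw [this]
      exact hs2.comp e e.injective
    exact Matrix.linearIndependent_cols_iff_isUnit.mp hli
  · intro i j
    rw [← mem_separableClosure_iff (F := E)]
    refine sum_mem fun g _ => mul_mem ?_ ?_
    · exact mem_separableClosure_iff.mpr (hsep _ _ _)
    · have : IsSeparable E (g (mj (e j)).1) := Algebra.IsSeparable.isSeparable E _
      exact mem_separableClosure_iff.mpr (this.map M.val M.val.injective)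
  · intro σ
    ext i j
    have := congrFun (hP σ (mj (e j))) i
    rw [Matrix.mul_apply]
    exact this

end Galois
end Tower

namespace Tower

section Deriv
open Polynomial IntermediateField
variable {E Ω : Type} [Field E] [Field Ω] [Algebra E Ω] [IsAlgClosure E Ω]

lemma eig_exists {K0 Ω V : Type} [Field K0] [Field Ω] [Algebra K0 Ω] [IsAlgClosed Ω] 
    [IsPurelyInseparable K0 Ω] (p : ℕ) [hp : Fact p.Prime] [CharP Ω p]
    [AddCommGroup V] [Module K0 V] [FiniteDimensional K0 V] (T Y : Module.End K0 V)
    (hTY : T * Y = Y * (T + 1)) (hYinj : Function.Injective Y) (hfr : Module.finrank K0 V = p) :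
    ∃ (z : K0) (m : V), Module.End.HasEigenvector T z m := by
  classical
  have : Nontrivial V := by
    apply Module.nontrivial_of_finrank_pos (R := K0); rw [hfr]; exact hp.out.pos
  have hconj : ∀ f : K0[X], aeval T f * Y = Y * aeval (T + 1) f := by
    intro f
    induction f using Polynomial.induction_on' with
    | add f g hf hg => rw [map_add, map_add, add_mul, mul_add, hf, hg]
    | monomial n a =>
      have hpow : T ^ n * Y = Y * (T + 1) ^ n := by
        have : SemiconjBy Y (T + 1) T := hTY.symm
        exact (this.pow_right n).symm
      rw [aeval_monomial, aeval_monomial, mul_assoc, hpow, ← mul_assoc, ← mul_assoc,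
        Algebra.commutes a Y]
  set μ := minpoly K0 T with hμ
  have hT1 : aeval (T + 1) μ = 0 := by
    have := hconj μ
    rw [hμ, minpoly.aeval, zero_mul] at this
    ext1 v
    apply hYinj
    have h3 := LinearMap.congr_fun this v
    simpa using h3.symm
  have hdvd : μ ∣ μ.comp (X + 1) := by
    apply minpoly.dvd
    rw [aeval_comp]
    simpa using hT1
  have hTint : IsIntegral K0 T := Algebra.IsIntegral.isIntegral T
  have hshift : ∀ z : Ω, aeval z μ = 0 → aeval (z + 1) μ = 0 := by
    intro z hz
    obtain ⟨g, hg⟩ := hdvd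
    have := congrArg (aeval z) hg
    rw [map_mul, hz, zero_mul, aeval_comp] at this
    simpa using this
  have hshiftn : ∀ (z : Ω) (n : ℕ), aeval z μ = 0 → aeval (z + n) μ = 0 := by
    intro z n hz
    induction n with
    | zero => simpa using hz
    | succ n ih => push_cast; rw [← add_assoc]; exact hshift _ ih
  have hμdeg : μ.natDegree ≤ p := by
    have h1 : μ ∣ T.charpoly := LinearMap.minpoly_dvd_charpoly T
    have h2 := natDegree_le_of_dvd h1 (LinearMap.charpoly_monic T).ne_zero
    rwa [LinearMap.charpoly_natDegree, hfr] at h2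
  have hμ0 : μ.degree ≠ 0 := (minpoly.degree_pos hTint).ne'
  obtain ⟨z, hz⟩ := IsAlgClosed.exists_aeval_eq_zero Ω μ hμ0
  have hμne : μ ≠ 0 := minpoly.ne_zero hTint
  have hinj : Function.Injective (fun i : Fin p => z + ((i : ℕ) : Ω)) := by
    intro i j hij
    have : ((i : ℕ) : Ω) = ((j : ℕ) : Ω) := add_left_cancel hij
    rw [CharP.natCast_eq_natCast Ω p] at this
    exact Fin.ext (Nat.ModEq.eq_of_lt_of_lt this i.2 j.2)
  have hcard1 : p ≤ (μ.aroots Ω).toFinset.card := by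
    have : (Finset.univ.image (fun i : Fin p => z + ((i : ℕ) : Ω))) ⊆ (μ.aroots Ω).toFinset := by
      intro w hw
      simp only [Finset.mem_image, Finset.mem_univ, true_and] at hw
      obtain ⟨i, rfl⟩ := hw
      rw [Multiset.mem_toFinset, mem_aroots]
      exact ⟨hμne, hshiftn z i hz⟩
    have h2 := Finset.card_le_card this
    rwa [Finset.card_image_of_injective _ hinj, Finset.card_univ, Fintype.card_fin] at h2
  have hcard2 : (μ.aroots Ω).card ≤ p := by
    refine le_trans (card_roots' _) ?_
    rwa [natDegree_map]
  have hnd : (μ.aroots Ω).Nodup := by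
    rw [← Multiset.toFinset_card_eq_card_iff_nodup]
    exact le_antisymm (Multiset.toFinset_card_le _) (hcard2.trans hcard1)
  have hμsep : μ.Separable := by
    refine (nodup_aroots_iff_of_splits hμne (IsAlgClosed.splits _)).mp hnd
  have hzsep : IsSeparable K0 z := hμsep.of_dvd (minpoly.dvd K0 z hz)
  obtain ⟨z0, hz0⟩ := IsPurelyInseparable.inseparable K0 z hzsep
  have hzr : μ.IsRoot z0 := by
    rw [← hz0, aeval_algebraMap_apply] at hz
    simpa using hz
  have hev := Module.End.hasEigenvalue_of_isRoot hzr
  obtain ⟨m, hm⟩ := hev.exists_hasEigenvector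
  exact ⟨z0, m, hm⟩

lemma der_exists (p : ℕ) [hp : Fact p.Prime] [CharP E p]
    (K0 : IntermediateField E Ω) (hK0 : separableClosure E Ω ≤ K0)
    (hst : ∀ (σ : Ω ≃ₐ[E] Ω), ∀ x ∈ K0, σ x ∈ K0)
    (y : Ω) (b : E) (hy : y ^ p = algebraMap E Ω b) (hyK : y ∉ K0) :
    ∃ δ : Ω → Ω, 
      (∀ a ∈ K0⟮y⟯, ∀ c ∈ K0⟮y⟯, δ (a * c) = a * δ c + c * δ a) ∧
      (∀ a ∈ K0, δ a = 0) ∧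
      (∀ a ∈ K0⟮y⟯, δ a ∈ K0⟮y⟯) ∧
      (∀ (σ : Ω ≃ₐ[E] Ω), ∀ a ∈ K0⟮y⟯, σ a ∈ K0⟮y⟯ ∧ δ (σ a) = σ (δ a)) ∧
      (∀ a ∈ K0⟮y⟯, a ≠ 0 → ∀ c ∈ K0, δ a = c * a → ∃ i : ℕ, c = i ∧ a / y ^ i ∈ K0) ∧
      (∀ h ∈ K0⟮y⟯, ∃ m ∈ K0⟮y⟯, m ≠ 0 ∧ ∃ z ∈ K0, δ m = (h + z) * m) := by
  have halg := isAlgE E Ω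
  have hac := isAlgClosedE E Ω
  have hcharΩ : CharP Ω p := charP_of_injective_algebraMap (algebraMap E Ω).injective p
  have hcharK : CharP K0 p := charP_of_injective_algebraMap (algebraMap E K0).injective p
  have : ExpChar Ω p := ExpChar.prime Fact.out
  have : ExpChar K0 p := ExpChar.prime Fact.out
  have hp0 : 0 < p := hp.out.pos
  have hyσ : ∀ σ : Ω ≃ₐ[E] Ω, σ y = y := by
    intro σ
    apply frobenius_inj Ω p
    simp only [frobenius_def]
    rw [← map_pow, hy, AlgEquiv.commutes]
  have hy0 : y ≠ 0 := fun h => hyK (h ▸ K0.zero_mem)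
  let c0 : K0 := algebraMap E K0 b
  have hirr : Irreducible (X ^ p - C c0 : K0[X]) := by
    apply X_pow_sub_C_irreducible_of_prime hp.out
    intro a ha
    apply hyK
    have : (a : Ω) = y := by
      apply frobenius_inj Ω p
      simp only [frobenius_def]
      rw [hy]
      exact congrArg (fun x : K0 => (x : Ω)) ha
    rw [← this]; exact a.2
  have hroot : aeval y (X ^ p - C c0 : K0[X]) = 0 := by
    simp only [map_sub, map_pow, aeval_X, aeval_C]
    rw [hy, sub_eq_zero]; rfl
  have hmin : minpoly K0 y = X ^ p - C c0 :=
    (minpoly.eq_of_irreducible_of_monic hirr hroot (monic_X_pow_sub_C _ hp0.ne')).symm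
  have hinteg : IsIntegral K0 y := ⟨_, monic_X_pow_sub_C c0 hp0.ne', by simpa [aeval_def] using hroot⟩
  have hdeg : (minpoly K0 y).natDegree = p := by rw [hmin, natDegree_X_pow_sub_C]
  have d1 : ∀ f : K0[X], aeval y f = 0 → aeval y (derivative f) = 0 := by
    intro f hf
    obtain ⟨g, rfl⟩ := minpoly.dvd K0 y hf
    rw [derivative_mul, map_add, map_mul, map_mul, minpoly.aeval, zero_mul, add_zero, hmin]
    rw [derivative_sub, derivative_C, derivative_X_pow, CharP.cast_eq_zero]
    simp
  have d2 : ∀ f : K0[X], aeval y f = 0 → f.natDegree < p → f = 0 := by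
    intro f hf hlt
    by_contra h0
    have := natDegree_le_of_dvd (minpoly.dvd K0 y hf) h0
    omega
  have hsurj : ∀ x ∈ K0⟮y⟯, ∃ f : K0[X], aeval y f = x ∧ f.natDegree < p := by
    intro x hx
    have hx' : x ∈ K0⟮y⟯.toSubalgebra := hx
    rw [IntermediateField.adjoin_simple_toSubalgebra_of_isAlgebraic hinteg.isAlgebraic,
      Algebra.adjoin_singleton_eq_range_aeval] at hx'
    obtain ⟨f, hf⟩ := hx'
    refine ⟨f %ₘ minpoly K0 y, ?_, ?_⟩
    · rw [← hf]
      have := modByMonic_add_div f (minpoly K0 y)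
      conv_rhs => rw [← this]
      simp
    · rw [← hdeg]
      exact natDegree_modByMonic_lt _ (minpoly.monic hinteg) (minpoly.ne_one K0 y)
  have hmem : ∀ f : K0[X], aeval y f ∈ K0⟮y⟯ := by
    intro f
    have : aeval y f ∈ K0⟮y⟯.toSubalgebra := by
      rw [IntermediateField.adjoin_simple_toSubalgebra_of_isAlgebraic hinteg.isAlgebraic,
      Algebra.adjoin_singleton_eq_range_aeval]
      exact ⟨f, rfl⟩
    exact this
  have hymem : y ∈ K0⟮y⟯ := mem_adjoin_simple_self K0 y
  have hKmem : ∀ a ∈ K0, a ∈ K0⟮y⟯ := fun a ha => K0⟮y⟯.algebraMap_mem ⟨a, ha⟩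
  -- the linear map
  let evK : K0[X] →ₗ[K0] K0⟮y⟯ := 
    { toFun := fun f => ⟨aeval y f, hmem f⟩
      map_add' := fun f g => Subtype.ext (by simp)
      map_smul' := fun f g => Subtype.ext (by simp) }
  let dK : K0[X] →ₗ[K0] K0⟮y⟯ := 
    { toFun := fun f => ⟨y * aeval y (derivative f), mul_mem hymem (hmem _)⟩
      map_add' := fun f g => Subtype.ext (by simp [mul_add])
      map_smul' := fun f g => Subtype.ext (by simp [derivative_smul]) }
  have hevs : LinearMap.range evK = ⊤ := by
    rw [LinearMap.range_eq_top]
    intro x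
    obtain ⟨f, hf, _⟩ := hsurj x x.2
    exact ⟨f, Subtype.ext hf⟩
  obtain ⟨s, hs⟩ := evK.exists_rightInverse_of_surjective hevs
  let D : K0⟮y⟯ →ₗ[K0] K0⟮y⟯ := dK ∘ₗ s
  have hD : ∀ f : K0[X], (D ⟨aeval y f, hmem f⟩ : Ω) = y * aeval y (derivative f) := by
    intro f
    have h1 : evK (s (evK f)) = evK f := LinearMap.congr_fun hs (evK f)
    have h2 : aeval y (s (evK f)) = aeval y f := congrArg Subtype.val h1
    have h3 : aeval y (derivative (s (evK f) - f)) = 0 := d1 _ (by rw [map_sub, h2, sub_self])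
    rw [derivative_sub, map_sub, sub_eq_zero] at h3
    change y * aeval y (derivative (s (evK f))) = _
    rw [h3]
  classical
  let δ : Ω → Ω := fun x => if hx : x ∈ K0⟮y⟯ then (D ⟨x, hx⟩ : Ω) else 0
  have hδD : ∀ x : K0⟮y⟯, δ x = D x := fun x => by simp [δ]
  have hδ : ∀ f : K0[X], δ (aeval y f) = y * aeval y (derivative f) := by
    intro f
    simp only [δ, hmem f, dif_pos]
    exact hD f
  have hleib : ∀ a ∈ K0⟮y⟯, ∀ c ∈ K0⟮y⟯, δ (a * c) = a * δ c + c * δ a := by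
    intro a ha c hc
    obtain ⟨f, rfl, _⟩ := hsurj a ha
    obtain ⟨g, rfl, _⟩ := hsurj c hc
    rw [← map_mul, hδ, hδ, hδ, derivative_mul, map_add, map_mul, map_mul]
    ring
  have hδy : δ y = y := by
    have := hδ X
    simpa using this
  refine ⟨δ, hleib, ?_, ?_, ?_, ?_, ?_⟩
  · intro a ha
    have := hδ (C ⟨a, ha⟩)
    simp only [aeval_C, derivative_C, map_zero, mul_zero] at this
    exact this
  · intro a ha
    rw [hδD ⟨a, ha⟩]
    exact (D ⟨a, ha⟩).2
  · intro σ a ha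
    obtain ⟨f, rfl, _⟩ := hsurj a ha
    let σ0 : K0 →+* K0 := 
      { toFun := fun x => ⟨σ x, hst σ x x.2⟩
        map_one' := Subtype.ext (by simp)
        map_zero' := Subtype.ext (by simp)
        map_add' := fun f g => Subtype.ext (by simp)
        map_mul' := fun f g => Subtype.ext (by simp) }
    have key : ∀ g : K0[X], σ (aeval y g) = aeval y (g.map σ0) := by
      intro g
      rw [aeval_def, aeval_def, eval₂_map]
      have := Polynomial.hom_eval₂ g (algebraMap K0 Ω) (σ : Ω →+* Ω) y
      simp only [RingHom.coe_coe] at this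
      rw [this, hyσ]
      rfl
    rw [key]
    refine ⟨hmem _, ?_⟩
    rw [hδ, hδ, map_mul, hyσ, key, derivative_map]
  · intro a ha ha0 c hc hac
    obtain ⟨f, rfl, hfd⟩ := hsurj a ha
    rw [hδ] at hac
    let c' : K0 := ⟨c, hc⟩
    have hz : X * derivative f - C c' * f = 0 := by
      apply d2
      · simp only [map_sub, map_mul, aeval_X, aeval_C]
        rw [sub_eq_zero]; exact hac
      · refine lt_of_le_of_lt (natDegree_sub_le _ _) (max_lt ?_ ?_)
        · rcases Nat.eq_zero_or_pos f.natDegree with h0 | h0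
          · rw [eq_C_of_natDegree_eq_zero h0]; simpa using hp0
          · refine lt_of_le_of_lt natDegree_mul_le ?_
            have := natDegree_derivative_lt h0.ne'
            rw [natDegree_X]
            omega
        · exact lt_of_le_of_lt (natDegree_C_mul_le _ _) hfd
    have hcoef : ∀ i : ℕ, (i : K0) * f.coeff i = c' * f.coeff i := by
      intro i
      have := congrArg (fun q => q.coeff i) hz
      simp only [coeff_sub, coeff_C_mul, coeff_zero] at this
      rw [sub_eq_zero] at this
      rw [← this]
      cases i with
      | zero => simp
      | succ i => rw [coeff_X_mul, coeff_derivative]; push_cast; ring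
    have hf0 : f ≠ 0 := by rintro rfl; simp at ha0
    set i := f.natDegree with hi
    have hlead : f.coeff i ≠ 0 := by rwa [hi, coeff_natDegree, leadingCoeff_ne_zero]
    have hci : c' = i := (mul_right_cancel₀ hlead (hcoef i)).symm
    refine ⟨i, by simpa using congrArg Subtype.val hci, ?_⟩
    have hmono : f = C (f.coeff i) * X ^ i := by
      refine Polynomial.ext fun j => ?_
      rw [coeff_C_mul, coeff_X_pow]
      split_ifs with hj
      · rw [hj, mul_one]
      · rw [mul_zero]
        by_contra hne
        have h1 : (j : K0) = i := by rw [← hci]; exact mul_right_cancel₀ hne (hcoef j)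
        have hjd : j ≤ i := le_natDegree_of_ne_zero hne
        rw [CharP.natCast_eq_natCast K0 p] at h1
        apply hj
        have := Nat.ModEq.eq_of_lt_of_lt h1 (by omega) (by omega)
        exact this
    rw [hmono]
    simp only [map_mul, aeval_C, map_pow, aeval_X]
    rw [mul_div_assoc, div_self (pow_ne_zero _ hy0), mul_one]
    exact (f.coeff i).2
  · intro h hh
    have hfd : FiniteDimensional K0 K0⟮y⟯ := adjoin.finiteDimensional hinteg
    have hfr : Module.finrank K0 K0⟮y⟯ = p := by rw [adjoin.finrank hinteg, hdeg]
    let T : Module.End K0 K0⟮y⟯ := D - LinearMap.mulLeft K0 ⟨h, hh⟩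
    let Y : Module.End K0 K0⟮y⟯ := LinearMap.mulLeft K0 ⟨y, hymem⟩
    have hTY : T * Y = Y * (T + 1) := by
      ext x
      have hl := hleib y hymem x x.2
      rw [hδy, hδD x] at hl
      have h2 : δ (y * x) = D (⟨y, hymem⟩ * x) := hδD (⟨y, hymem⟩ * x)
      rw [h2] at hl
      simp only [T, Y, Module.End.mul_apply, LinearMap.sub_apply, LinearMap.add_apply, LinearMap.mulLeft_apply,
        Module.End.one_apply]
      push_cast
      rw [hl]
      ring
    have hYinj : Function.Injective Y := by
      intro u v huv
      exact mul_left_cancel₀ (fun h0 => hy0 (congrArg Subtype.val h0)) huv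
    have hpi : IsPurelyInseparable K0 Ω := by
      rw [isPurelyInseparable_iff_pow_mem K0 p]
      intro x
      obtain ⟨N, hN⟩ := exists_pow_sep (E := E) p x
      exact ⟨N, ⟨x ^ p ^ N, hK0 (mem_separableClosure_iff.mpr hN)⟩, rfl⟩
    obtain ⟨z0, m, hm⟩ := eig_exists p (K0 := K0) (Ω := Ω) T Y hTY hYinj hfr
    refine ⟨m, m.2, fun h0 => hm.2 (Subtype.ext h0), z0, z0.2, ?_⟩
    have h1 := hm.apply_eq_smul
    have h2 := congrArg Subtype.val h1
    simp only [T, LinearMap.sub_apply, LinearMap.mulLeft_apply] at h2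
    rw [hδD m]
    push_cast at h2
    rw [sub_eq_iff_eq_add] at h2
    rw [h2]
    change (z0 : Ω) * (m : Ω) + _ = _
    ring
end Deriv
end Tower

namespace Tower

section L1
open Polynomial IntermediateField
variable {E Ω : Type} [Field E] [Field Ω] [Algebra E Ω] 

open Classical in
/-- a natural number representing an element of the prime field -/
def idx {Ω : Type} [Field Ω] (x : Ω) : ℕ := if h : ∃ i : ℕ, x = i then Nat.find h else 0

lemma idx_spec {x : Ω} (h : ∃ i : ℕ, x = i) : x = idx x := by
  classical
  rw [idx, dif_pos h]
  exact Nat.find_spec h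

lemma pow_congr_base (p : ℕ) [CharP Ω p] {y : Ω} {b : E} (hy : y ^ p = algebraMap E Ω b) (hy0 : y ≠ 0)
    {i j : ℕ} (hij : (i : Ω) = j) : ∃ e : E, e ≠ 0 ∧ y ^ i = y ^ j * algebraMap E Ω e := by
  have hb : b ≠ 0 := by
    rintro rfl
    rw [map_zero] at hy
    exact hy0 ((pow_eq_zero_iff (n := p) (Nat.pos_iff_ne_zero.mp (by
      rcases Nat.eq_zero_or_pos p with h | h
      · subst h; simp at hy
      · exact h))).mp hy)
  have aux : ∀ i j : ℕ, i ≤ j → (i : Ω) = j → ∃ e : E, e ≠ 0 ∧ y ^ j = y ^ i * algebraMap E Ω e := by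
    intro i j hle h
    rw [CharP.natCast_eq_natCast Ω p] at h
    obtain ⟨k, hk⟩ := (Nat.modEq_iff_dvd' hle).mp h
    refine ⟨b ^ k, pow_ne_zero _ hb, ?_⟩
    rw [map_pow, ← hy, ← pow_mul, ← hk, ← pow_add]
    congr 1; omega
  rcases le_total i j with h | h
  · obtain ⟨e, he, h'⟩ := aux i j h hij
    refine ⟨e⁻¹, inv_ne_zero he, ?_⟩
    rw [h', map_inv₀, mul_assoc, mul_inv_cancel₀ (by simpa using he), mul_one]
  · exact aux j i h hij.symm

lemma fp_of_pow (p : ℕ) [hp : Fact p.Prime] [CharP Ω p] {x : Ω} (hx : x ^ p = x) :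
    ∃ i : ℕ, x = i := by
  have : ∃ i : ZMod p, (ZMod.castHom (dvd_refl p) Ω i) = x := by
    by_contra hne
    push Not at hne
    classical
    have hinj : Function.Injective (ZMod.castHom (dvd_refl p) Ω) := RingHom.injective _
    let S : Finset Ω := insert x (Finset.univ.image (ZMod.castHom (dvd_refl p) Ω))
    have hc : S.card = p + 1 := by
      rw [Finset.card_insert_of_notMem, Finset.card_image_of_injective _ hinj, Finset.card_univ, ZMod.card]
      simp only [Finset.mem_image, not_exists]
      rintro i ⟨_, h⟩
      exact hne i h
    have hne0 : (X ^ p - X : Polynomial Ω) ≠ 0 := FiniteField.X_pow_card_sub_X_ne_zero Ω hp.out.one_lt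
    have hsub : S ⊆ (X ^ p - X : Polynomial Ω).roots.toFinset := by
      intro w hw
      rw [Multiset.mem_toFinset, mem_roots hne0]
      simp only [IsRoot.def, eval_sub, eval_pow, eval_X]
      rw [sub_eq_zero]
      rcases Finset.mem_insert.mp hw with rfl | hw
      · exact hx
      · obtain ⟨i, _, rfl⟩ := Finset.mem_image.mp hw
        rw [← map_pow, ZMod.pow_card]
    have h1 := (Finset.card_le_card hsub).trans (Multiset.toFinset_card_le _)
    have h2 := h1.trans (card_roots' _)
    rw [FiniteField.X_pow_card_sub_X_natDegree_eq Ω hp.out.one_lt, hc] at h2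
    omega
  obtain ⟨i, hi⟩ := this
  refine ⟨i.val, ?_⟩
  rw [← hi]
  conv_lhs => rw [← ZMod.natCast_zmod_val i]
  rw [map_natCast]

lemma as_diff (p : ℕ) [hp : Fact p.Prime] [CharP Ω p] {r : Ω} {a : E} (hr : r ^ p - r = algebraMap E Ω a)
    (σ : Ω ≃ₐ[E] Ω) : σ r = r + idx (σ r - r) := by
  have : ExpChar Ω p := ExpChar.prime hp.out
  have h1 : (σ r - r) ^ p = σ r - r := by
    rw [sub_pow_expChar]
    have h2 : (σ r) ^ p - σ r = r ^ p - r := by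
      rw [← map_pow, ← map_sub, hr, AlgEquiv.commutes]
    linear_combination h2
  have := idx_spec (fp_of_pow p h1)
  linear_combination this

variable [IsAlgClosure E Ω]

lemma sep_iff {x : Ω} : IsSeparable E x ↔ x ∈ separableClosure E Ω := mem_separableClosure_iff.symm

lemma L1 (p : ℕ) [hp : Fact p.Prime] [CharP E p]
    (K0 : IntermediateField E Ω) (hK0 : separableClosure E Ω ≤ K0)
    (hst : ∀ (σ : Ω ≃ₐ[E] Ω), ∀ x ∈ K0, σ x ∈ K0)
    (hKp : ∀ x ∈ K0, IsSeparable E (x ^ p))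
    (y : Ω) (b : E) (hy : y ^ p = algebraMap E Ω b) (hy0 : y ≠ 0)
    (β : (Ω ≃ₐ[E] Ω) → Ω) (hsm : Smooth β) (hβ0 : ∀ σ, β σ ≠ 0) (hβK : ∀ σ, β σ ∈ K0⟮y⟯)
    (hc : ∀ σ τ, IsSeparable E (β σ * σ (β τ) / β (σ * τ))) :
    ∃ (m r : Ω) (a : E) (n : (Ω ≃ₐ[E] Ω) → Ω), m ≠ 0 ∧ r ^ p - r = algebraMap E Ω a ∧ Smooth n ∧
      (∀ σ, n σ ≠ 0) ∧ (∀ σ, n σ ∈ K0) ∧ (∀ σ τ, IsSeparable E (n σ * σ (n τ) / n (σ * τ))) ∧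
      ∀ σ, β σ = (σ m / m) * y ^ idx (σ r - r) * n σ := by
  have hcharΩ : CharP Ω p := charP_of_injective_algebraMap (algebraMap E Ω).injective p
  have : ExpChar Ω p := ExpChar.prime Fact.out
  by_cases hyK : y ∈ K0
  · have hK : ∀ x ∈ K0⟮y⟯, x ∈ K0 := by
      intro x hx
      have : K0⟮y⟯ ≤ ⊥ := by
        rw [adjoin_simple_le_iff]
        exact ⟨⟨y, hyK⟩, rfl⟩
      obtain ⟨z, hz⟩ := this hx
      rw [← hz]
      exact z.2
    refine ⟨1, 0, 0, β, one_ne_zero, by simp [hp.out.ne_zero], hsm, hβ0, fun σ => hK _ (hβK σ), hc, ?_⟩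
    intro σ
    have : idx (0 : Ω) = 0 := by
      have h : ∃ i : ℕ, (0 : Ω) = i := ⟨0, by simp⟩
      classical
      rw [idx, dif_pos h]
      rw [Nat.find_eq_zero]; simp
    simp [this]
  obtain ⟨δ, hleib, hδ0, hδK, hδσ, heig, hex⟩ := der_exists p K0 hK0 hst y b hy hyK
  have hKK : ∀ a ∈ K0, a ∈ K0⟮y⟯ := fun a ha => K0⟮y⟯.algebraMap_mem ⟨a, ha⟩
  have hyσ : ∀ σ : Ω ≃ₐ[E] Ω, σ y = y := by
    intro σ
    apply frobenius_inj Ω p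
    simp only [frobenius_def]
    rw [← map_pow, hy, AlgEquiv.commutes]
  -- logarithmic derivative
  have hdl : ∀ a ∈ K0⟮y⟯, a ≠ 0 → ∀ c ∈ K0⟮y⟯, c ≠ 0 → δ (a * c) / (a * c) = δ a / a + δ c / c := by
    intro a ha ha0 c hc hc0
    rw [hleib a ha c hc]
    field_simp
    ring
  let h : (Ω ≃ₐ[E] Ω) → Ω := fun σ => δ (β σ) / β σ
  have hsh : Smooth h := hsm.comp (fun x => δ x / x)
  have hhK : ∀ σ, h σ ∈ K0⟮y⟯ := fun σ => div_mem (hδK _ (hβK σ)) (hβK σ)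
  have hhσ : ∀ (σ : Ω ≃ₐ[E] Ω), ∀ a ∈ K0⟮y⟯, σ (δ a / a) = δ (σ a) / σ a := by
    intro σ a ha
    rw [map_div₀, (hδσ σ a ha).2]
  have hhc : ∀ σ τ, h (σ * τ) = h σ + σ (h τ) := by
    intro σ τ
    have hcm := hK0 (sep_iff.mp (hc σ τ))
    set c := β σ * σ (β τ) / β (σ * τ) with hcdef
    have hc0 : c ≠ 0 := div_ne_zero (mul_ne_zero (hβ0 σ) (by simpa using hβ0 τ)) (hβ0 _)
    have heq : c * β (σ * τ) = β σ * σ (β τ) := by rw [hcdef]; exact div_mul_cancel₀ _ (hβ0 _)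
    have h1 := hdl c (hKK c hcm) hc0 (β (σ * τ)) (hβK _) (hβ0 _)
    have h2 := hdl (β σ) (hβK σ) (hβ0 σ) (σ (β τ)) (hδσ σ _ (hβK τ)).1 (by simpa using hβ0 τ)
    rw [heq, h2, hδ0 c hcm, zero_div, zero_add] at h1
    simp only [h]
    rw [hhσ σ _ (hβK τ), ← h1]
  obtain ⟨g, hg, hgσ⟩ := add_h90 p hsh hhc K0⟮y⟯.toSubfield.toSubring.toAddSubgroup (by
    intro σ m hm
    exact (mul_mem (hhK σ) (hKK m (hK0 (sep_iff.mp hm))) : h σ * m ∈ K0⟮y⟯))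
  obtain ⟨m, hmK, hm0, z, hz, hmz⟩ := hex g hg
  have hσm0 : ∀ σ : Ω ≃ₐ[E] Ω, σ m ≠ 0 := fun σ => by simpa using hm0
  have hβ' : ∀ σ, ∃ i : ℕ, z - σ z = i ∧ β σ / (σ m / m) / y ^ i ∈ K0 := by
    intro σ
    have hmem : β σ * m / σ m ∈ K0⟮y⟯ := div_mem (mul_mem (hβK σ) hmK) (hδσ σ m hmK).1
    have hne : β σ * m / σ m ≠ 0 := div_ne_zero (mul_ne_zero (hβ0 σ) hm0) (hσm0 σ)
    have e1 := hdl _ hmem hne (σ m) (hδσ σ m hmK).1 (hσm0 σ)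
    rw [div_mul_cancel₀ _ (hσm0 σ), hdl _ (hβK σ) (hβ0 σ) m hmK hm0, ← hhσ σ m hmK, hmz,
      mul_div_cancel_right₀ _ hm0, map_add] at e1
    have e2 : h σ = σ g - g := hgσ σ
    have e3 : δ (β σ) / β σ = h σ := rfl
    rw [e3, e2] at e1
    have e4 : δ (β σ * m / σ m) = (z - σ z) * (β σ * m / σ m) := by
      rw [← div_eq_iff hne]
      linear_combination -e1
    obtain ⟨i, hi, hmem'⟩ := heig _ hmem hne (z - σ z) (sub_mem hz (hst σ z hz)) e4
    refine ⟨i, hi, ?_⟩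
    convert hmem' using 2
    field_simp
  let r : Ω := -z ^ p
  have hrs : IsSeparable E r := sep_iff.mpr (neg_mem (sep_iff.mp (hKp z hz)))
  have hrσ : ∀ σ : Ω ≃ₐ[E] Ω, ∃ i : ℕ, σ r - r = i ∧ β σ / (σ m / m) / y ^ i ∈ K0 := by
    intro σ
    obtain ⟨i, hi, hmem⟩ := hβ' σ
    refine ⟨i, ?_, hmem⟩
    simp only [r, map_neg, map_pow]
    have : (z - σ z) ^ p = z - σ z := by
      rw [hi]; exact map_natCast (frobenius Ω p) i
    rw [← hi, ← this, sub_pow_expChar]; ring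
  obtain ⟨a, ha⟩ : ∃ a : E, algebraMap E Ω a = r ^ p - r := by
    apply mem_base_of_fixed
    · exact sep_iff.mpr (sub_mem (pow_mem (sep_iff.mp hrs) _) (sep_iff.mp hrs))
    · intro σ
      obtain ⟨i, hi, _⟩ := hrσ σ
      have hi' : σ r = r + i := by linear_combination hi
      rw [map_sub, map_pow, hi', add_pow_expChar]
      have : (i : Ω) ^ p = i := map_natCast (frobenius Ω p) i
      rw [this]; ring
  let n : (Ω ≃ₐ[E] Ω) → Ω := fun σ => β σ / (σ m / m) / y ^ idx (σ r - r)
  have hn0 : ∀ σ, n σ ≠ 0 := fun σ =>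
    div_ne_zero (div_ne_zero (hβ0 σ) (div_ne_zero (hσm0 σ) hm0)) (pow_ne_zero _ hy0)
  refine ⟨m, r, a, n, hm0, ha.symm, ?_, hn0, ?_, ?_, ?_⟩
  · refine ((hsm.comp₂ (Smooth.eval m) (fun b s => b / (s / m))).comp₂ (Smooth.eval r) 
      (fun b s => b / y ^ idx (s - r)))
  · intro σ
    obtain ⟨i, hi, hmem⟩ := hrσ σ
    have h2 := idx_spec ⟨i, hi⟩
    obtain ⟨e, he, hpow⟩ := pow_congr_base p hy hy0 (i := i) (j := idx (σ r - r)) (by rw [← hi, ← h2])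
    have : n σ = β σ / (σ m / m) / y ^ i * algebraMap E Ω e := by
      simp only [n]
      rw [hpow]
      have : algebraMap E Ω e ≠ 0 := by simpa using he
      field_simp
    rw [this]
    exact mul_mem hmem (K0.algebraMap_mem e)
  · intro σ τ
    have hi1 := as_diff p ha.symm σ
    have hi2 := as_diff p ha.symm τ
    have hi3 := as_diff p ha.symm (σ * τ)
    have hi : ((idx ((σ * τ) r - r) : ℕ) : Ω) = ((idx (σ r - r) + idx (τ r - r) : ℕ) : Ω) := by
      push_cast
      have h4 : (σ * τ) r = σ (τ r) := rfl
      rw [h4] at hi3 ⊢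
      have h5 : σ (τ r) = σ r + idx (τ r - r) := by
        conv_lhs => rw [hi2]
        rw [map_add, map_natCast]
      linear_combination h5 + hi1 - hi3
    obtain ⟨e, he, hpow⟩ := pow_congr_base p hy hy0 hi
    have he' : algebraMap E Ω e ≠ 0 := by simpa using he
    have hb0 := hβ0 (σ * τ)
    have hτ0 : σ (β τ) ≠ 0 := by simpa using hβ0 τ
    have hστ0 : σ (τ m) ≠ 0 := by simpa using hm0
    have : n σ * σ (n τ) / n (σ * τ) = (β σ * σ (β τ) / β (σ * τ)) * algebraMap E Ω e := by
      simp only [n]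
      rw [hpow, map_div₀, map_div₀, map_div₀, map_pow, hyσ, AlgEquiv.mul_apply, pow_add]
      have := hσm0 σ
      field_simp
    rw [this]
    exact sep_iff.mpr (mul_mem (sep_iff.mp (hc σ τ)) ((separableClosure E Ω).algebraMap_mem e))
  · intro σ
    simp only [n]
    have := hσm0 σ
    field_simp
end L1
end Tower

namespace Tower

section Decomp
open Polynomial IntermediateField
variable {E Ω : Type} [Field E] [Field Ω] [Algebra E Ω] [IsAlgClosure E Ω]

lemma sep_map (σ : Ω ≃ₐ[E] Ω) {x : Ω} (hx : IsSeparable E x) : IsSeparable E (σ x) :=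
  hx.map σ.toAlgHom σ.injective

lemma decomp (p : ℕ) [hp : Fact p.Prime] [CharP E p] (t ϖ : E) (ht : t ≠ 0) (hϖ : ϖ ≠ 0)
    (H5 : ∀ x : E, ∃ f : Fin p → Fin p → E, x = ∑ i, ∑ j, f i j ^ p * t ^ (i : ℕ) * ϖ ^ (j : ℕ))
    (x y : Ω) (hx : x ^ p = algebraMap E Ω t) (hy : y ^ p = algebraMap E Ω ϖ)
    (β : (Ω ≃ₐ[E] Ω) → Ω) (hsm : Smooth β) (hβ0 : ∀ σ, β σ ≠ 0)
    (hβp : ∀ σ, IsSeparable E (β σ ^ p))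
    (hc : ∀ σ τ, IsSeparable E (β σ * σ (β τ) / β (σ * τ))) :
    ∃ (m r₁ r₂ : Ω) (a₁ a₂ : E) (e : (Ω ≃ₐ[E] Ω) → Ω), m ≠ 0 ∧ r₁ ^ p - r₁ = algebraMap E Ω a₁ ∧
      r₂ ^ p - r₂ = algebraMap E Ω a₂ ∧ (∀ σ, e σ ≠ 0) ∧ (∀ σ, IsSeparable E (e σ)) ∧
      ∀ σ, β σ = (σ m / m) * x ^ idx (σ r₁ - r₁) * y ^ idx (σ r₂ - r₂) * e σ := by
  have halg := isAlgE E Ω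
  have hac := isAlgClosedE E Ω
  have hcharΩ : CharP Ω p := charP_of_injective_algebraMap (algebraMap E Ω).injective p
  have : ExpChar Ω p := ExpChar.prime Fact.out
  have : ExpChar E p := ExpChar.prime Fact.out
  have hx0 : x ≠ 0 := by
    rintro rfl
    rw [zero_pow hp.out.ne_zero] at hx
    exact ht ((map_eq_zero (algebraMap E Ω)).mp hx.symm)
  have hy0 : y ≠ 0 := by
    rintro rfl
    rw [zero_pow hp.out.ne_zero] at hy
    exact hϖ ((map_eq_zero (algebraMap E Ω)).mp hy.symm)
  have hxσ : ∀ σ : Ω ≃ₐ[E] Ω, σ x = x := by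
    intro σ
    apply frobenius_inj Ω p
    simp only [frobenius_def]
    rw [← map_pow, hx, AlgEquiv.commutes]
  let M := separableClosure E Ω
  let K1 : IntermediateField E Ω := (M⟮x⟯).restrictScalars E
  have hMK : M ≤ K1 := by
    intro z hz
    exact (M⟮x⟯).algebraMap_mem ⟨z, hz⟩
  have hst : ∀ (σ : Ω ≃ₐ[E] Ω), ∀ z ∈ K1, σ z ∈ K1 := by
    intro σ z hz
    change z ∈ M⟮x⟯ at hz
    change σ z ∈ M⟮x⟯
    induction hz using IntermediateField.adjoin_induction with
    | mem z hz => rw [Set.mem_singleton_iff.mp hz, hxσ]; exact mem_adjoin_simple_self M x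
    | algebraMap z => exact (M⟮x⟯).algebraMap_mem ⟨σ z, sep_iff.mp (sep_map σ (sep_iff.mpr z.2))⟩
    | add a b _ _ ha hb => rw [map_add]; exact add_mem ha hb
    | inv a _ ha => rw [map_inv₀]; exact inv_mem ha
    | mul a b _ _ ha hb => rw [map_mul]; exact mul_mem ha hb
  have hKp : ∀ z ∈ K1, IsSeparable E (z ^ p) := by
    intro z hz
    change z ∈ M⟮x⟯ at hz
    rw [sep_iff]
    induction hz using IntermediateField.adjoin_induction with
    | mem z hz => rw [Set.mem_singleton_iff.mp hz, hx]; exact M.algebraMap_mem t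
    | algebraMap z => exact pow_mem z.2 _
    | add a b _ _ ha hb => rw [add_pow_expChar]; exact add_mem ha hb
    | inv a _ ha => rw [inv_pow]; exact inv_mem ha
    | mul a b _ _ ha hb => rw [mul_pow]; exact mul_mem ha hb
  have hKy : ∀ a ∈ K1, a ∈ K1⟮y⟯ := fun a ha => K1⟮y⟯.algebraMap_mem ⟨a, ha⟩
  have hβK : ∀ σ, β σ ∈ K1⟮y⟯ := by
    intro σ
    let φ := (frobeniusEquiv Ω p).symm
    have hφ : ∀ z, φ (z ^ p) = z := fun z => frobeniusEquiv_symm_apply_frobenius Ω p z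
    have hw := adjoin_simple_eq_adjoin_pow_expChar_of_isSeparable E Ω (hβp σ) p
    have hmem : β σ ^ p ∈ E⟮(β σ ^ p) ^ p⟯ := by
      rw [← hw]; exact mem_adjoin_simple_self _ _
    have key : ∀ z ∈ E⟮(β σ ^ p) ^ p⟯, φ z ∈ K1⟮y⟯ := by
      intro z hz
      induction hz using IntermediateField.adjoin_induction with
      | mem z hz => 
        rw [Set.mem_singleton_iff.mp hz, hφ]
        exact hKy _ (hMK (sep_iff.mp (hβp σ)))
      | algebraMap z =>
        obtain ⟨f, hf⟩ := H5 z
        rw [hf, map_sum, map_sum]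
        refine sum_mem fun i _ => ?_
        rw [map_sum, map_sum]
        refine sum_mem fun j _ => ?_
        have hcalc : φ (algebraMap E Ω (f i j ^ p * t ^ (i : ℕ) * ϖ ^ (j : ℕ)))
            = algebraMap E Ω (f i j) * x ^ (i : ℕ) * y ^ (j : ℕ) := by
          have h1 : algebraMap E Ω (f i j ^ p * t ^ (i : ℕ) * ϖ ^ (j : ℕ))
            = (algebraMap E Ω (f i j) * x ^ (i : ℕ) * y ^ (j : ℕ)) ^ p := by
            simp only [map_mul, map_pow]
            rw [← hx, ← hy]; ring
          rw [h1, hφ]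
        rw [hcalc]
        refine mul_mem (mul_mem ?_ ?_) ?_
        · exact hKy _ (K1.algebraMap_mem _)
        · exact pow_mem (hKy _ (mem_adjoin_simple_self M x)) _
        · exact pow_mem (mem_adjoin_simple_self K1 y) _
      | add a b _ _ ha hb => rw [map_add]; exact add_mem ha hb
      | inv a _ ha => rw [map_inv₀]; exact inv_mem ha
      | mul a b _ _ ha hb => rw [map_mul]; exact mul_mem ha hb
    have := key _ hmem
    rwa [hφ] at this
  obtain ⟨m₂, r₂, a₂, n₂, hm₂, hr₂, hs₂, hn₂, hnK₂, hnc₂, heq₂⟩ :=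
    L1 p K1 hMK hst hKp y ϖ hy hy0 β hsm hβ0 hβK hc
  obtain ⟨m₁, r₁, a₁, n₁, hm₁, hr₁, hs₁, hn₁, hnK₁, hnc₁, heq₁⟩ :=
    L1 p M le_rfl (fun σ z hz => sep_iff.mp (sep_map σ (sep_iff.mpr hz)))
      (fun z hz => sep_iff.mpr (pow_mem hz _)) x t hx hx0 n₂ hs₂ hn₂ hnK₂ hnc₂
  refine ⟨m₂ * m₁, r₁, r₂, a₁, a₂, n₁, mul_ne_zero hm₂ hm₁, hr₁, hr₂, hn₁,
    fun σ => sep_iff.mpr (hnK₁ σ), fun σ => ?_⟩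
  rw [heq₂ σ, heq₁ σ, map_mul]
  field_simp
end Decomp
end Tower

namespace Tower

section Sym
open Polynomial

lemma prod_add_natCast {Ω : Type} [Field Ω] (p : ℕ) [hp : Fact p.Prime] [CharP Ω p] (x : Ω) :
    ∏ i ∈ Finset.range p, (x + i) = x ^ p - x := by
  have hr : roots (X ^ p - X : (ZMod p)[X]) = Finset.univ.val := by
    have := FiniteField.roots_X_pow_card_sub_X (ZMod p)
    rwa [ZMod.card] at this
  have hdeg := FiniteField.X_pow_card_sub_X_natDegree_eq (ZMod p) hp.out.one_lt
  have hm : (X ^ p - X : (ZMod p)[X]).Monic := by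
    apply monic_X_pow_sub
    rw [degree_X]
    exact_mod_cast hp.out.one_lt
  have h := prod_multiset_X_sub_C_of_monic_of_roots_card_eq hm (by
    rw [hr, hdeg]
    simp [ZMod.card])
  rw [hr] at h
  have h2 := congrArg (eval₂ (ZMod.castHom (dvd_refl p) Ω) x) h
  have h3 : (Multiset.map (fun a : ZMod p => X - C a) Finset.univ.val).prod
    = ∏ a : ZMod p, (X - C a) := rfl
  rw [h3, eval₂_finsetProd] at h2
  simp only [eval₂_sub, eval₂_X, eval₂_C, eval₂_pow] at h2
  rw [← h2]
  refine Finset.prod_nbij' (fun i => -(i : ZMod p)) (fun a => (-a).val) ?_ ?_ ?_ ?_ ?_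
  · simp
  · intro a _
    simpa using ZMod.val_lt (-a)
  · intro i hi
    simp [ZMod.val_natCast, Nat.mod_eq_of_lt (Finset.mem_range.mp hi)]
  · intro a _
    simp
  · intro i _
    rw [map_neg, map_natCast]; ring

variable {E Ω : Type} [Field E] [Field Ω] [Algebra E Ω]

lemma as_sep (p : ℕ) [hp : Fact p.Prime] [CharP E p] {r : Ω} {a : E}
    (hr : r ^ p - r = algebraMap E Ω a) : IsSeparable E r := by
  have h0 : aeval r (X ^ p - X - C a : E[X]) = 0 := by
    simp [hr]
  have hsep : (X ^ p - X - C a : E[X]).Separable := by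
    rw [separable_def]
    have : derivative (X ^ p - X - C a : E[X]) = -1 := by
      simp [derivative_X_pow]
    rw [this]
    exact isCoprime_one_right.neg_right
  exact hsep.of_dvd (minpoly.dvd E r h0)

variable (E Ω) in
/-- functions that become separable after a coboundary change -/
def Bsub : Subgroup ((Ω ≃ₐ[E] Ω) → Ωˣ) where
  carrier := {f | ∃ m : Ω, m ≠ 0 ∧ ∀ σ, IsSeparable E ((f σ : Ω) * (m / σ m))}
  one_mem' := ⟨1, one_ne_zero, fun σ => by simpa using isSeparable_algebraMap (F := E) (K := Ω) (1 : E)⟩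
  mul_mem' := by
    rintro f g ⟨m, hm, h⟩ ⟨m', hm', h'⟩
    refine ⟨m * m', mul_ne_zero hm hm', fun σ => ?_⟩
    have := mem_separableClosure_iff.mp
      (mul_mem (mem_separableClosure_iff.mpr (h σ)) (mem_separableClosure_iff.mpr (h' σ)))
    convert this using 1
    rw [Pi.mul_apply, Units.val_mul, map_mul]
    field_simp
  inv_mem' := by
    rintro f ⟨m, hm, h⟩
    refine ⟨m⁻¹, inv_ne_zero hm, fun σ => ?_⟩
    have := mem_separableClosure_iff.mp
      (inv_mem (mem_separableClosure_iff.mpr (h σ)))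
    convert this using 1
    rw [Pi.inv_apply, Units.val_inv_eq_inv_val, map_inv₀]
    field_simp

variable (E Ω) in
/-- the group in which symbols live -/
def HH : Type := Additive (((Ω ≃ₐ[E] Ω) → Ωˣ) ⧸ Bsub E Ω)

instance : AddCommGroup (HH E Ω) :=
  inferInstanceAs (AddCommGroup (Additive (((Ω ≃ₐ[E] Ω) → Ωˣ) ⧸ Bsub E Ω)))

/-- class of a function -/
def cls (f : (Ω ≃ₐ[E] Ω) → Ωˣ) : HH E Ω :=
  (Additive.ofMul (QuotientGroup.mk f) : Additive (((Ω ≃ₐ[E] Ω) → Ωˣ) ⧸ Bsub E Ω))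

lemma cls_mul (f g : (Ω ≃ₐ[E] Ω) → Ωˣ) : cls (f * g) = cls f + cls g := rfl

lemma cls_eq_zero {f : (Ω ≃ₐ[E] Ω) → Ωˣ} : cls f = 0 ↔
    ∃ m : Ω, m ≠ 0 ∧ ∀ σ, IsSeparable E ((f σ : Ω) * (m / σ m)) :=
  QuotientGroup.eq_one_iff f

lemma cls_eq {f g : (Ω ≃ₐ[E] Ω) → Ωˣ} : cls f = cls g ↔
    ∃ m : Ω, m ≠ 0 ∧ ∀ σ, IsSeparable E ((f σ : Ω) / g σ * (m / σ m)) := by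
  have : cls f = cls g ↔ cls (f / g) = 0 := by
    have h : cls (f / g) = cls f - cls g := rfl
    rw [h, sub_eq_zero]
  rw [this, cls_eq_zero]
  simp

lemma cls_add_cls_inv (f : (Ω ≃ₐ[E] Ω) → Ωˣ) (n : ℕ) : cls (f ^ n) = n • cls f := rfl


lemma as_root_exists [IsAlgClosed Ω] (p : ℕ) [hp : Fact p.Prime] (a : Ω) : ∃ r : Ω, r ^ p - r = a := by
  have hdeg : (X ^ p - X - C a : Polynomial Ω).degree ≠ 0 := by
    have h1 : (X ^ p - X - C a : Polynomial Ω).natDegree = p := by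
      rw [natDegree_sub_C, FiniteField.X_pow_card_sub_X_natDegree_eq Ω hp.out.one_lt]
    intro h
    have := natDegree_eq_of_degree_eq_some h
    rw [h1] at this
    exact hp.out.ne_zero this
  obtain ⟨r, hr⟩ := IsAlgClosed.exists_root _ hdeg
  refine ⟨r, ?_⟩
  simp only [IsRoot.def, eval_sub, eval_pow, eval_X, eval_C] at hr
  linear_combination hr

lemma pth_root_exists [IsAlgClosed Ω] (p : ℕ) [hp : Fact p.Prime] (b : Ωˣ) : ∃ s : Ωˣ, s ^ p = b := by
  obtain ⟨z, hz⟩ := IsAlgClosed.exists_pow_nat_eq (b : Ω) hp.out.pos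
  have hz0 : z ≠ 0 := by
    rintro rfl
    rw [zero_pow hp.out.ne_zero] at hz
    exact b.ne_zero hz.symm
  exact ⟨Units.mk0 z hz0, by ext; simpa using hz⟩

variable [IsAlgClosure E Ω] (p : ℕ) [hp : Fact p.Prime] [CharP E p]

variable (Ω) in
/-- chosen root -/
def rt (a : E) : Ω := (haveI := isAlgClosedE E Ω; as_root_exists (Ω := Ω) p (algebraMap E Ω a)).choose
lemma rt_spec (a : E) : rt Ω p a ^ p - rt Ω p a = algebraMap E Ω a :=
  (haveI := isAlgClosedE E Ω; as_root_exists (Ω := Ω) p (algebraMap E Ω a)).choose_spec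

variable (Ω) in
/-- chosen root -/
def pr (b : Eˣ) : Ωˣ := (haveI := isAlgClosedE E Ω; pth_root_exists (Ω := Ω) p (Units.map (algebraMap E Ω) b)).choose
lemma pr_spec (b : Eˣ) : pr Ω p b ^ p = Units.map (algebraMap E Ω) b :=
  haveI := isAlgClosedE E Ω
  (pth_root_exists (Ω := Ω) p (Units.map (algebraMap E Ω : E →* Ω) b)).choose_spec

variable (Ω) in
/-- the symbol -/
def sym0 (a : E) (b : Eˣ) : HH E Ω := cls fun σ => pr Ω p b ^ idx (σ (rt Ω p a) - rt Ω p a)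

lemma sym0_eq (a : E) (b : Eˣ) (r : Ω) (hr : r ^ p - r = algebraMap E Ω a) (s : Ωˣ)
    (hs : s ^ p = Units.map (algebraMap E Ω) b) (i : (Ω ≃ₐ[E] Ω) → ℕ) (hi : ∀ σ, σ r = r + i σ) :
    sym0 Ω p a b = cls fun σ => s ^ i σ := by
  have hcharΩ : CharP Ω p := charP_of_injective_algebraMap (algebraMap E Ω).injective p
  have : ExpChar Ω p := ExpChar.prime Fact.out
  have hsr : pr Ω p b = s := by
    ext
    apply frobenius_inj Ω p
    simp only [frobenius_def]
    rw [← Units.val_pow_eq_pow_val, pr_spec, ← hs, Units.val_pow_eq_pow_val]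
  have hs' : (s : Ω) ^ p = algebraMap E Ω (b : E) := by
    rw [← Units.val_pow_eq_pow_val, hs]; rfl
  have hd : (rt Ω p a - r) ^ p = rt Ω p a - r := by
    rw [sub_pow_expChar]
    linear_combination rt_spec (Ω := Ω) p a - hr
  obtain ⟨c, hc⟩ := fp_of_pow p hd
  rw [sym0, cls_eq]
  refine ⟨1, one_ne_zero, fun σ => ?_⟩
  have hσ : σ (rt Ω p a) - rt Ω p a = i σ := by
    have h1 : rt Ω p a = r + c := by linear_combination hc
    rw [h1, map_add, map_natCast, hi]; ring
  have h2 := idx_spec ⟨_, hσ⟩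
  obtain ⟨e, he, hpow⟩ := pow_congr_base p hs' s.ne_zero
    (i := idx (σ (rt Ω p a) - rt Ω p a)) (j := i σ) (by rw [← h2, hσ])
  rw [hsr]
  push_cast
  rw [hpow, mul_div_assoc, mul_comm, map_one, div_one, one_mul, mul_div_assoc', mul_comm,
    mul_div_cancel_right₀ _ (pow_ne_zero _ s.ne_zero)]
  exact isSeparable_algebraMap e

lemma rt_diff (a : E) (σ : Ω ≃ₐ[E] Ω) : σ (rt Ω p a) = rt Ω p a + idx (σ (rt Ω p a) - rt Ω p a) :=
  have hcharΩ : CharP Ω p := charP_of_injective_algebraMap (algebraMap E Ω).injective p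
  as_diff p (rt_spec p a) σ

variable (Ω) in
/-- the symbol as a bilinear map -/
def sym : E →+ Additive Eˣ →+ HH E Ω :=
  AddMonoidHom.mk' (fun a => AddMonoidHom.mk' (fun b => sym0 Ω p a b.toMul) (by
    intro b b'
    rw [toMul_add, sym0_eq p a (b.toMul * b'.toMul) (rt Ω p a) (rt_spec p a) (pr Ω p b.toMul * pr Ω p b'.toMul)
      (by rw [mul_pow, pr_spec, pr_spec, map_mul]) _ (rt_diff p a)]
    simp only [mul_pow]
    rfl)) (by
    have hcharΩ : CharP Ω p := charP_of_injective_algebraMap (algebraMap E Ω).injective p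
    have : ExpChar Ω p := ExpChar.prime Fact.out
    intro a a'
    refine DFunLike.ext _ _ fun b => ?_
    change sym0 Ω p (a + a') b.toMul = sym0 Ω p a b.toMul + sym0 Ω p a' b.toMul
    rw [sym0_eq p (a + a') b.toMul (rt Ω p a + rt Ω p a')
      (by rw [add_pow_expChar, map_add]; linear_combination rt_spec (Ω := Ω) p a + rt_spec (Ω := Ω) p a')
      (pr Ω p b.toMul) (pr_spec p _)
      (fun σ => idx (σ (rt Ω p a) - rt Ω p a) + idx (σ (rt Ω p a') - rt Ω p a'))
      (by intro σ
          have h1 := rt_diff (Ω := Ω) p a σ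
          have h2 := rt_diff (Ω := Ω) p a' σ
          rw [map_add]
          push_cast
          linear_combination h1 + h2)]
    simp only [pow_add]
    rfl)

/-- abbreviation for the symbol of a field element and nonzero element -/
lemma sym_apply (a : E) (b : Eˣ) : sym Ω p a (Additive.ofMul b) = sym0 Ω p a b := rfl

lemma sym_wp (x : E) (b : Additive Eˣ) : sym Ω p (x ^ p - x) b = 0 := by
  change sym0 Ω p (x ^ p - x) b.toMul = 0
  rw [sym0_eq p _ b.toMul (algebraMap E Ω x) (by simp) (pr Ω p b.toMul) (pr_spec p _) (fun _ => 0)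
    (by simp)]
  simp only [pow_zero]
  rfl

lemma sym_self (f : Eˣ) : sym Ω p (f : E) (Additive.ofMul f) = 0 := by
  have hcharΩ : CharP Ω p := charP_of_injective_algebraMap (algebraMap E Ω).injective p
  have : ExpChar Ω p := ExpChar.prime Fact.out
  have hac := isAlgClosedE E Ω
  rw [sym_apply, sym0, cls_eq_zero]
  have hr := rt_spec (Ω := Ω) p (f : E)
  have hrs : IsSeparable E (rt Ω p (f : E)) := as_sep p hr
  have hd := rt_diff (Ω := Ω) p (f : E)
  set r := rt Ω p (f : E) with hrdef
  have hs : (pr Ω p f : Ω) ^ p = algebraMap E Ω f := by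
    rw [← Units.val_pow_eq_pow_val, pr_spec]; rfl
  set s := pr Ω p f with hsdef
  let φ := (frobeniusEquiv Ω p).symm
  have hφ : ∀ z, φ (z ^ p) = z := fun z => frobeniusEquiv_symm_apply_frobenius Ω p z
  have hφ' : ∀ z, (φ z) ^ p = z := fun z => frobeniusEquiv_symm_pow_p Ω p z
  let ρ : ℕ → Ω := fun i => φ (r + i)
  have hρp : ∀ i, ρ i ^ p = r + i := fun i => hφ' _
  have hri : ∀ i : ℕ, r + i ≠ 0 := by
    intro i h
    have h1 : (r + i) ^ p - (r + i) = algebraMap E Ω f := by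
      rw [add_pow_expChar, ← hr]
      have : (i : Ω) ^ p = i := map_natCast (frobenius Ω p) i
      rw [this]; ring
    rw [h, zero_pow hp.out.ne_zero, sub_zero] at h1
    exact f.ne_zero ((map_eq_zero (algebraMap E Ω)).mp h1.symm)
  have hρ0 : ∀ i, ρ i ≠ 0 := by
    intro i h
    apply hri i
    rw [← hρp, h, zero_pow hp.out.ne_zero]
  have hρper : ∀ i, ρ (p + i) = ρ i := by
    intro i; simp only [ρ]; congr 1; push_cast; simp
  have hρprod : ∀ c, ∏ i ∈ Finset.range p, ρ (i + c) = s := by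
    intro c
    apply frobenius_inj Ω p
    simp only [frobenius_def]
    rw [← Finset.prod_pow, hs, ← hr]
    have : ∀ i ∈ Finset.range p, ρ (i + c) ^ p = (r + c) + i := by
      intro i _; rw [hρp]; push_cast; ring
    rw [Finset.prod_congr rfl this, prod_add_natCast, add_pow_expChar]
    have : (c : Ω) ^ p = c := map_natCast (frobenius Ω p) c
    rw [this]; ring
  let P : ℕ → Ω := fun c => ∏ i ∈ Finset.range p, ρ (i + c) ^ i
  have hP0 : ∀ c, P c ≠ 0 := fun c => Finset.prod_ne_zero_iff.mpr fun i _ => pow_ne_zero _ (hρ0 _)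
  have hPs : ∀ c, P (c + 1) * s = P c * (r + c) := by
    intro c
    rw [← hρprod (c + 1), ← Finset.prod_mul_distrib]
    have h1 : ∀ i ∈ Finset.range p, ρ (i + (c + 1)) ^ i * ρ (i + (c + 1)) = ρ ((i + 1) + c) ^ (i + 1) := by
      intro i _
      rw [← pow_succ]; congr 2; ring
    rw [Finset.prod_congr rfl h1]
    have h2 := Finset.prod_range_succ' (fun j => ρ (j + c) ^ j) p
    have h3 := Finset.prod_range_succ (fun j => ρ (j + c) ^ j) p
    simp only [pow_zero, mul_one] at h2
    rw [← h2, h3, hρper, hρp]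
  have hPc : ∀ c, P c * s ^ c = P 0 * ∏ j ∈ Finset.range c, (r + j) := by
    intro c
    induction c with
    | zero => simp
    | succ c ih =>
      rw [Finset.prod_range_succ, pow_succ']
      linear_combination (s : Ω) ^ c * hPs c + (r + c) * ih
  have hσρ : ∀ (σ : Ω ≃ₐ[E] Ω) i, σ (ρ i) = ρ (i + idx (σ r - r)) := by
    intro σ i
    apply frobenius_inj Ω p
    simp only [frobenius_def]
    rw [← map_pow, hρp, hρp, map_add, map_natCast]
    push_cast
    linear_combination hd σ
  have hσP : ∀ σ : Ω ≃ₐ[E] Ω, σ (P 0) = P (idx (σ r - r)) := by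
    intro σ
    simp only [P, map_prod, map_pow, hσρ, add_zero]
  refine ⟨(P 0)⁻¹, inv_ne_zero (hP0 0), fun σ => ?_⟩
  have : ((s ^ idx (σ r - r) : Ωˣ) : Ω) * ((P 0)⁻¹ / σ (P 0)⁻¹) = ∏ j ∈ Finset.range (idx (σ r - r)), (r + j) := by
    rw [map_inv₀, hσP]
    have := hPc (idx (σ r - r))
    have h0 := hP0 0
    have h1 := hP0 (idx (σ r - r))
    push_cast
    field_simp
    linear_combination this
  rw [this]
  rw [← mem_separableClosure_iff]
  refine prod_mem fun j _ => add_mem (mem_separableClosure_iff.mpr hrs) ?_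
  exact natCast_mem _ _

end Sym
end Tower

namespace Tower

section Bracket
variable {E H : Type} [Field E] [AddCommGroup H]

/-- symbol extended by zero -/
def br (S : E →+ Additive Eˣ →+ H) (a b : E) : H :=
  open Classical in if hb : b = 0 then 0 else S a (Additive.ofMul (Units.mk0 b hb))

variable (S : E →+ Additive Eˣ →+ H)

lemma br_ne (a : E) {b : E} (hb : b ≠ 0) : br S a b = S a (Additive.ofMul (Units.mk0 b hb)) := by
  rw [br, dif_neg hb]

lemma br_zero_left (b : E) : br S 0 b = 0 := by
  rw [br]; split_ifs <;> simp

lemma br_add (a a' b : E) : br S (a + a') b = br S a b + br S a' b := by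
  simp only [br]; split_ifs <;> simp

lemma br_neg (a b : E) : br S (-a) b = - br S a b := by
  simp only [br]; split_ifs <;> simp

lemma br_sub (a a' b : E) : br S (a - a') b = br S a b - br S a' b := by
  simp only [br]; split_ifs <;> simp

lemma br_sum {ι : Type} (s : Finset ι) (f : ι → E) (b : E) :
    br S (∑ i ∈ s, f i) b = ∑ i ∈ s, br S (f i) b := by
  classical
  induction s using Finset.induction_on with
  | empty => simp [br_zero_left]
  | insert i s hi ih => rw [Finset.sum_insert hi, Finset.sum_insert hi, br_add, ih]

lemma br_int (n : ℤ) (a b : E) : br S ((n : E) * a) b = n • br S a b := by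
  simp only [br]; split_ifs
  · simp
  · rw [← zsmul_eq_mul, map_zsmul, AddMonoidHom.coe_smul, Pi.smul_apply]

lemma br_nat (n : ℕ) (a b : E) : br S ((n : E) * a) b = n • br S a b := by
  have := br_int S n a b
  simpa using this

lemma br_mul (a : E) {b c : E} (hb : b ≠ 0) (hc : c ≠ 0) : br S a (b * c) = br S a b + br S a c := by
  rw [br_ne S a hb, br_ne S a hc, br_ne S a (mul_ne_zero hb hc), ← map_add, ← ofMul_mul]
  congr; ext; simp

lemma br_one (a : E) : br S a 1 = 0 := by
  have := br_mul S a (b := 1) (c := 1) one_ne_zero one_ne_zero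
  rw [mul_one] at this
  exact left_eq_add.mp this

lemma br_inv (a : E) {b : E} (hb : b ≠ 0) : br S a b⁻¹ = - br S a b := by
  have := br_mul S a hb (inv_ne_zero hb)
  rw [mul_inv_cancel₀ hb, br_one] at this
  exact (neg_eq_of_add_eq_zero_right this.symm).symm

lemma br_div (a : E) {b c : E} (hb : b ≠ 0) (hc : c ≠ 0) : br S a (b / c) = br S a b - br S a c := by
  rw [div_eq_mul_inv, br_mul S a hb (inv_ne_zero hc), br_inv S a hc, sub_eq_add_neg]

lemma br_pow (a : E) {b : E} (hb : b ≠ 0) (n : ℕ) : br S a (b ^ n) = n • br S a b := by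
  induction n with
  | zero => simp [br_one]
  | succ n ih => rw [pow_succ, br_mul S a (pow_ne_zero _ hb) hb, ih, succ_nsmul]

variable (p : ℕ) [hp : Fact p.Prime] [CharP E p]
  (hwp : ∀ x b, S (x ^ p - x) b = 0) (hself : ∀ f : Eˣ, S (f : E) (Additive.ofMul f) = 0)

include hwp in
lemma br_wp (x b : E) : br S (x ^ p - x) b = 0 := by
  rw [br]; split_ifs
  · rfl
  · exact hwp _ _

include hwp in
lemma br_pth (x b : E) : br S (x ^ p) b = br S x b := by
  have := br_wp S p hwp x b
  rwa [br_sub, sub_eq_zero] at this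

include hself in
lemma br_self (x : E) : br S x x = 0 := by
  rw [br]; split_ifs with h
  · rfl
  · exact hself (Units.mk0 x h)

lemma br_tors (a b : E) : p • br S a b = 0 := by
  rw [← br_nat]; simp [br_zero_left]

include hself in
lemma br_leib2 (h g : E) : br S (h * g) g = - br S (h * g) h := by
  by_cases hg : g = 0
  · subst hg; simp [br_zero_left]
  by_cases hh : h = 0
  · subst hh; simp [br_zero_left]
  have := br_self S hself (h * g)
  rw [br_mul S _ hh hg] at this
  exact (neg_eq_of_add_eq_zero_right this).symm

include hself in
lemma br_leib (h g g' : E) : br S (h * (g + g')) (g + g') = br S (h * g) g + br S (h * g') g' := by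
  rw [br_leib2 S hself, br_leib2 S hself h g, br_leib2 S hself h g', mul_add, br_add]; abel

include hself in
lemma br_leib_sum {ι : Type} (s : Finset ι) (h : E) (g : ι → E) :
    br S (h * ∑ i ∈ s, g i) (∑ i ∈ s, g i) = ∑ i ∈ s, br S (h * g i) (g i) := by
  classical
  induction s using Finset.induction_on with
  | empty => simp [br_zero_left]
  | insert i s hi ih => rw [Finset.sum_insert hi, Finset.sum_insert hi, br_leib S hself, ih]

include hself in
lemma br_one_add (Y : E) {z : E} (hz : 1 + z ≠ 0) : br S Y (1 + z) = br S (Y * z / (1 + z)) z := by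
  have := br_leib S hself (Y / (1 + z)) 1 z
  rw [div_mul_cancel₀ _ hz, br_one, zero_add] at this
  rw [this]; congr 1; ring

include hself in
/-- `[Y,A) = -[A,1+Y/A) - [Y,1+Y/A)` -/
lemma br_swap {A Y : E} (hA : A ≠ 0) (hz : 1 + Y / A ≠ 0) :
    br S Y A = - br S A (1 + Y / A) - br S Y (1 + Y / A) := by
  have h := br_self S hself (A + Y)
  have h2 : A + Y = A * (1 + Y / A) := by field_simp
  have h3 : br S (A + Y) (A * (1 + Y / A)) = 0 := by rw [← h2]; exact h
  rw [br_mul S _ hA hz, br_add, br_add, br_self S hself A] at h3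
  have h4 : br S Y A + (br S A (1 + Y / A) + br S Y (1 + Y / A)) = 0 := by rw [← h3]; abel
  rw [eq_neg_of_add_eq_zero_left h4]; abel

lemma exists_inv_mod (p : ℕ) [hp : Fact p.Prime] {s : ℤ} (hs : ¬ (p : ℤ) ∣ s) :
    ∃ c : ℤ, (p : ℤ) ∣ c * s - 1 := by
  have h : IsCoprime s (p : ℤ) := by
    have : Prime (p : ℤ) := Nat.prime_iff_prime_int.mp hp.out
    exact ((Prime.coprime_iff_not_dvd this).mpr hs).symm
  obtain ⟨a, b, hab⟩ := h
  exact ⟨a, -b, by linear_combination hab⟩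

include hself in
/-- kill: `[f^p t^s, t) = 0` for `p ∤ s` -/
lemma br_kill {f t : E} (ht : t ≠ 0) {s : ℤ} (hs : ¬ (p : ℤ) ∣ s) : br S (f ^ p * t ^ s) t = 0 := by
  by_cases hf : f = 0
  · subst hf; rw [zero_pow hp.out.ne_zero, zero_mul, br_zero_left]
  have hz : ∀ (a : E) (n : ℤ), br S a (t ^ n) = n • br S a t := by
    intro a n
    rcases n with n | n
    · simpa using br_pow S a ht n
    · rw [zpow_negSucc, br_inv S a (pow_ne_zero _ ht), br_pow S a ht, negSucc_zsmul]
  have h := br_self S hself (f ^ p * t ^ s)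
  rw [br_mul S _ (pow_ne_zero _ hf) (zpow_ne_zero _ ht), br_pow S _ hf, br_tors S p, zero_add, hz] at h
  obtain ⟨c, d, hc⟩ := exists_inv_mod p hs
  have h1 : (c * s - 1 : ℤ) • br S (f ^ p * t ^ s) t = 0 := by
    rw [hc, mul_comm, mul_zsmul, natCast_zsmul, br_tors S p, zsmul_zero]
  rw [sub_zsmul, mul_zsmul, h, zsmul_zero, one_zsmul, zero_add, neg_eq_zero] at h1
  exact h1

end Bracket
end Tower

namespace Tower

section Loc
lemma fin_eq_of_dvd {p : ℕ} {i i' : Fin p} (h : (p : ℤ) ∣ (i : ℤ) - (i' : ℤ)) : i = i' := by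
  ext
  have h1 := i.2
  have h2 := i'.2
  obtain ⟨c, hc⟩ := h
  have : c = 0 := by
    by_contra hne
    rcases lt_or_gt_of_ne hne with h | h
    · nlinarith
    · nlinarith
  subst this
  omega

variable {E Γ : Type} [Field E] [LinearOrderedCommGroupWithZero Γ] 

/-- abstract two-dimensional local field of characteristic `p`, basic part -/
structure Loc1 (p : ℕ) (V : Valuation E Γ) (t ϖ : E) : Prop where
  t0 : t ≠ 0
  ϖ0 : ϖ ≠ 0
  tlt : V t < 1
  ϖlt : ∀ n : ℕ, V ϖ < V t ^ n
  val : ∀ x, x ≠ 0 → ∃ n s : ℤ, V x = V ϖ ^ n * V t ^ s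
  H2 : ∀ x, V x < 1 → ∃ y, y ^ p - y = x
  fin : ∃ R : Finset E, ∀ x, V x ≤ 1 → ∃ r ∈ R, V (x - r) < 1

/-- abstract two-dimensional local field of characteristic `p` -/
structure Loc2 (p : ℕ) (V : Valuation E Γ) (t ϖ c0 : E) : Prop extends Loc1 p V t ϖ where
  H3 : ∀ x, V x ≤ 1 → ∃ c, V (x - c ^ p) < 1
  H4 : ∀ x, V x ≤ 1 → ∃ (j : ℕ) (y : E), x = j * c0 + (y ^ p - y)
  H4' : V c0 ≤ 1
  Hc : ∀ y, V y ≤ 1 → ¬ V (y ^ p - y - c0) < 1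
  H5 : ∀ x : E, ∃ f : Fin p → Fin p → E, x = ∑ i, ∑ j, f i j ^ p * t ^ (i : ℕ) * ϖ ^ (j : ℕ)

variable {p : ℕ} {V : Valuation E Γ} {t ϖ : E} (L : Loc1 p V t ϖ)
include L

lemma Loc1.Vt0 : 0 < V t := zero_lt_iff.mpr (by simpa using L.t0)
lemma Loc1.Vϖ0 : 0 < V ϖ := zero_lt_iff.mpr (by simpa using L.ϖ0)
lemma Loc1.Vϖlt : V ϖ < 1 := by simpa using L.ϖlt 0

lemma Loc1.lex_lt {n : ℤ} (hn : 0 < n) (s : ℤ) : V ϖ ^ n * V t ^ s < 1 := by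
  have h1 : V ϖ ^ n ≤ V ϖ := by
    have := zpow_le_zpow_right_of_le_one₀ L.Vϖ0 L.Vϖlt.le (show 1 ≤ n by omega)
    simpa using this
  have h2 : V ϖ < V t ^ s.natAbs := L.ϖlt _
  have hts : 0 < V t ^ s := zpow_pos L.Vt0 _
  have h3 : V t ^ s.natAbs * V t ^ s ≤ 1 := by
    rw [← zpow_natCast, ← zpow_add₀ L.Vt0.ne']
    have := zpow_le_zpow_right_of_le_one₀ L.Vt0 L.tlt.le (show 0 ≤ (s.natAbs : ℤ) + s by omega)
    simpa using this
  calc V ϖ ^ n * V t ^ s ≤ V ϖ * V t ^ s := by gcongr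
    _ < V t ^ s.natAbs * V t ^ s := by gcongr
    _ ≤ 1 := h3

lemma Loc1.t_lt {s : ℤ} (hs : 0 < s) : V t ^ s < 1 := by
  have := zpow_lt_zpow_right_of_lt_one₀ L.Vt0 L.tlt hs
  simpa using this

lemma Loc1.lex {n s n' s' : ℤ} : V ϖ ^ n * V t ^ s ≤ V ϖ ^ n' * V t ^ s' ↔ n' < n ∨ (n' = n ∧ s' ≤ s) := by
  have e : ∀ a b c d : ℤ, V ϖ ^ a * V t ^ b = (V ϖ ^ (a - c) * V t ^ (b - d)) * (V ϖ ^ c * V t ^ d) := by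
    intro a b c d
    have := L.Vt0.ne'
    have := L.Vϖ0.ne'
    rw [zpow_sub₀ ‹_›, zpow_sub₀ ‹_›]
    field_simp
  have pos : ∀ a b : ℤ, 0 < V ϖ ^ a * V t ^ b := fun a b => mul_pos (zpow_pos L.Vϖ0 _) (zpow_pos L.Vt0 _)
  have lt : ∀ a b c d : ℤ, (c < a ∨ (c = a ∧ d < b)) → V ϖ ^ a * V t ^ b < V ϖ ^ c * V t ^ d := by
    intro a b c d h
    rw [e a b c d]
    refine mul_lt_of_lt_one_left (pos c d) ?_
    rcases h with h | ⟨rfl, h⟩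
    · exact L.lex_lt (by omega) _
    · simpa using L.t_lt (by omega)
  constructor
  · intro h
    by_contra hc
    refine absurd h (not_le.mpr (lt _ _ _ _ ?_))
    omega
  · intro h
    by_cases heq : n' = n ∧ s' = s
    · rw [heq.1, heq.2]
    · exact (lt _ _ _ _ (by omega)).le

lemma Loc1.lex_eq {n s n' s' : ℤ} (h : V ϖ ^ n * V t ^ s = V ϖ ^ n' * V t ^ s') : n = n' ∧ s = s' := by
  have h1 := L.lex.mp h.le
  have h2 := L.lex.mp h.ge
  omega

/-- first-coordinate filtration -/
def Loc1.U (n : ℤ) : AddSubgroup E where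
  carrier := {x | ∃ m : ℕ, V x * V t ^ m ≤ V ϖ ^ n}
  zero_mem' := ⟨0, by simp⟩
  add_mem' := by
    rintro x y ⟨m, hm⟩ ⟨m', hm'⟩
    have ht1 : ∀ k : ℕ, V t ^ k ≤ 1 := fun k => pow_le_one₀ zero_le L.tlt.le
    refine ⟨m + m', ?_⟩
    have h := V.map_add x y
    rcases le_max_iff.mp h with h | h
    · calc V (x + y) * V t ^ (m + m') ≤ V x * V t ^ (m + m') := by gcongr
        _ = V x * V t ^ m * V t ^ m' := by rw [pow_add, mul_assoc]
        _ ≤ V ϖ ^ n * 1 := by gcongr; exact ht1 _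
        _ = _ := mul_one _
    · calc V (x + y) * V t ^ (m + m') ≤ V y * V t ^ (m + m') := by gcongr
        _ = V y * V t ^ m' * V t ^ m := by rw [pow_add]; ac_rfl
        _ ≤ V ϖ ^ n * 1 := by gcongr; exact ht1 _
        _ = _ := mul_one _
  neg_mem' := by
    rintro x ⟨m, hm⟩
    exact ⟨m, by rwa [Valuation.map_neg]⟩

lemma Loc1.mem_U {x : E} {a s n : ℤ} (hx : V x = V ϖ ^ a * V t ^ s) : x ∈ L.U n ↔ n ≤ a := by
  constructor
  · rintro ⟨m, hm⟩
    rw [hx, mul_assoc, ← zpow_natCast (V t) m, ← zpow_add₀ L.Vt0.ne', ← mul_one (V ϖ ^ n),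
      ← zpow_zero (V t), L.lex] at hm
    omega
  · intro h
    refine ⟨s.natAbs, ?_⟩
    rw [hx, mul_assoc, ← zpow_natCast (V t) _, ← zpow_add₀ L.Vt0.ne', ← mul_one (V ϖ ^ n),
      ← zpow_zero (V t), L.lex]
    omega

lemma Loc1.U_anti {m n : ℤ} (h : m ≤ n) {x : E} (hx : x ∈ L.U n) : x ∈ L.U m := by
  by_cases h0 : x = 0
  · rw [h0]; exact zero_mem _
  obtain ⟨a, s, hv⟩ := L.val x h0
  rw [L.mem_U hv] at hx ⊢
  omega

lemma Loc1.U_mul {m n : ℤ} {x y : E} (hx : x ∈ L.U m) (hy : y ∈ L.U n) : x * y ∈ L.U (m + n) := by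
  by_cases h0 : x = 0
  · rw [h0, zero_mul]; exact zero_mem _
  by_cases h0' : y = 0
  · rw [h0', mul_zero]; exact zero_mem _
  obtain ⟨a, s, hv⟩ := L.val x h0
  obtain ⟨b, r, hw⟩ := L.val y h0'
  have : V (x * y) = V ϖ ^ (a + b) * V t ^ (s + r) := by
    rw [map_mul, hv, hw, zpow_add₀ L.Vt0.ne', zpow_add₀ L.Vϖ0.ne']; ac_rfl
  rw [L.mem_U hv] at hx
  rw [L.mem_U hw] at hy
  rw [L.mem_U this]; omega

lemma Loc1.U_one_lt {x : E} (hx : x ∈ L.U 1) : V x < 1 := by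
  by_cases h0 : x = 0
  · rw [h0]; simp
  obtain ⟨a, s, hv⟩ := L.val x h0
  rw [L.mem_U hv] at hx
  rw [hv]; exact L.lex_lt (by omega) _

lemma Loc1.U_zero_of_le {x : E} (hx : V x ≤ 1) : x ∈ L.U 0 := ⟨0, by simpa using hx⟩

lemma Loc1.le_of_dvdV {x y : E} (h : V x ≤ V y) {n : ℤ} (hy : y ∈ L.U n) : x ∈ L.U n := by
  obtain ⟨m, hm⟩ := hy
  exact ⟨m, le_trans (by gcongr) hm⟩

lemma Loc1.exists_U (x : E) : ∃ N : ℕ, x ∈ L.U (-N) := by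
  by_cases h0 : x = 0
  · exact ⟨0, by rw [h0]; exact zero_mem _⟩
  obtain ⟨a, s, hv⟩ := L.val x h0
  exact ⟨a.natAbs, by rw [L.mem_U hv]; omega⟩

lemma Loc1.U_exact {x : E} {n : ℤ} (hx : x ∈ L.U n) (hx' : x ∉ L.U (n + 1)) :
    ∃ s : ℤ, V x = V ϖ ^ n * V t ^ s := by
  have h0 : x ≠ 0 := by rintro rfl; exact hx' (zero_mem _)
  obtain ⟨a, s, hv⟩ := L.val x h0
  rw [L.mem_U hv] at hx hx'
  obtain rfl : a = n := by omega
  exact ⟨s, hv⟩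

/-- adding a higher-level term keeps the valuation -/
lemma Loc1.V_add {A R : E} {n s e : ℤ} (hA : V A = V ϖ ^ n * V t ^ s) (he : n < e) (hR : R ∈ L.U e) :
    V (A + R) = V A := by
  apply V.map_add_eq_of_lt_left
  by_cases h0 : R = 0
  · rw [h0, map_zero, hA]; exact mul_pos (zpow_pos L.Vϖ0 _) (zpow_pos L.Vt0 _)
  obtain ⟨b, r, hw⟩ := L.val R h0
  rw [L.mem_U hw] at hR
  rw [← not_le, hA, hw, L.lex]; omega

lemma Loc1.V_one_add {z : E} (hz : V z < 1) : V (1 + z) = 1 := by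
  rw [V.map_add_eq_of_lt_left (by simpa using hz), map_one]

lemma Loc1.ne_one_add {z : E} (hz : V z < 1) : 1 + z ≠ 0 := by
  intro h
  have := L.V_one_add hz
  rw [h] at this; simp at this

lemma Loc1.ne_of_val {x : E} {n s : ℤ} (hx : V x = V ϖ ^ n * V t ^ s) : x ≠ 0 := by
  rintro rfl
  rw [map_zero] at hx
  exact (mul_pos (zpow_pos L.Vϖ0 n) (zpow_pos L.Vt0 s)).ne hx

variable [hp : Fact p.Prime]

/-- valuation of monomials -/
lemma Loc1.val_term {f : E} (hf : f ≠ 0) (i j : ℕ) : ∃ n s : ℤ,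
    V (f ^ p * t ^ i * ϖ ^ j) = V ϖ ^ n * V t ^ s ∧ (p : ℤ) ∣ n - j ∧ (p : ℤ) ∣ s - i := by
  obtain ⟨a, s, hv⟩ := L.val f hf
  refine ⟨a * p + j, s * p + i, ?_, by simp, by simp⟩
  rw [map_mul, map_mul, map_pow, map_pow, map_pow, hv, mul_pow, zpow_add₀ L.Vt0.ne', zpow_add₀ L.Vϖ0.ne',
    zpow_mul, zpow_mul, zpow_natCast, zpow_natCast, zpow_natCast, zpow_natCast]
  generalize (V t ^ s) ^ p = A
  generalize (V ϖ ^ a) ^ p = B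
  generalize V t ^ i = C
  generalize V ϖ ^ j = D
  simp only [mul_comm, mul_left_comm]

/-- orthogonality -/
lemma Loc1.orth (f : Fin p × Fin p → E) (Q : Finset (Fin p × Fin p)) {x : E}
    (hx : x = ∑ q ∈ Q, f q ^ p * t ^ (q.1 : ℕ) * ϖ ^ (q.2 : ℕ)) (hx0 : x ≠ 0) :
    ∃ q0 ∈ Q, f q0 ≠ 0 ∧ V x = V (f q0 ^ p * t ^ (q0.1 : ℕ) * ϖ ^ (q0.2 : ℕ)) ∧
      ∀ q ∈ Q, q ≠ q0 → V (f q ^ p * t ^ (q.1 : ℕ) * ϖ ^ (q.2 : ℕ)) < V x := by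
  set g : Fin p × Fin p → E := fun q => f q ^ p * t ^ (q.1 : ℕ) * ϖ ^ (q.2 : ℕ) with hg
  have hne : Q.Nonempty := by
    rw [Finset.nonempty_iff_ne_empty]; rintro rfl; simp at hx; exact hx0 hx
  obtain ⟨q0, hq0, hmax⟩ := Finset.exists_max_image Q (fun q => V (g q)) hne
  have hf0 : f q0 ≠ 0 := by
    intro h
    have h1 : g q0 = 0 := by simp [hg, h, hp.out.ne_zero]
    apply hx0
    rw [hx]
    refine Finset.sum_eq_zero fun q hq => ?_
    have := hmax q hq
    simp only [h1, map_zero, le_zero_iff] at this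
    exact (map_eq_zero V).mp this
  have hlt : ∀ q ∈ Q, q ≠ q0 → V (g q) < V (g q0) := by
    intro q hq hqq
    refine lt_of_le_of_ne (hmax q hq) ?_
    intro heq
    have hfq : f q ≠ 0 := by
      intro h
      have h1 : g q = 0 := by simp [hg, h, hp.out.ne_zero]
      rw [h1, map_zero] at heq
      have := (map_eq_zero V).mp heq.symm
      simp [hg, hf0, L.t0, L.ϖ0] at this
    obtain ⟨n, s, h1, h2, h3⟩ := L.val_term hfq (q.1 : ℕ) (q.2 : ℕ)
    obtain ⟨n', s', h1', h2', h3'⟩ := L.val_term hf0 (q0.1 : ℕ) (q0.2 : ℕ)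
    have heq' : V ϖ ^ n * V t ^ s = V ϖ ^ n' * V t ^ s' := by rw [← h1, ← h1']; exact heq
    obtain ⟨rfl, rfl⟩ := L.lex_eq heq'
    apply hqq
    refine Prod.ext (fin_eq_of_dvd ?_) (fin_eq_of_dvd ?_)
    · have := dvd_sub h3' h3; simpa using this
    · have := dvd_sub h2' h2; simpa using this
  have hVx : V x = V (g q0) := by
    rw [hx, ← Finset.add_sum_erase Q g hq0]
    apply V.map_add_eq_of_lt_left
    apply V.map_sum_lt
    · simp [hg, hf0, L.t0, L.ϖ0]
    · intro q hq
      rw [Finset.mem_erase] at hq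
      exact hlt q hq.2 hq.1
  exact ⟨q0, hq0, hf0, hVx, fun q hq hqq => by rw [hVx]; exact hlt q hq hqq⟩

lemma Loc1.V_int [CharP E p] (n : ℤ) : V (n : E) ≤ 1 := by
  have key : ∀ n : ℕ, V (n : E) ≤ 1 := by
    intro n
    induction n with
    | zero => simp
    | succ n ih =>
      rw [Nat.cast_succ]
      exact (V.map_add _ _).trans (max_le ih (by simp))
  rcases n with n | n
  · simpa only [Int.ofNat_eq_natCast, Int.cast_natCast] using key n
  · rw [Int.cast_negSucc, Valuation.map_neg]
    exact key _

end Loc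

section LocB
lemma Loc2.H5' {E Γ : Type} [Field E] [LinearOrderedCommGroupWithZero Γ] {p : ℕ} {V : Valuation E Γ} {t ϖ c0 : E}
    (L : Loc2 p V t ϖ c0) (x : E) :
    ∃ f : Fin p × Fin p → E, x = ∑ q, f q ^ p * t ^ (q.1 : ℕ) * ϖ ^ (q.2 : ℕ) := by
  obtain ⟨f, hf⟩ := L.H5 x
  refine ⟨fun q => f q.1 q.2, ?_⟩
  rw [Fintype.sum_prod_type]; exact hf
end LocB
end Tower

namespace Tower

section Red
variable {E Γ H : Type} [Field E] [LinearOrderedCommGroupWithZero Γ] [AddCommGroup H]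
  {p : ℕ} {V : Valuation E Γ} {t ϖ c0 : E} (L : Loc2 p V t ϖ c0) [hp : Fact p.Prime] [CharP E p]
  (S : E →+ Additive Eˣ →+ H)
  (hwp : ∀ x b, S (x ^ p - x) b = 0) (hself : ∀ f : Eˣ, S (f : E) (Additive.ofMul f) = 0)

include hp in
lemma intCast_eq_of_dvd {a b : ℤ} (h : (p : ℤ) ∣ a - b) : (a : E) = (b : E) := by
  have := (CharP.intCast_eq_zero_iff E p (a - b)).mpr h
  rwa [Int.cast_sub, sub_eq_zero] at this

include L hwp in
lemma Loc2.br_small {x : E} (hx : V x < 1) (b : E) : br S x b = 0 := by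
  obtain ⟨y, rfl⟩ := L.H2 x hx
  exact br_wp S p hwp y b

include L in
lemma Loc2.V_unit_int {n : ℤ} (hn : ¬ (p : ℤ) ∣ n) : V (n : E) = 1 := by
  obtain ⟨c, hc⟩ := exists_inv_mod p hn
  have h1 : (c : E) * n = 1 := by
    have := intCast_eq_of_dvd (E := E) (p := p) hc
    simpa using this
  have h2 : V (c : E) * V (n : E) = 1 := by rw [← map_mul, h1, map_one]
  refine le_antisymm (L.V_int n) ?_
  rw [← h2]
  exact mul_le_of_le_one_left zero_le (L.V_int c)

include L hself in
lemma Loc2.dlog {Z : E} {n s : ℤ} (hZ : V Z = V ϖ ^ n * V t ^ s) : ∃ d1 d2 : E,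
    (∀ X, br S X Z = br S (X * d1) t + br S (X * d2) ϖ) ∧ V (d1 - s) < 1 ∧ d2 - n ∈ L.U 1 := by
  have hZ0 := L.ne_of_val hZ
  obtain ⟨f, hf⟩ := L.H5' Z
  set g : Fin p × Fin p → E := fun q => f q ^ p * t ^ (q.1 : ℕ) * ϖ ^ (q.2 : ℕ) with hg
  obtain ⟨q0, -, hf0, hV, hlt⟩ := L.orth f Finset.univ hf hZ0
  obtain ⟨n', s', h1, h2, h3⟩ := L.val_term hf0 (q0.1 : ℕ) (q0.2 : ℕ)
  obtain ⟨rfl, rfl⟩ := L.lex_eq (hZ.symm.trans (hV.trans h1))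
  have hn : (n : E) = ((q0.2 : ℕ) : E) := by simpa using intCast_eq_of_dvd (E := E) h2
  have hs : (s : E) = ((q0.1 : ℕ) : E) := by simpa using intCast_eq_of_dvd (E := E) h3
  have hone : (1 : E) = ∑ q, g q / Z := by
    rw [← Finset.sum_div, eq_div_iff hZ0, one_mul]; exact hf
  have hVlt : ∀ q, q ≠ q0 → V (g q / Z) < 1 := by
    intro q hq
    rw [map_div₀, div_lt_one₀ (zero_lt_iff.mpr (by simpa using hZ0))]
    exact hlt q (Finset.mem_univ _) hq
  refine ⟨∑ q, ((q.1 : ℕ) : E) * (g q / Z), ∑ q, ((q.2 : ℕ) : E) * (g q / Z), ?_, ?_, ?_⟩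
  · intro X
    have e1 : br S X Z = ∑ q, br S (X / Z * g q) (g q) := by
      rw [← br_leib_sum S hself Finset.univ (X / Z) g]
      have : ∑ q, g q = Z := hf.symm
      rw [this, div_mul_cancel₀ _ hZ0]
    rw [e1, Finset.mul_sum, Finset.mul_sum, br_sum, br_sum, ← Finset.sum_add_distrib]
    refine Finset.sum_congr rfl fun q _ => ?_
    by_cases hfq : f q = 0
    · have : g q = 0 := by simp [hg, hfq, hp.out.ne_zero]
      simp [this, br_zero_left]
    · have e2 : ∀ Y, br S Y (g q) = br S ((q.1 : ℕ) * Y) t + br S ((q.2 : ℕ) * Y) ϖ := by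
        intro Y
        simp only [hg]
        rw [br_mul S _ (mul_ne_zero (pow_ne_zero _ hfq) (pow_ne_zero _ L.t0)) (pow_ne_zero _ L.ϖ0),
          br_mul S _ (pow_ne_zero _ hfq) (pow_ne_zero _ L.t0), br_pow S _ hfq, br_pow S _ L.t0,
          br_pow S _ L.ϖ0, br_tors, zero_add, br_nat, br_nat]
      rw [e2]
      congr 2 <;> ring
  · have : ∑ q, ((q.1 : ℕ) : E) * (g q / Z) - s = ∑ q, (((q.1 : ℕ) : E) - (q0.1 : ℕ)) * (g q / Z) := by
      simp only [sub_mul, Finset.sum_sub_distrib]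
      rw [← Finset.mul_sum, ← hone, mul_one, hs]
    rw [this]
    apply V.map_sum_lt one_ne_zero
    intro q _
    by_cases hq : q = q0
    · subst hq; simp
    · rw [map_mul]
      have hi : V (((q.1 : ℕ) : E) - (q0.1 : ℕ)) ≤ 1 := by
        have := L.V_int ((q.1 : ℕ) - (q0.1 : ℕ) : ℤ)
        simpa using this
      exact lt_of_le_of_lt (mul_le_of_le_one_left zero_le hi) (hVlt q hq)
  · have : ∑ q, ((q.2 : ℕ) : E) * (g q / Z) - n = ∑ q, (((q.2 : ℕ) : E) - (q0.2 : ℕ)) * (g q / Z) := by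
      simp only [sub_mul, Finset.sum_sub_distrib]
      rw [← Finset.mul_sum, ← hone, mul_one, hn]
    rw [this]
    refine sum_mem fun q _ => ?_
    by_cases hq : q.2 = q0.2
    · rw [hq]; simp [zero_mem]
    · have hi : V (((q.2 : ℕ) : E) - (q0.2 : ℕ)) ≤ 1 := by
        have := L.V_int ((q.2 : ℕ) - (q0.2 : ℕ) : ℤ)
        simpa using this
      have hgq : g q / Z ∈ L.U 1 := by
        by_cases hfq : f q = 0
        · have : g q = 0 := by simp [hg, hfq, hp.out.ne_zero]
          rw [this, zero_div]; exact zero_mem _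
        obtain ⟨n1, s1, k1, k2, k3⟩ := L.val_term hfq (q.1 : ℕ) (q.2 : ℕ)
        have hv : V (g q / Z) = V ϖ ^ (n1 - n) * V t ^ (s1 - s) := by
          have := L.Vt0.ne'
          have := L.Vϖ0.ne'
          rw [map_div₀, hZ, zpow_sub₀ ‹_›, zpow_sub₀ ‹_›]
          rw [show V (g q) = _ from k1]
          field_simp
        have hl := (hVlt q (by rintro rfl; exact hq rfl)).le
        have e1 : (1 : Γ) = V ϖ ^ (0 : ℤ) * V t ^ (0 : ℤ) := by simp
        rw [hv, e1, L.lex] at hl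
        rw [L.mem_U hv]
        by_contra hcon
        have hnn : n1 = n := by omega
        apply hq
        apply fin_eq_of_dvd
        have := dvd_sub h2 k2
        rw [hnn] at this
        simpa using this
      have := L.U_mul (L.U_zero_of_le hi) hgq
      simpa using this

include L in
lemma Loc2.U0_of {d : E} {s : ℤ} (h : V (d - s) < 1) : V d ≤ 1 := by
  have : d = (d - s) + s := by ring
  rw [this]
  exact (V.map_add _ _).trans (max_le h.le (L.V_int s))

include L in
lemma Loc2.U1_of {d : E} {s : ℤ} (h : d - s ∈ L.U 1) : d ∈ L.U 0 := by
  exact L.U_zero_of_le (L.U0_of (L.U_one_lt h))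

include L in
lemma Loc2.inv_one_add {z : E} (hz : V z < 1) : (1 + z)⁻¹ ∈ L.U 0 := by
  apply L.U_zero_of_le
  rw [map_inv₀, L.V_one_add hz, inv_one]

include L hself in
lemma Loc2.err {Y z : E} {e : ℤ} (hY : Y ∈ L.U e) (hz : z ∈ L.U 1) : ∃ P Q, P ∈ L.U (e + 1) ∧ Q ∈ L.U (e + 1) ∧
    br S Y (1 + z) = br S P t + br S Q ϖ := by
  by_cases hz0 : z = 0
  · refine ⟨0, 0, zero_mem _, zero_mem _, ?_⟩
    rw [hz0, add_zero, br_one, br_zero_left, br_zero_left, add_zero]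
  have hz1 := L.U_one_lt hz
  obtain ⟨n, s, hv⟩ := L.val z hz0
  obtain ⟨d1, d2, h1, h2, h3⟩ := L.dlog S hself hv
  have hX : Y * z / (1 + z) ∈ L.U (e + 1) := by
    have := L.U_mul (L.U_mul hY hz) (L.inv_one_add hz1)
    rwa [add_zero, ← div_eq_mul_inv] at this
  refine ⟨Y * z / (1 + z) * d1, Y * z / (1 + z) * d2, ?_, ?_, ?_⟩
  · have := L.U_mul hX (L.U_zero_of_le (L.U0_of h2)); simpa using this
  · have := L.U_mul hX (L.U1_of h3); simpa using this
  · rw [br_one_add S hself Y (L.ne_one_add hz1), h1]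

include L in
lemma Loc2.U_div {R A : E} {n s e : ℤ} (hA : V A = V ϖ ^ n * V t ^ s) (hR : R ∈ L.U e) : R / A ∈ L.U (e - n) := by
  have h : V A⁻¹ = V ϖ ^ (-n) * V t ^ (-s) := by
    rw [map_inv₀, hA, zpow_neg, zpow_neg, mul_inv]
  have := L.U_mul hR ((L.mem_U h (n := -n)).mpr le_rfl)
  rwa [← div_eq_mul_inv, ← sub_eq_add_neg] at this

include L hself in
lemma Loc2.step {A x P Q : E} {nA sA nx sx e : ℤ} (hA : V A = V ϖ ^ nA * V t ^ sA)
    (hx : V x = V ϖ ^ nx * V t ^ sx) (hdet : ¬ (p : ℤ) ∣ sx * nA - nx * sA) (he : nA < e)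
    (hP : P ∈ L.U e) (hQ : Q ∈ L.U e) :
    ∃ A' x' P' Q', V A' = V A ∧ V x' = V x ∧ P' ∈ L.U (e + 1) ∧ Q' ∈ L.U (e + 1) ∧
      br S A x + (br S P t + br S Q ϖ) = br S A' x' + (br S P' t + br S Q' ϖ) := by
  obtain ⟨a1, a2, hab, ha1, ha2⟩ := L.dlog S hself hA
  obtain ⟨x1, x2, hxb, hx1, hx2⟩ := L.dlog S hself hx
  have hA0 := L.ne_of_val hA
  have hx0 := L.ne_of_val hx
  set Δ := x1 * a2 - x2 * a1 with hΔ
  have Va1 := L.U0_of ha1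
  have Vx1 := L.U0_of hx1
  have Va2 := L.U0_of (L.U_one_lt ha2)
  have Vx2 := L.U0_of (L.U_one_lt hx2)
  have hVΔ : V Δ = 1 := by
    have e1 : Δ = ((sx * nA - nx * sA : ℤ) : E) + ((x1 - sx) * a2 + sx * (a2 - nA) - (x2 - nx) * a1 - nx * (a1 - sA)) := by
      push_cast; rw [hΔ]; ring
    have lt1 : ∀ u v : E, V u < 1 → V v ≤ 1 → V (u * v) < 1 := by
      intro u v hu hv; rw [map_mul]; exact lt_of_le_of_lt (mul_le_of_le_one_right zero_le hv) hu
    have k1 := lt1 _ _ hx1 Va2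
    have k2 := lt1 _ _ (L.U_one_lt ha2) (L.V_int sx)
    have k3 := lt1 _ _ (L.U_one_lt hx2) Va1
    have k4 := lt1 _ _ ha1 (L.V_int nx)
    rw [mul_comm] at k2 k4
    have := L.V_unit_int (E := E) hdet
    rw [e1, V.map_add_eq_of_lt_left, this]
    rw [this]
    exact V.map_sub_lt (V.map_sub_lt (V.map_add_lt k1 k2) k3) k4
  have hΔ0 : Δ ≠ 0 := by rintro h; rw [h] at hVΔ; simp at hVΔ
  have hΔi : Δ⁻¹ ∈ L.U 0 := L.U_zero_of_le (by rw [map_inv₀, hVΔ, inv_one])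
  have U0 : ∀ {w : E} {m : ℤ} {d : E}, w ∈ L.U m → d ∈ L.U 0 → w * d ∈ L.U m := by
    intro w m d hw hd; have := L.U_mul hw hd; simpa using this
  set R := (P * a2 - Q * a1) * Δ⁻¹ with hR
  set Y := (Q * x1 - P * x2) * Δ⁻¹ with hY
  have hRU : R ∈ L.U e := U0 (sub_mem (U0 hP (L.U_zero_of_le Va2)) (U0 hQ (L.U_zero_of_le Va1))) hΔi
  have hYU : Y ∈ L.U e := U0 (sub_mem (U0 hQ (L.U_zero_of_le Vx1)) (U0 hP (L.U_zero_of_le Vx2))) hΔi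
  have eP : P = R * x1 + Y * a1 := by rw [hR, hY]; field_simp; rw [hΔ]; ring
  have eQ : Q = R * x2 + Y * a2 := by rw [hR, hY]; field_simp; rw [hΔ]; ring
  have hA' : V (A + R) = V A := L.V_add hA he hRU
  have hA'0 : A + R ≠ 0 := L.ne_of_val (hA'.trans hA)
  have hRA : R / A ∈ L.U 1 := L.U_anti (by omega) (L.U_div hA hRU)
  have hYA : Y / (A + R) ∈ L.U 1 := L.U_anti (by omega) (L.U_div (hA'.trans hA) hYU)
  have n1 := L.ne_one_add (L.U_one_lt hRA)
  have n2 := L.ne_one_add (L.U_one_lt hYA)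
  obtain ⟨P1, Q1, hP1, hQ1, h1⟩ := L.err S hself hYU hRA
  obtain ⟨P2, Q2, hP2, hQ2, h2⟩ := L.err S hself hYU hYA
  refine ⟨A + R, x / (1 + Y / (A + R)), -(P1 + P2), -(Q1 + Q2), hA', ?_, neg_mem (add_mem hP1 hP2),
    neg_mem (add_mem hQ1 hQ2), ?_⟩
  · rw [map_div₀, L.V_one_add (L.U_one_lt hYA), div_one]
  · have e1 : br S P t + br S Q ϖ = br S R x + br S Y A := by
      rw [hxb, hab, eP, eQ, br_add, br_add]; abel
    have e2 : br S Y (A + R) = br S Y A + br S Y (1 + R / A) := by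
      rw [← br_mul S Y hA0 n1]; congr 1; field_simp
    have e3 := br_swap S hself hA'0 n2
    rw [br_div S _ hx0 n2, br_neg, br_neg, e1, br_add S P1, br_add S Q1, br_add S A R x]
    have e4 : br S Y A = br S Y (A + R) - br S Y (1 + R / A) := by rw [e2]; abel
    rw [e4, e3, h1, h2]; abel

include L hself hwp in
lemma Loc2.iter {nA sA nx sx : ℤ} (hdet : ¬ (p : ℤ) ∣ sx * nA - nx * sA) (m : ℕ) :
    ∀ {e : ℤ} {A x P Q : E}, 1 - e ≤ m → V A = V ϖ ^ nA * V t ^ sA →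
    V x = V ϖ ^ nx * V t ^ sx → nA < e → P ∈ L.U e → Q ∈ L.U e →
    ∃ A' x', V A' = V A ∧ V x' = V x ∧ br S A x + (br S P t + br S Q ϖ) = br S A' x' := by
  induction m with
  | zero =>
    intro e A x P Q hm hA hx he hP hQ
    refine ⟨A, x, rfl, rfl, ?_⟩
    rw [L.br_small S hwp (L.U_one_lt (L.U_anti (by omega) hP)),
      L.br_small S hwp (L.U_one_lt (L.U_anti (by omega) hQ))]; simp
  | succ m ih =>
    intro e A x P Q hm hA hx he hP hQ
    obtain ⟨A', x', P', Q', h1, h2, h3, h4, h5⟩ := L.step S hself hA hx hdet he hP hQ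
    obtain ⟨A'', x'', k1, k2, k3⟩ := ih (e := e + 1) (by push_cast at hm; omega) (h1.trans hA) (h2.trans hx) (by omega) h3 h4
    exact ⟨A'', x'', k1.trans h1, k2.trans h2, h5.trans k3⟩

/-- a symbol of one of three normal forms -/
def Good (p : ℕ) (V : Valuation E Γ) (t ϖ c0 : E) (S : E →+ Additive Eˣ →+ H) (α : H) : Prop :=
  ∃ f u, u ≠ 0 ∧ α = br S f u ∧ (V u = V t ∨
    (∃ (N : ℕ) (s : ℤ), V f = V ϖ ^ (-N : ℤ) * V t ^ s ∧ p ∣ N ∧ ¬ (p : ℤ) ∣ s ∧ (0 < N ∨ s < 0)) ∨ f = c0)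

include L in
lemma Loc2.expand (x : E) : ∃ f : Fin p × Fin p → E,
    x = ∑ q, f q ^ p * t ^ (q.1 : ℕ) * ϖ ^ (q.2 : ℕ) ∧
    ∀ q, V (f q ^ p * t ^ (q.1 : ℕ) * ϖ ^ (q.2 : ℕ)) ≤ V x := by
  by_cases hx : x = 0
  · refine ⟨0, ?_, ?_⟩ <;> simp [hx, hp.out.ne_zero]
  obtain ⟨f, hf⟩ := L.H5' x
  refine ⟨f, hf, fun q => ?_⟩
  obtain ⟨q0, -, h1, h2, h3⟩ := L.orth f Finset.univ hf hx
  by_cases hq : q = q0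
  · rw [hq, h2]
  · exact (h3 q (Finset.mem_univ _) hq).le

include L in
lemma Loc2.root_mem {f : E} {M : ℕ} (hM : 0 < M) (h : f ^ p ∈ L.U (-M)) : f ∈ L.U (-M + 1) := by
  by_cases hf : f = 0
  · rw [hf]; exact zero_mem _
  obtain ⟨n, s, hv⟩ := L.val f hf
  have hv' : V (f ^ p) = V ϖ ^ (n * p) * V t ^ (s * p) := by
    rw [map_pow, hv, mul_pow, zpow_mul, zpow_mul, zpow_natCast, zpow_natCast]
  rw [L.mem_U hv'] at h
  rw [L.mem_U hv]
  have := hp.out.two_le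
  by_contra hc
  have : n ≤ -M := by omega
  nlinarith

include L hself hwp in
lemma Loc2.good_A {M : ℕ} (hM : ¬ p ∣ M)
    (ih : ∀ a b, a ∈ L.U (-M + 1) → b ∈ L.U (-M + 1) → Good p V t ϖ c0 S (br S a t + br S b ϖ))
    {a b : E} (ha : a ∈ L.U (-M)) (hb : b ∈ L.U (-M)) : Good p V t ϖ c0 S (br S a t + br S b ϖ) := by
  have hM' : ¬ (p : ℤ) ∣ -(M : ℤ) := by rw [dvd_neg]; exact_mod_cast hM
  obtain ⟨a', b', ha', hb', heq⟩ : ∃ a' b', a' ∈ L.U (-M) ∧ b' ∈ L.U (-M + 1) ∧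
      br S a t + br S b ϖ = br S a' t + br S b' ϖ := by
    by_cases hbb : b ∈ L.U (-M + 1)
    · exact ⟨a, b, ha, hbb, rfl⟩
    obtain ⟨s, hv⟩ := L.U_exact hb hbb
    obtain ⟨d1, d2, h1, h2, h3⟩ := L.dlog S hself hv
    obtain ⟨c, hc⟩ := exists_inv_mod p hM'
    have hc1 : (c : E) * ((-M : ℤ) : E) = 1 := by
      have := intCast_eq_of_dvd (E := E) hc
      simpa using this
    refine ⟨a - c * b * d1, b * (-c * (d2 - (-M : ℤ))), ?_, ?_, ?_⟩
    · refine sub_mem ha ?_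
      have := L.U_mul (L.U_mul (L.U_zero_of_le (L.V_int c)) hb) (L.U_zero_of_le (L.U0_of h2))
      simpa using this
    · have h4 : -(c : E) ∈ L.U 0 := neg_mem (L.U_zero_of_le (L.V_int c))
      have := L.U_mul hb (L.U_mul h4 h3)
      simpa using this
    · have e1 : b * (-c * (d2 - (-M : ℤ))) = b - c * b * d2 := by
        linear_combination b * hc1
      have e2 := h1 (c * b)
      rw [br_int, br_self S hself, smul_zero] at e2
      rw [e1, br_sub, br_sub]
      have e3 := eq_neg_of_add_eq_zero_left e2.symm
      rw [e3]; abel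
  rw [heq]
  by_cases haa : a' ∈ L.U (-M + 1)
  · exact ih _ _ haa hb'
  obtain ⟨s, hv⟩ := L.U_exact ha' haa
  have ht : V t = V ϖ ^ (0 : ℤ) * V t ^ (1 : ℤ) := by simp
  obtain ⟨A', x', h1, h2, h3⟩ := L.iter S hwp hself (nA := -M) (sA := s) (nx := 0) (sx := 1)
    (by simpa [Int.natCast_dvd_natCast] using hM) (M + 1) (e := -M + 1) (A := a') (x := t) (P := 0) (Q := b') (by push_cast; omega) hv ht (by omega)
    (zero_mem _) hb'
  rw [br_zero_left, zero_add] at h3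
  refine ⟨A', x', L.ne_of_val (h2.trans ht), h3, Or.inl h2⟩

include L hself hwp in
lemma Loc2.good_B {M : ℕ} (hM0 : 0 < M) (hM : p ∣ M)
    (ih : ∀ a b, a ∈ L.U (-M + 1) → b ∈ L.U (-M + 1) → Good p V t ϖ c0 S (br S a t + br S b ϖ))
    {a b : E} (ha : a ∈ L.U (-M)) (hb : b ∈ L.U (-M)) : Good p V t ϖ c0 S (br S a t + br S b ϖ) := by
  have hp0 := hp.out.pos
  obtain ⟨a1, ha1, hea⟩ : ∃ a1 ∈ L.U (-M + 1), br S a t = br S a1 t := by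
    obtain ⟨f, hf, hle⟩ := L.expand a
    set g : Fin p × Fin p → E := fun q => f q ^ p * t ^ (q.1 : ℕ) * ϖ ^ (q.2 : ℕ) with hg
    have hgU : ∀ q, g q ∈ L.U (-M) := fun q => L.le_of_dvdV (hle q) ha
    refine ⟨∑ q, if (q.2 : ℕ) ≠ 0 then g q else if (q.1 : ℕ) = 0 then f q else 0, sum_mem fun q _ => ?_, ?_⟩
    · split_ifs with h1 h2
      · by_cases hfq : f q = 0
        · have : g q = 0 := by simp [hg, hfq, hp.out.ne_zero]
          rw [this]; exact zero_mem _
        obtain ⟨n1, s1, k1, k2, k3⟩ := L.val_term hfq (q.1 : ℕ) (q.2 : ℕ)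
        have := hgU q
        rw [L.mem_U (show V (g q) = _ from k1)] at this ⊢
        by_contra hc
        have hn : n1 = -M := by omega
        rw [hn] at k2
        have hM' : (p : ℤ) ∣ -M := by rw [dvd_neg]; exact_mod_cast hM
        have k4 := (dvd_sub_right hM').mp k2
        have k5 : p ∣ (q.2 : ℕ) := by exact_mod_cast k4
        exact h1 (Nat.eq_zero_of_dvd_of_lt k5 q.2.2)
      · apply L.root_mem hM0
        have := hgU q
        simp only [hg] at this
        push Not at h1
        rw [h1, h2] at this
        simpa using this
      · exact zero_mem _
    · conv_lhs => rw [hf]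
      rw [br_sum, br_sum]
      refine Finset.sum_congr rfl fun q _ => ?_
      split_ifs with h1 h2
      · rfl
      · push Not at h1
        rw [h1, h2, pow_zero, pow_zero, mul_one, mul_one, br_pth S p hwp]
      · push Not at h1
        rw [h1, pow_zero, mul_one, br_zero_left, ← zpow_natCast t]
        apply br_kill S p hself L.t0
        intro hd
        have hd' : p ∣ (q.1 : ℕ) := by exact_mod_cast hd
        exact h2 (Nat.eq_zero_of_dvd_of_lt hd' q.1.2)
  rw [hea]
  obtain ⟨f, hf, hle⟩ := L.expand b
  set z : Fin p × Fin p := (⟨0, hp0⟩, ⟨0, hp0⟩) with hz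
  have hf0U : f z ∈ L.U (-M + 1) := by
    apply L.root_mem hM0
    have := L.le_of_dvdV (hle z) hb
    simpa [hz] using this
  have hB : b - f z ^ p = ∑ q ∈ Finset.univ.erase z, f q ^ p * t ^ (q.1 : ℕ) * ϖ ^ (q.2 : ℕ) := by
    have := Finset.add_sum_erase Finset.univ (fun q => f q ^ p * t ^ (q.1 : ℕ) * ϖ ^ (q.2 : ℕ)) (Finset.mem_univ z)
    rw [← hf] at this
    rw [← this]; simp [hz]
  have heb : br S b ϖ = br S (b - f z ^ p) ϖ + br S (f z) ϖ := by
    rw [br_sub, br_pth S p hwp]; abel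
  by_cases hBU : b - f z ^ p ∈ L.U (-M + 1)
  · rw [heb, ← br_add]
    exact ih _ _ ha1 (add_mem hBU hf0U)
  have hBM : b - f z ^ p ∈ L.U (-M) := by
    refine sub_mem hb ?_
    have := L.le_of_dvdV (hle z) hb
    simpa [hz] using this
  obtain ⟨s, hv⟩ := L.U_exact hBM hBU
  obtain ⟨q0, hq0, k1, k2, k3⟩ := L.orth f _ hB (L.ne_of_val hv)
  obtain ⟨n', s', l1, l2, l3⟩ := L.val_term k1 (q0.1 : ℕ) (q0.2 : ℕ)
  obtain ⟨rfl, rfl⟩ := L.lex_eq (hv.symm.trans (k2.trans l1))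
  have hM' : (p : ℤ) ∣ -M := by rw [dvd_neg]; exact_mod_cast hM
  have k4 := (dvd_sub_right hM').mp l2
  have k5 : p ∣ (q0.2 : ℕ) := by exact_mod_cast k4
  have hq2 := Nat.eq_zero_of_dvd_of_lt k5 q0.2.2
  have hs : ¬ (p : ℤ) ∣ s := by
    intro hd
    have k4 := (dvd_sub_right hd).mp l3
    have k5 : p ∣ (q0.1 : ℕ) := by exact_mod_cast k4
    have hq1 := Nat.eq_zero_of_dvd_of_lt k5 q0.1.2
    apply (Finset.mem_erase.mp hq0).1
    rw [hz]
    exact Prod.ext (Fin.ext hq1) (Fin.ext hq2)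
  have hϖ : V ϖ = V ϖ ^ (1 : ℤ) * V t ^ (0 : ℤ) := by simp
  obtain ⟨A', x', h1, h2, h3⟩ := L.iter S hwp hself (nA := -M) (sA := s) (nx := 1) (sx := 0)
    (by simpa using hs) (M + 1) (e := -M + 1) (A := b - f z ^ p) (x := ϖ) (P := a1) (Q := f z)
    (by push_cast; omega) hv hϖ (by omega) ha1 hf0U
  refine ⟨A', x', L.ne_of_val (h2.trans hϖ), ?_, Or.inr (Or.inl ⟨M, s, h1.trans hv, hM, hs, Or.inl hM0⟩)⟩
  rw [heb, ← h3]; abel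

/-- peel off one pole of `t` -/
lemma Loc2.peel (L : Loc2 p V t ϖ c0) {a : E} {m : ℕ} (h : V a * V t ^ (m + 1) ≤ 1) :
    ∃ c r, V c ≤ 1 ∧ a = c ^ p * t ^ (-(m + 1 : ℕ) : ℤ) + r ∧ V r * V t ^ m ≤ 1 := by
  obtain ⟨c, hc⟩ := L.H3 (a * t ^ (m + 1)) (by rwa [map_mul, map_pow])
  have hc1 : V c ≤ 1 := by
    have : V (c ^ p) ≤ 1 := by
      have e : c ^ p = a * t ^ (m + 1) - (a * t ^ (m + 1) - c ^ p) := by ring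
      rw [e]
      exact (V.map_sub _ _).trans (max_le (by rwa [map_mul, map_pow]) hc.le)
    rw [map_pow] at this
    exact (pow_le_one_iff hp.out.ne_zero).mp this
  refine ⟨c, a - c ^ p * t ^ (-(m + 1 : ℕ) : ℤ), hc1, by ring, ?_⟩
  set r := a - c ^ p * t ^ (-(m + 1 : ℕ) : ℤ) with hr
  have hrt : r * t ^ (m + 1) = a * t ^ (m + 1) - c ^ p := by
    rw [hr, zpow_neg, zpow_natCast]
    have := L.t0
    field_simp
  by_cases h0 : r = 0
  · rw [h0]; simp
  obtain ⟨n, s, hv⟩ := L.val r h0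
  rw [← hrt, map_mul, map_pow, hv] at hc
  rw [hv]
  have e1 : (1 : Γ) = V ϖ ^ (0 : ℤ) * V t ^ (0 : ℤ) := by simp
  have e2 : ∀ k : ℕ, V ϖ ^ n * V t ^ s * V t ^ k = V ϖ ^ n * V t ^ (s + k) := by
    intro k; rw [zpow_add₀ L.Vt0.ne', zpow_natCast, mul_assoc]
  rw [e2, e1, L.lex]
  have hc' := hc.le
  rw [e2, e1, L.lex] at hc'
  have hc2 := not_le.mpr hc
  rw [e2, e1, L.lex] at hc2
  push_cast at *
  omega

include L in
lemma Loc2.root_bound {c : E} (hc : V c ≤ 1) {m m' : ℕ} (h : m' ≤ m) : V (c * t ^ (-(m' : ℕ) : ℤ)) * V t ^ m ≤ 1 := by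
  rw [map_mul, map_zpow₀, mul_assoc, ← zpow_natCast, ← zpow_add₀ L.Vt0.ne']
  refine mul_le_one₀ hc zero_le ?_
  have := zpow_le_zpow_right_of_le_one₀ L.Vt0 L.tlt.le (show 0 ≤ (-(m' : ℕ) : ℤ) + m by omega)
  simpa using this

include L hself hwp in
lemma Loc2.red_a (m : ℕ) : ∀ a, V a * V t ^ m ≤ 1 → ∃ a', V a' ≤ 1 ∧ br S a t = br S a' t := by
  induction m with
  | zero => intro a ha; exact ⟨a, by simpa using ha, rfl⟩
  | succ m ih =>
    intro a ha
    obtain ⟨c, r, hc, rfl, hr⟩ := L.peel ha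
    rw [br_add]
    by_cases hm : p ∣ m + 1
    · obtain ⟨m', hm'⟩ := hm
      have hle : m' ≤ m := by have := hp.out.two_le; nlinarith
      have e1 : c ^ p * t ^ (-(m + 1 : ℕ) : ℤ) = (c * t ^ (-(m' : ℕ) : ℤ)) ^ p := by
        rw [mul_pow, ← zpow_natCast (t ^ _), ← zpow_mul, hm']; congr 2; push_cast; ring
      rw [e1, br_pth S p hwp, ← br_add]
      apply ih
      rcases le_max_iff.mp (V.map_add (c * t ^ (-(m' : ℕ) : ℤ)) r) with h | h
      · exact le_trans (by gcongr) (L.root_bound hc hle)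
      · exact le_trans (by gcongr) hr
    · rw [br_kill S p hself L.t0 (by rw [dvd_neg]; exact_mod_cast hm), zero_add]
      exact ih r hr

include L hwp in
lemma Loc2.red_b (m : ℕ) : ∀ b, V b * V t ^ m ≤ 1 → ∃ b', br S b ϖ = br S b' ϖ ∧
    (V b' ≤ 1 ∨ ∃ s : ℕ, 0 < s ∧ ¬ p ∣ s ∧ V b' = V ϖ ^ (0 : ℤ) * V t ^ (-s : ℤ)) := by
  induction m with
  | zero => intro a ha; exact ⟨a, rfl, Or.inl (by simpa using ha)⟩
  | succ m ih =>
    intro b hb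
    by_cases hb' : V b * V t ^ m ≤ 1
    · exact ih b hb'
    by_cases hm : p ∣ m + 1
    · obtain ⟨c, r, hc, rfl, hr⟩ := L.peel hb
      obtain ⟨m', hm'⟩ := hm
      have hle : m' ≤ m := by have := hp.out.two_le; nlinarith
      have e1 : c ^ p * t ^ (-(m + 1 : ℕ) : ℤ) = (c * t ^ (-(m' : ℕ) : ℤ)) ^ p := by
        rw [mul_pow, ← zpow_natCast (t ^ _), ← zpow_mul, hm']; congr 2; push_cast; ring
      rw [br_add, e1, br_pth S p hwp, ← br_add]
      apply ih
      rcases le_max_iff.mp (V.map_add (c * t ^ (-(m' : ℕ) : ℤ)) r) with h | h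
      · exact le_trans (by gcongr) (L.root_bound hc hle)
      · exact le_trans (by gcongr) hr
    · refine ⟨b, rfl, Or.inr ⟨m + 1, by omega, hm, ?_⟩⟩
      have h0 : b ≠ 0 := by rintro rfl; simp at hb'
      obtain ⟨n, s, hv⟩ := L.val b h0
      have e1 : (1 : Γ) = V ϖ ^ (0 : ℤ) * V t ^ (0 : ℤ) := by simp
      have e2 : ∀ k : ℕ, V ϖ ^ n * V t ^ s * V t ^ k = V ϖ ^ n * V t ^ (s + k) := by
        intro k; rw [zpow_add₀ L.Vt0.ne', zpow_natCast, mul_assoc]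
      rw [hv, e2, e1, L.lex] at hb hb'
      rw [hv]
      congr 2 <;> push_cast at * <;> omega

include L hself hwp in
lemma Loc2.good_0 {a b : E} (ha : a ∈ L.U 0) (hb : b ∈ L.U 0) : Good p V t ϖ c0 S (br S a t + br S b ϖ) := by
  obtain ⟨m, hm⟩ := ha
  obtain ⟨m', hm'⟩ := hb
  rw [zpow_zero] at hm hm'
  obtain ⟨a', ha', e1⟩ := L.red_a S hwp hself m a hm
  obtain ⟨b', e2, hb'⟩ := L.red_b S hwp m' b hm'
  rw [e1, e2]
  clear e1 e2 hm hm'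
  rcases hb' with hb' | ⟨s, hs0, hs, hv⟩
  · obtain ⟨j, y, rfl⟩ := L.H4 _ ha'
    obtain ⟨j', y', rfl⟩ := L.H4 _ hb'
    refine ⟨c0, t ^ j * ϖ ^ j', mul_ne_zero (pow_ne_zero _ L.t0) (pow_ne_zero _ L.ϖ0), ?_, Or.inr (Or.inr rfl)⟩
    rw [br_add, br_add, br_wp S p hwp, br_wp S p hwp, br_nat, br_nat,
      br_mul S _ (pow_ne_zero _ L.t0) (pow_ne_zero _ L.ϖ0), br_pow S _ L.t0, br_pow S _ L.ϖ0]; simp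
  · have hs' : ¬ (p : ℤ) ∣ -(s : ℤ) := by rw [dvd_neg]; exact_mod_cast hs
    obtain ⟨d1, d2, h1, h2, h3⟩ := L.dlog S hself hv
    obtain ⟨c, hc⟩ := exists_inv_mod p hs'
    have hc1 : (c : E) * ((-s : ℤ) : E) = 1 := by
      have := intCast_eq_of_dvd (E := E) hc
      simpa using this
    have lt1 : ∀ u v : E, V u ≤ 1 → V v < 1 → V (u * v) < 1 := by
      intro u v hu hv; rw [map_mul]; exact lt_of_le_of_lt (mul_le_of_le_one_left zero_le hu) hv
    have hca : V (c * a') ≤ 1 := by rw [map_mul]; exact mul_le_one₀ (L.V_int c) zero_le ha'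
    have e1 : br S a' t = br S (c * a') b' := by
      rw [h1]
      have k2 : V (c * a' * d2) < 1 := lt1 _ _ hca (by simpa using L.U_one_lt h3)
      have k1 : c * a' * d1 = a' + (c * a') * (d1 - (-s : ℤ)) := by linear_combination a' * hc1
      rw [L.br_small S hwp k2, k1, br_add, L.br_small S hwp (lt1 _ _ hca h2)]; simp
    have hb0 := L.ne_of_val hv
    have hVb : 1 < V b' := by
      rw [hv, zpow_zero, one_mul, zpow_neg]
      exact (one_lt_inv₀ (zpow_pos L.Vt0 _)).mpr (L.t_lt (by exact_mod_cast hs0))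
    have hy : V (c * a' / b') < 1 := by
      rw [map_div₀, div_lt_one₀ (zero_lt_one.trans hVb)]
      exact lt_of_le_of_lt hca hVb
    have n1 := L.ne_one_add hy
    have e2 := br_swap S hself hb0 n1
    have e3 : br S (c * a') (1 + c * a' / b') = 0 := by
      rw [br_one_add S hself _ n1]
      apply L.br_small S hwp
      rw [map_div₀, L.V_one_add hy, div_one]
      exact lt1 _ _ hca hy
    refine ⟨b', ϖ / (1 + c * a' / b'), div_ne_zero L.ϖ0 n1, ?_, Or.inr (Or.inl ⟨0, -s, by simpa using hv, by simp, hs', Or.inr (by omega)⟩)⟩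
    rw [br_div S _ L.ϖ0 n1, e1, e2, e3]; abel

include L hself hwp in
theorem Loc2.good (a b : E) : Good p V t ϖ c0 S (br S a t + br S b ϖ) := by
  have key : ∀ N : ℕ, ∀ a b, a ∈ L.U (-N) → b ∈ L.U (-N) → Good p V t ϖ c0 S (br S a t + br S b ϖ) := by
    intro N
    induction N with
    | zero => intro a b ha hb; exact L.good_0 S hwp hself (by simpa using ha) (by simpa using hb)
    | succ N ih =>
      intro a b ha hb
      have ih' : ∀ a b, a ∈ L.U (-((N + 1 : ℕ) : ℤ) + 1) → b ∈ L.U (-((N + 1 : ℕ) : ℤ) + 1) →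
          Good p V t ϖ c0 S (br S a t + br S b ϖ) := by
        have : (-((N + 1 : ℕ) : ℤ) + 1) = -N := by push_cast; ring
        rw [this]; exact ih
      by_cases hM : p ∣ N + 1
      · exact L.good_B S hwp hself (Nat.succ_pos N) hM ih' ha hb
      · exact L.good_A S hwp hself hM ih' ha hb
  obtain ⟨N, hN⟩ := L.exists_U a
  obtain ⟨N', hN'⟩ := L.exists_U b
  exact key (N + N') a b (L.U_anti (by push_cast; omega) hN) (L.U_anti (by push_cast; omega) hN')

end Red
end Tower

namespace Tower

section Key
variable {E Γ Ω : Type} [Field E] [Field Ω] [Algebra E Ω] [IsAlgClosure E Ω] [LinearOrderedCommGroupWithZero Γ]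
  {p : ℕ} {V : Valuation E Γ} {t ϖ c0 : E} 

/-- the three types of normal form -/
def TypeOK (p : ℕ) (V : Valuation E Γ) (t ϖ c0 f u : E) : Prop :=
  u ≠ 0 ∧ (V u = V t ∨
    (∃ (N : ℕ) (s : ℤ), V f = V ϖ ^ (-N : ℤ) * V t ^ s ∧ p ∣ N ∧ ¬ (p : ℤ) ∣ s ∧ (0 < N ∨ s < 0)) ∨ f = c0)

theorem key1 (L : Loc2 p V t ϖ c0) [hp : Fact p.Prime] [CharP E p]
    (β : (Ω ≃ₐ[E] Ω) → Ω) (hsm : Smooth β) (hβ0 : ∀ σ, β σ ≠ 0)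
    (hβp : ∀ σ, IsSeparable E (β σ ^ p))
    (hc : ∀ σ τ, IsSeparable E (β σ * σ (β τ) / β (σ * τ))) :
    ∃ f u : E, TypeOK p V t ϖ c0 f u ∧ ∃ r s m : Ω, r ^ p - r = algebraMap E Ω f ∧ s ^ p = algebraMap E Ω u ∧
      s ≠ 0 ∧ m ≠ 0 ∧ ∀ σ, IsSeparable E (β σ / s ^ idx (σ r - r) * (m / σ m)) := by
  have hcharΩ : CharP Ω p := charP_of_injective_algebraMap (algebraMap E Ω).injective p
  have htu := pr_spec (Ω := Ω) p (Units.mk0 t L.t0)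
  have hϖu := pr_spec (Ω := Ω) p (Units.mk0 ϖ L.ϖ0)
  set x := pr Ω p (Units.mk0 t L.t0)
  set y := pr Ω p (Units.mk0 ϖ L.ϖ0)
  have hx : (x : Ω) ^ p = algebraMap E Ω t := by
    have := congrArg Units.val htu; simpa using this
  have hy : (y : Ω) ^ p = algebraMap E Ω ϖ := by
    have := congrArg Units.val hϖu; simpa using this
  obtain ⟨m, r₁, r₂, a₁, a₂, e, hm, hr1, hr2, he0, hes, heq⟩ := decomp p t ϖ L.t0 L.ϖ0 L.H5 (x : Ω) (y : Ω) hx hy β hsm hβ0 hβp hc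
  have h1 : cls (fun σ => Units.mk0 (β σ) (hβ0 σ)) = br (sym Ω p) a₁ t + br (sym Ω p) a₂ ϖ := by
    rw [br_ne _ _ L.t0, br_ne _ _ L.ϖ0, sym_apply, sym_apply,
      sym0_eq p a₁ _ r₁ hr1 x htu _ (fun σ => as_diff p hr1 σ),
      sym0_eq p a₂ _ r₂ hr2 y hϖu _ (fun σ => as_diff p hr2 σ), ← cls_mul, cls_eq]
    refine ⟨m, hm, fun σ => ?_⟩
    convert hes σ using 1
    have hσm : σ m ≠ 0 := by simpa using hm
    have h3 : (x : Ω) ≠ 0 := x.ne_zero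
    have h4 : (y : Ω) ≠ 0 := y.ne_zero
    simp only [Units.val_mk0, Pi.mul_apply, Units.val_mul, Units.val_pow_eq_pow_val]
    rw [heq σ]
    field_simp
  obtain ⟨f, u, hu, hfu, hty⟩ := L.good (sym Ω p) (sym_wp p) (sym_self p) a₁ a₂
  rw [← h1, br_ne _ _ hu, sym_apply, sym0, cls_eq] at hfu
  obtain ⟨m', hm', hs⟩ := hfu
  refine ⟨f, u, ⟨hu, hty⟩, rt Ω p f, pr Ω p (Units.mk0 u hu), m', rt_spec p f, ?_, Units.ne_zero _, hm', fun σ => ?_⟩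
  · have := congrArg Units.val (pr_spec (Ω := Ω) p (Units.mk0 u hu)); simpa using this
  · have := hs σ
    simpa using this

end Key

section Tow
variable {F Ω : Type} [Field F] [Field Ω] [Algebra F Ω] [IsAlgClosure F Ω]

lemma idx_zero : idx (0 : Ω) = 0 := by
  have h : ∃ i : ℕ, (0 : Ω) = i := ⟨0, by simp⟩
  classical
  rw [idx, dif_pos h]
  simp

lemma algClosure_inter (E : IntermediateField F Ω) : IsAlgClosure E Ω := by
  have := isAlgE F Ω
  exact ⟨isAlgClosedE F Ω, Algebra.IsAlgebraic.tower_top (K := F) E⟩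

lemma sep_mono {E E' : IntermediateField F Ω} (h : E ≤ E') {x : Ω} (hx : IsSeparable E x) : IsSeparable E' x := by
  letI : Algebra E E' := (IntermediateField.inclusion h).toAlgebra
  haveI : IsScalarTower E E' Ω := IsScalarTower.of_algebraMap_eq fun x => rfl
  have hres := hx.tower_top E'
  exact hres

def overE (E : IntermediateField F Ω) (σ : Ω ≃ₐ[F] Ω) (h : ∀ x ∈ E, σ x = x) : Ω ≃ₐ[E] Ω :=
  AlgEquiv.ofRingEquiv (f := (σ : Ω ≃+* Ω)) (fun x => h x x.2)

lemma overE_apply (E : IntermediateField F Ω) (σ : Ω ≃ₐ[F] Ω) (h : ∀ x ∈ E, σ x = x) (x : Ω) :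
    overE E σ h x = σ x := rfl

/-- inductive condition on a cochain -/
structure Cond (p : ℕ) (E : IntermediateField F Ω) (β : (Ω ≃ₐ[F] Ω) → Ω) (j : ℕ) : Prop where
  sm : Smooth β
  ne : ∀ σ, β σ ≠ 0
  coc : ∀ σ τ : Ω ≃ₐ[F] Ω, (∀ x ∈ E, σ x = x) → (∀ x ∈ E, τ x = x) → IsSeparable E (β σ * σ (β τ) / β (σ * τ))
  pow : ∀ σ : Ω ≃ₐ[F] Ω, (∀ x ∈ E, σ x = x) → IsSeparable E (β σ ^ p ^ j)

lemma sep_pow {E : IntermediateField F Ω} {x : Ω} (hx : IsSeparable E x) (n : ℕ) : IsSeparable E (x ^ n) := by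
  rw [← mem_separableClosure_iff] at *; exact pow_mem hx n

lemma sep_mul {E : IntermediateField F Ω} {x y : Ω} (hx : IsSeparable E x) (hy : IsSeparable E y) : IsSeparable E (x * y) := by
  rw [← mem_separableClosure_iff] at *; exact mul_mem hx hy

theorem key_step {p : ℕ} [hp : Fact p.Prime] [CharP F p] {Γ : Type} [LinearOrderedCommGroupWithZero Γ]
    (E : IntermediateField F Ω) {V : Valuation E Γ} {t ϖ c0 : E} (L : Loc2 p V t ϖ c0)
    {β : (Ω ≃ₐ[F] Ω) → Ω} {j : ℕ} (C : Cond p E β (j + 1)) :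
    ∃ f u : E, TypeOK p V t ϖ c0 f u ∧ ∃ r s m : Ω, r ^ p - r = (f : Ω) ∧ s ^ p = (u : Ω) ∧ m ≠ 0 ∧
      ∀ E' : IntermediateField F Ω, E ≤ E' → (r ∈ E' ∨ s ∈ E') → Cond p E' (fun σ => β σ * (m / σ m)) j := by
  haveI := algClosure_inter E
  haveI hac := isAlgClosedE F Ω
  haveI : CharP E p := charP_of_injective_algebraMap (algebraMap F E).injective p
  let res : (Ω ≃ₐ[E] Ω) → (Ω ≃ₐ[F] Ω) := fun σ => σ.restrictScalars F
  have hres : ∀ σ : Ω ≃ₐ[E] Ω, ∀ x ∈ E, res σ x = x := fun σ x hx => σ.commutes ⟨x, hx⟩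
  obtain ⟨f, u, hty, r, s, m0, hr, hs, hs0, hm0, hsep⟩ := key1 L (fun σ => β (res σ) ^ p ^ j) (by
    obtain ⟨S, hS, h⟩ := C.sm
    exact ⟨S, hS, fun σ τ hst => congrArg (· ^ p ^ j) (h (res σ) (res τ) hst)⟩)
    (fun σ => pow_ne_zero _ (C.ne _))
    (fun σ => by
      have := C.pow (res σ) (hres σ)
      rwa [pow_succ, pow_mul] at this)
    (fun σ τ => by
      have := sep_pow (C.coc (res σ) (res τ) (hres σ) (hres τ)) (p ^ j)
      rw [div_pow, mul_pow] at this
      have h2 : res (σ * τ) = res σ * res τ := rfl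
      rw [h2, map_pow]
      exact this)
  obtain ⟨m, hm⟩ := IsAlgClosed.exists_pow_nat_eq m0 (pow_pos hp.out.pos j)
  have hmne : m ≠ 0 := by
    rintro rfl
    rw [zero_pow (pow_ne_zero _ hp.out.ne_zero)] at hm
    exact hm0 hm.symm
  refine ⟨f, u, hty, r, s, m, hr, hs, hmne, fun E' hE hrs => ⟨?_, ?_, ?_, ?_⟩⟩
  · exact C.sm.comp₂ (Smooth.eval m) (fun a b => a * (m / b))
  · intro σ
    exact mul_ne_zero (C.ne σ) (div_ne_zero hmne (by simpa using hmne))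
  · intro σ τ hσ hτ
    have h := sep_mono hE (C.coc σ τ (fun x hx => hσ x (hE hx)) (fun x hx => hτ x (hE hx)))
    convert h using 1
    have h1 : σ m ≠ 0 := by simpa using hmne
    have h2 : σ (τ m) ≠ 0 := by simpa using hmne
    have h3 := C.ne (σ * τ)
    rw [map_mul, map_div₀, AlgEquiv.mul_apply]
    field_simp
  · intro σ hσ
    have hσE : ∀ x ∈ E, σ x = x := fun x hx => hσ x (hE hx)
    have h1 := sep_mono hE (hsep (overE E σ hσE))
    have e1 : res (overE E σ hσE) = σ := rfl
    simp only [overE_apply, e1] at h1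
    have e2 : (β σ * (m / σ m)) ^ p ^ j = β σ ^ p ^ j / s ^ idx (σ r - r) * (m0 / σ m0) * s ^ idx (σ r - r) := by
      have h1 : σ m ≠ 0 := by simpa using hmne
      rw [mul_pow, div_pow, ← map_pow, hm]
      have h2 : σ m0 ≠ 0 := by simpa using hm0
      field_simp
    rw [e2]
    refine sep_mul h1 ?_
    rcases hrs with hr' | hs'
    · rw [hσ r hr', sub_self, idx_zero, pow_zero]
      exact isSeparable_algebraMap (F := E') (K := Ω) (1 : E')
    · have h5 : IsSeparable E' s := isSeparable_algebraMap (F := E') (K := Ω) (⟨s, hs'⟩ : E')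
      exact sep_pow h5 _

end Tow
end Tower

namespace Tower

lemma finite_as {κ : Type} [Field κ] [Finite κ] (p : ℕ) [hp : Fact p.Prime] [CharP κ p] :
    ∃ c : κ, (∀ y : κ, y ^ p - y ≠ c) ∧ ∀ x : κ, ∃ (j : ℕ) (y : κ), x = j * c + (y ^ p - y) := by
  let P : κ →+ κ := (frobenius κ p).toAddMonoidHom - AddMonoidHom.id κ
  have hP : ∀ y, P y = y ^ p - y := fun y => rfl
  have hker : Nat.card P.ker = p := by
    have e : Function.Bijective (fun i : ZMod p => (⟨ZMod.castHom (dvd_refl p) κ i, by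
        rw [AddMonoidHom.mem_ker, hP, ← map_pow, ZMod.pow_card, sub_self]⟩ : P.ker)) := by
      constructor
      · intro a b h
        exact (ZMod.castHom (dvd_refl p) κ).injective (congrArg Subtype.val h)
      · rintro ⟨x, hx⟩
        obtain ⟨i, hi⟩ := fp_of_pow p (x := x) (by rwa [AddMonoidHom.mem_ker, hP, sub_eq_zero] at hx)
        exact ⟨i, Subtype.ext (by simp [hi])⟩
    rw [← Nat.card_congr (Equiv.ofBijective _ e), Nat.card_zmod]
  have hidx : Nat.card (κ ⧸ P.range) = p := by
    have h1 := P.ker.card_mul_index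
    have h2 := P.range.card_mul_index
    rw [AddSubgroup.index_ker, hker] at h1
    change P.range.index = p
    have : 0 < Nat.card P.range := Nat.card_pos
    refine Nat.eq_of_mul_eq_mul_left this ?_
    rw [h2, ← h1, mul_comm]
  have hnt : ∃ c : κ, c ∉ P.range := by
    by_contra! h
    have : P.range = ⊤ := by ext; simp [h]
    rw [this] at hidx
    have h2 : Nat.card (κ ⧸ (⊤ : AddSubgroup κ)) = 1 := AddSubgroup.index_top
    rw [h2] at hidx
    exact hp.out.one_lt.ne hidx
  obtain ⟨c, hc⟩ := hnt
  refine ⟨c, fun y h => hc ⟨y, h⟩, fun x => ?_⟩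
  have := mem_multiples_of_prime_card (G := κ ⧸ P.range) hidx (g := (c : κ ⧸ P.range)) (g' := (x : κ ⧸ P.range)) (by
    intro h; exact hc ((QuotientAddGroup.eq_zero_iff c).mp h))
  obtain ⟨j, hj⟩ := this
  have hj : ((j • c : κ) : κ ⧸ P.range) = x := hj
  rw [QuotientAddGroup.eq] at hj
  obtain ⟨y, hy⟩ := hj
  refine ⟨j, y, ?_⟩
  rw [hP] at hy
  rw [hy, nsmul_eq_mul]; ring

section
variable {E Γ : Type} [Field E] [LinearOrderedCommGroupWithZero Γ]
  {p : ℕ} {V : Valuation E Γ} {t ϖ : E}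

lemma res_zero_iff (x : V.valuationSubring) : IsLocalRing.residue V.valuationSubring x = 0 ↔ V (x : E) < 1 := by
  rw [IsLocalRing.residue_eq_zero_iff, IsLocalRing.mem_maximalIdeal, mem_nonunits_iff]
  have h : IsUnit x ↔ V (x : E) = 1 := (Valuation.integer.integers V).isUnit_iff_valuation_eq_one (x := x)
  rw [h]
  exact ⟨fun h => lt_of_le_of_ne x.2 h, fun h => h.ne⟩

theorem Loc1.exists_c0 (L : Loc1 p V t ϖ) [hp : Fact p.Prime] [CharP E p] :
    (∀ x : E, V x ≤ 1 → ∃ c, V (x - c ^ p) < 1) ∧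
    ∃ c0 : E, (∀ x : E, V x ≤ 1 → ∃ (j : ℕ) (y : E), x = j * c0 + (y ^ p - y)) ∧ V c0 ≤ 1 ∧
      (∀ y : E, V y ≤ 1 → ¬ V (y ^ p - y - c0) < 1) := by
  set O := V.valuationSubring
  let κ := IsLocalRing.ResidueField O
  have hfin : Finite κ := by
    obtain ⟨R, hR⟩ := L.fin
    classical
    let g : R → κ := fun r => if h : V (r : E) ≤ 1 then IsLocalRing.residue O ⟨r, h⟩ else 0
    refine Finite.of_surjective g fun x => ?_
    obtain ⟨x, rfl⟩ := IsLocalRing.residue_surjective x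
    obtain ⟨r, hr, h⟩ := hR x x.2
    have hr1 : V r ≤ 1 := by
      have : r = x - (x - r) := by ring
      rw [this]
      exact V.map_sub_le x.2 h.le
    refine ⟨⟨r, hr⟩, ?_⟩
    simp only [g, hr1, dif_pos]
    rw [eq_comm, ← sub_eq_zero, ← map_sub, res_zero_iff]
    exact h
  haveI : CharP O p := (algebraMap O E).charP (IsFractionRing.injective O E) p
  haveI : CharP κ p := CharP.of_ringHom_of_ne_zero (IsLocalRing.residue O) p hp.out.ne_zero
  constructor
  · intro x hx
    have : Function.Surjective (frobenius κ p) := Finite.surjective_of_injective (frobenius κ p).injective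
    obtain ⟨c, hc⟩ := this (IsLocalRing.residue O ⟨x, hx⟩)
    obtain ⟨c, rfl⟩ := IsLocalRing.residue_surjective c
    refine ⟨c, ?_⟩
    have : IsLocalRing.residue O (⟨x, hx⟩ - c ^ p) = 0 := by
      rw [map_sub, map_pow, ← hc, frobenius_def, sub_self]
    exact (res_zero_iff _).mp this
  · obtain ⟨c, hc1, hc2⟩ := finite_as (κ := κ) p
    obtain ⟨c, rfl⟩ := IsLocalRing.residue_surjective c
    refine ⟨c, fun x hx => ?_, c.2, fun y hy h => ?_⟩
    · obtain ⟨j, y, h⟩ := hc2 (IsLocalRing.residue O ⟨x, hx⟩)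
      obtain ⟨y, rfl⟩ := IsLocalRing.residue_surjective y
      have : IsLocalRing.residue O (⟨x, hx⟩ - (j * c + (y ^ p - y))) = 0 := by
        rw [map_sub, h]; simp
      obtain ⟨w, hw⟩ := L.H2 _ ((res_zero_iff _).mp this)
      refine ⟨j, y + w, ?_⟩
      rw [add_pow_char]
      push_cast at hw
      linear_combination -hw
    · refine hc1 (IsLocalRing.residue O ⟨y, hy⟩) ?_
      rw [← sub_eq_zero, ← map_pow, ← map_sub, ← map_sub, res_zero_iff]
      exact h
end
end Tower

namespace Tower

/-- type synonym for twisting module structures -/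
def Twist (E : Type) : Type := E
instance (E : Type) [Field E] : Field (Twist E) := inferInstanceAs (Field E)

theorem Loc1.H5_of {F E Γ : Type} [Field F] [Field E] [LinearOrderedCommGroupWithZero Γ] [Algebra F E] [FiniteDimensional F E]
    {p : ℕ} {V : Valuation E Γ} {t ϖ : E} (L : Loc1 p V t ϖ) [hp : Fact p.Prime] [CharP F p] [CharP E p]
    (g : Fin p × Fin p → F) (hg : ∀ x : F, ∃ f : Fin p × Fin p → F, x = ∑ q, f q ^ p * g q) (x : E) :
    ∃ f : Fin p → Fin p → E, x = ∑ i, ∑ j, f i j ^ p * t ^ (i : ℕ) * ϖ ^ (j : ℕ) := by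
  let inst : Module F (Twist E) := Module.compHom E ((algebraMap F E).comp (frobenius F p))
  have hsm : ∀ (a : F) (y : E), inst.smul a y = (algebraMap F E a ^ p * y : E) := fun a y => by
    change algebraMap F E (a ^ p) * y = _
    rw [map_pow]
  let φ : (Fin p × Fin p → E) →ₗ[F] Twist E :=
    { toFun := fun f => (∑ q, f q ^ p * t ^ (q.1 : ℕ) * ϖ ^ (q.2 : ℕ) : E)
      map_add' := fun f f' => by
        change (∑ q, (f q + f' q) ^ p * t ^ (q.1 : ℕ) * ϖ ^ (q.2 : ℕ) : E) = (∑ q, f q ^ p * t ^ (q.1 : ℕ) * ϖ ^ (q.2 : ℕ) : E) + (∑ q, f' q ^ p * t ^ (q.1 : ℕ) * ϖ ^ (q.2 : ℕ) : E)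
        rw [← Finset.sum_add_distrib]
        refine Finset.sum_congr rfl fun q _ => ?_
        rw [add_pow_char]; ring
      map_smul' := fun a f => by
        change (∑ q, (a • f q) ^ p * t ^ (q.1 : ℕ) * ϖ ^ (q.2 : ℕ) : E) = inst.smul a (∑ q, f q ^ p * t ^ (q.1 : ℕ) * ϖ ^ (q.2 : ℕ) : E)
        rw [hsm, Finset.mul_sum]
        refine Finset.sum_congr rfl fun q _ => ?_
        rw [Algebra.smul_def, mul_pow]; ring }
  have hφ : ∀ f, φ f = (∑ q, f q ^ p * t ^ (q.1 : ℕ) * ϖ ^ (q.2 : ℕ) : E) := fun f => rfl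
  have hinj : Function.Injective φ := by
    rw [injective_iff_map_eq_zero]
    intro f hf
    by_contra hne
    obtain ⟨q, hq⟩ := Function.ne_iff.mp hne
    have hq : f q ≠ 0 := hq
    have h1 : (∑ q, f q ^ p * t ^ (q.1 : ℕ) * ϖ ^ (q.2 : ℕ) : E) = 0 := hf
    rw [← Finset.add_sum_erase _ _ (Finset.mem_univ q)] at h1
    have h0 : - (f q ^ p * t ^ (q.1 : ℕ) * ϖ ^ (q.2 : ℕ)) = ∑ x ∈ Finset.univ.erase q, f x ^ p * t ^ (x.1 : ℕ) * ϖ ^ (x.2 : ℕ) := by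
      linear_combination -h1
    have hne0 : f q ^ p * t ^ (q.1 : ℕ) * ϖ ^ (q.2 : ℕ) ≠ 0 := by
      simp [hq, L.t0, L.ϖ0]
    obtain ⟨q0, hq0, hf0, hV, -⟩ := L.orth f _ h0 (neg_ne_zero.mpr hne0)
    rw [Valuation.map_neg] at hV
    obtain ⟨n, s, h1, h2, h3⟩ := L.val_term hq (q.1 : ℕ) (q.2 : ℕ)
    obtain ⟨n', s', h1', h2', h3'⟩ := L.val_term hf0 (q0.1 : ℕ) (q0.2 : ℕ)
    rw [h1, h1'] at hV
    obtain ⟨rfl, rfl⟩ := L.lex_eq hV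
    refine (Finset.mem_erase.mp hq0).1 ?_
    refine Prod.ext (fin_eq_of_dvd ?_) (fin_eq_of_dvd ?_)
    · have := dvd_sub h3 h3'; simpa using this
    · have := dvd_sub h2 h2'; simpa using this
  let b := Module.finBasis F E
  let v : (Fin p × Fin p) × Fin (Module.finrank F E) → Twist E := fun q => (algebraMap F E (g q.1) * b q.2 : E)
  have hsurj : Function.Surjective (Fintype.linearCombination F v) := by
    intro y
    have hy := b.sum_repr (y : E)
    choose f hf using fun i => hg (b.repr (y : E) i)
    refine ⟨fun q => f q.2 q.1, ?_⟩
    rw [Fintype.linearCombination_apply]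
    change (∑ q : (Fin p × Fin p) × Fin (Module.finrank F E), (algebraMap F E (f q.2 q.1 ^ p) * (algebraMap F E (g q.1) * b q.2)) : E) = (y : E)
    rw [← hy, Fintype.sum_prod_type_right]
    refine Finset.sum_congr rfl fun i _ => ?_
    rw [Algebra.smul_def, hf i, map_sum, Finset.sum_mul]
    refine Finset.sum_congr rfl fun q _ => ?_
    rw [map_mul, map_pow]; ring
  haveI : Module.Finite F (Twist E) := Module.Finite.of_surjective _ hsurj
  have hle := LinearMap.finrank_le_finrank_of_injective hinj
  have hge : Module.finrank F (Twist E) ≤ Module.finrank F (Fin p × Fin p → E) := by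
    have := LinearMap.finrank_le_finrank_of_surjective hsurj
    refine this.trans ?_
    have h := Module.finrank_pi_fintype F (M := fun _ : Fin p × Fin p => E)
    rw [h]
    simp
  obtain ⟨f, hf⟩ := (LinearMap.injective_iff_surjective_of_finrank_eq_finrank (le_antisymm hle hge)).mp hinj x
  refine ⟨fun i j => f (i, j), ?_⟩
  rw [hφ, Fintype.sum_prod_type] at hf
  exact hf.symm
end Tower

namespace Tower

section MaxSum
variable {Ω Γ : Type} [Field Ω] [LinearOrderedCommGroupWithZero Γ] (W : Valuation Ω Γ)

lemma max_sum {ι : Type} (S : Finset ι) (hS : S.Nonempty) (x : ι → Ω)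
    (hd : ∀ i ∈ S, ∀ j ∈ S, i ≠ j → x i ≠ 0 → W (x i) ≠ W (x j)) :
    ∃ i ∈ S, W (∑ j ∈ S, x j) = W (x i) ∧ ∀ j ∈ S, W (x j) ≤ W (x i) := by
  classical
  obtain ⟨i, hi, hmax⟩ := Finset.exists_max_image S (fun q => W (x q)) hS
  refine ⟨i, hi, ?_, hmax⟩
  by_cases h0 : x i = 0
  · have : ∑ j ∈ S, x j = 0 := Finset.sum_eq_zero fun j hj => by
      have := hmax j hj
      simpa [h0] using this
    rw [this, h0]
  · rw [← Finset.add_sum_erase S x hi]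
    apply W.map_add_eq_of_lt_left
    apply W.map_sum_lt
    · simpa using h0
    · intro j hj
      rw [Finset.mem_erase] at hj
      exact lt_of_le_of_ne (hmax j hj.2) (hd i hi j hj.2 (Ne.symm hj.1) h0).symm

end MaxSum

section Adj
variable {F Ω : Type} [Field F] [Field Ω] [Algebra F Ω]

/-- adjoin an element -/
def adj (E : IntermediateField F Ω) (z : Ω) : IntermediateField F Ω := (IntermediateField.adjoin E {z}).restrictScalars F

lemma le_adj (E : IntermediateField F Ω) (z : Ω) : E ≤ adj E z := fun x hx =>
  (IntermediateField.adjoin E {z}).algebraMap_mem ⟨x, hx⟩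

lemma mem_adj (E : IntermediateField F Ω) (z : Ω) : z ∈ adj E z := IntermediateField.mem_adjoin_simple_self E z

lemma adj_span {p : ℕ} (hp : 1 < p) (E : IntermediateField F Ω) {z d g : Ω} (hd : d ∈ E) (hg : g ∈ E)
    (hz : z ^ p = d * z + g) {x : Ω} (hx : x ∈ adj E z) : ∃ a : ℕ → E, x = ∑ j ∈ Finset.range p, (a j : Ω) * z ^ j := by
  let P : Polynomial E := Polynomial.X ^ p - (Polynomial.C ⟨d, hd⟩ * Polynomial.X + Polynomial.C ⟨g, hg⟩)
  have hdeg : (Polynomial.C (⟨d, hd⟩ : E) * Polynomial.X + Polynomial.C (⟨g, hg⟩ : E)).degree < (p : WithBot ℕ) :=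
    lt_of_le_of_lt Polynomial.degree_linear_le (by exact_mod_cast hp)
  have hmon : P.Monic := Polynomial.monic_X_pow_sub hdeg
  have hnat : P.natDegree = p := by
    have : P.degree = p := by
      rw [Polynomial.degree_sub_eq_left_of_degree_lt, Polynomial.degree_X_pow]
      rwa [Polynomial.degree_X_pow]
    exact Polynomial.natDegree_eq_of_degree_eq_some this
  have hPz : Polynomial.aeval z P = 0 := by
    simp only [P, map_sub, map_add, map_mul, map_pow, Polynomial.aeval_X, Polynomial.aeval_C]
    change z ^ p - (d * z + g) = 0
    rw [hz, sub_self]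
  have hinteg : IsIntegral E z := ⟨P, hmon, by rwa [← Polynomial.aeval_def]⟩
  have hx' : x ∈ (IntermediateField.adjoin E {z}).toSubalgebra := hx
  rw [IntermediateField.adjoin_simple_toSubalgebra_of_isAlgebraic hinteg.isAlgebraic, Algebra.adjoin_singleton_eq_range_aeval] at hx'
  obtain ⟨Q, hQ⟩ := hx'
  refine ⟨fun j => (Q %ₘ P).coeff j, ?_⟩
  have h1 : Polynomial.aeval z Q = Polynomial.aeval z (Q %ₘ P) := by
    conv_lhs => rw [← Polynomial.modByMonic_add_div Q P]
    rw [map_add, map_mul, hPz, zero_mul, add_zero]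
  have h2 : (Q %ₘ P).natDegree < p := by
    rw [← hnat]
    exact Polynomial.natDegree_modByMonic_lt Q hmon (by
      intro h; rw [h] at hnat; simp at hnat; omega)
  rw [← hQ]
  change Polynomial.aeval z Q = _
  rw [h1, Polynomial.aeval_eq_sum_range' h2]
  refine Finset.sum_congr rfl fun i _ => ?_
  rw [Algebra.smul_def]; rfl

lemma adj_finrank {p : ℕ} (hp : 1 < p) (E : IntermediateField F Ω) {z d g : Ω} (hd : d ∈ E) (hg : g ∈ E)
    (hz : z ^ p = d * z + g)
    (hind : ∀ a : ℕ → E, ∑ j ∈ Finset.range p, (a j : Ω) * z ^ j = 0 → ∀ j < p, a j = 0) :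
    Module.finrank F (adj E z) = p * Module.finrank F E := by
  have h1 : Module.finrank E (IntermediateField.adjoin E {z}) = p := by
    let v : Fin p → IntermediateField.adjoin E {z} := fun i => (IntermediateField.AdjoinSimple.gen E z) ^ (i : ℕ)
    have hv : ∀ i, (v i : Ω) = z ^ (i : ℕ) := fun i => by simp [v]
    have hli : LinearIndependent E v := by
      rw [Fintype.linearIndependent_iff]
      intro a ha i
      have h2 := hind (fun j => if h : j < p then a ⟨j, h⟩ else 0) (by
        rw [Finset.sum_range]
        have := congrArg (Subtype.val) ha
        simp only [AddSubmonoidClass.coe_finsetSum, ZeroMemClass.coe_zero] at this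
        rw [← this]
        refine Finset.sum_congr rfl fun j _ => ?_
        simp only [Fin.is_lt, dif_pos]
        rw [IntermediateField.coe_smul, hv, Algebra.smul_def]; rfl) i i.2
      simpa using h2
    have hsp : ⊤ ≤ Submodule.span E (Set.range v) := by
      rintro ⟨x, hx⟩ -
      obtain ⟨a, ha⟩ := adj_span hp E hd hg hz (show x ∈ adj E z from hx)
      have : (⟨x, hx⟩ : IntermediateField.adjoin E {z}) = ∑ i : Fin p, a i • v i := by
        apply Subtype.ext
        simp only [AddSubmonoidClass.coe_finsetSum]
        rw [ha, Finset.sum_range]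
        refine Finset.sum_congr rfl fun j _ => ?_
        rw [IntermediateField.coe_smul, hv, Algebra.smul_def]; rfl
      rw [this]
      exact Submodule.sum_mem _ fun i _ => Submodule.smul_mem _ _ (Submodule.subset_span ⟨i, rfl⟩)
    rw [Module.finrank_eq_card_basis (Module.Basis.mk hli hsp), Fintype.card_fin]
  have h2 := Module.finrank_mul_finrank F E (IntermediateField.adjoin E {z})
  rw [h1] at h2
  rw [mul_comm]
  exact h2.symm
end Adj

section Ram
variable {F Ω Γ : Type} [Field F] [Field Ω] [Algebra F Ω] [LinearOrderedCommGroupWithZero Γ] {W : Valuation Ω Γ}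
  {p : ℕ} [hp : Fact p.Prime] [CharP F p]

lemma ℘sum {E' : IntermediateField F Ω} {ι : Type} (S : Finset ι) (x : ι → Ω)
    (h : ∀ i ∈ S, ∃ y ∈ E', y ^ p - y = x i) : ∃ y ∈ E', y ^ p - y = ∑ i ∈ S, x i := by
  haveI : CharP Ω p := charP_of_injective_algebraMap (algebraMap F Ω).injective p
  choose! y hy1 hy2 using h
  refine ⟨∑ i ∈ S, y i, sum_mem hy1, ?_⟩
  rw [sum_pow_char, ← Finset.sum_sub_distrib]
  exact Finset.sum_congr rfl hy2

/-- valuation on an intermediate field -/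
abbrev VE (W : Valuation Ω Γ) (E : IntermediateField F Ω) : Valuation E Γ := W.comap (algebraMap E Ω)

lemma VE_apply (E : IntermediateField F Ω) (x : E) : VE W E x = W (x : Ω) := rfl

theorem ram_step {E : IntermediateField F Ω} {t ϖ : E} (L : Loc1 p (VE W E) t ϖ) {z d g : Ω} (hd : d ∈ E) (hg : g ∈ E)
    (hz : z ^ p = d * z + g) {s : ℤ} (hs : ¬ (p : ℤ) ∣ s) (hW : W z ^ p = W (t : Ω) ^ s)
    (hH2 : ∀ (a : E) (i : ℕ), W (a * z ^ i) < 1 → ∃ y ∈ adj E z, y ^ p - y = a * z ^ i) :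
    (∃ t' : adj E z, W (t' : Ω) ^ p = W (t : Ω) ∧ Loc1 p (VE W (adj E z)) t' ⟨ϖ, le_adj E z ϖ.2⟩) ∧
    ∀ a : ℕ → E, ∀ i < p, W (a i * z ^ i) ≤ W (∑ j ∈ Finset.range p, (a j : Ω) * z ^ j) := by
  have hp0 := hp.out.ne_zero
  have hVt : 0 < W (t : Ω) := L.Vt0
  have hVϖ : 0 < W (ϖ : Ω) := L.Vϖ0
  have hz0 : z ≠ 0 := by
    rintro rfl
    rw [map_zero, zero_pow hp0] at hW
    exact zpow_ne_zero _ hVt.ne' hW.symm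
  -- values of terms
  have hval : ∀ (a : E) (i : ℕ), a ≠ 0 → ∃ n m : ℤ, W (a : Ω) = W (ϖ : Ω) ^ n * W (t : Ω) ^ m ∧
      W (a * z ^ i) ^ p = W (ϖ : Ω) ^ (n * p) * W (t : Ω) ^ (m * p + s * i) := by
    intro a i ha
    obtain ⟨n, m, h⟩ := L.val a ha
    have h : W (a : Ω) = W (ϖ : Ω) ^ n * W (t : Ω) ^ m := h
    refine ⟨n, m, h, ?_⟩
    rw [map_mul, map_pow, mul_pow, ← pow_mul, mul_comm i p, pow_mul, hW, h, mul_pow, zpow_add₀ hVt.ne', zpow_mul, zpow_mul, zpow_mul]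
    simp only [zpow_natCast]
    rw [mul_assoc]
  have hlex : ∀ {n m n' m' : ℤ}, W (ϖ : Ω) ^ n * W (t : Ω) ^ m = W (ϖ : Ω) ^ n' * W (t : Ω) ^ m' → n = n' ∧ m = m' :=
    fun h => L.lex_eq h
  have hdist : ∀ a : ℕ → E, ∀ i ∈ Finset.range p, ∀ j ∈ Finset.range p, i ≠ j → (a i : Ω) * z ^ i ≠ 0 →
      W (a i * z ^ i) ≠ W (a j * z ^ j) := by
    intro a i hi j hj hij h0 heq
    rw [Finset.mem_range] at hi hj
    have hai : a i ≠ 0 := by rintro h; simp [h] at h0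
    have haj : a j ≠ 0 := by
      rintro h
      rw [h] at heq
      simp [hai, hz0] at heq
    obtain ⟨n, m, -, h1⟩ := hval _ i hai
    obtain ⟨n', m', -, h2⟩ := hval _ j haj
    rw [heq, h2] at h1
    have h3 := (hlex h1).2
    have h4 : (p : ℤ) ∣ s * ((i : ℤ) - j) := ⟨m' - m, by linear_combination -h3⟩
    rcases (Nat.prime_iff_prime_int.mp hp.out).dvd_or_dvd h4 with h | h
    · exact hs h
    · apply hij
      have := fin_eq_of_dvd (p := p) (i := ⟨i, hi⟩) (i' := ⟨j, hj⟩) h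
      simpa using this
  have hne : (Finset.range p).Nonempty := ⟨0, by simp [hp.out.pos]⟩
  have hmax := fun a : ℕ → E => max_sum W (Finset.range p) hne (fun i => (a i : Ω) * z ^ i) (hdist a)
  have horth : ∀ a : ℕ → E, ∀ i < p, W (a i * z ^ i) ≤ W (∑ j ∈ Finset.range p, (a j : Ω) * z ^ j) := by
    intro a i hi
    obtain ⟨i0, -, h1, h2⟩ := hmax a
    rw [h1]; exact h2 i (by simpa using hi)
  refine ⟨?_, horth⟩
  -- the uniformizer
  obtain ⟨c, b, hcb⟩ := exists_inv_mod p hs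
  have hzE := mem_adj E z
  have htE := le_adj E z t.2
  let t' : adj E z := ⟨z ^ c * (t : Ω) ^ (-b), mul_mem (zpow_mem hzE c) (zpow_mem htE (-b))⟩
  have ht'c : (t' : Ω) = z ^ c * (t : Ω) ^ (-b) := rfl
  have ht' : W (t' : Ω) ^ p = W (t : Ω) := by
    rw [ht'c, map_mul, map_zpow₀, map_zpow₀, mul_pow, ← zpow_natCast, ← zpow_mul, mul_comm c, zpow_mul, zpow_natCast, hW, ← zpow_mul,
      ← zpow_natCast, ← zpow_mul, ← zpow_add₀ hVt.ne']
    have : s * c + -b * p = 1 := by linear_combination hcb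
    rw [this, zpow_one]
  have ht0 : 0 < W (t' : Ω) := by
    rw [zero_lt_iff]; intro h
    rw [h, zero_pow hp0] at ht'
    exact hVt.ne ht'
  have hz' : W z = W (t' : Ω) ^ s := by
    refine (pow_left_inj₀ zero_le zero_le hp0).mp ?_
    rw [hW, ← ht', ← zpow_natCast, ← zpow_mul, ← zpow_natCast, ← zpow_mul, mul_comm]
  have ht1 : W (t' : Ω) < 1 := by
    have : W (t' : Ω) ^ p < 1 := by rw [ht']; exact L.tlt
    exact (pow_lt_one_iff_of_nonneg zero_le hp0).mp this
  refine ⟨t', ht', ⟨?_, ?_, ht1, ?_, ?_, ?_, ?_⟩⟩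
  · intro h; rw [h] at ht0; simp at ht0
  · intro h
    have := congrArg Subtype.val h
    exact L.ϖ0 (Subtype.ext this)
  · intro n
    refine lt_of_lt_of_le (show W (ϖ : Ω) < W (t : Ω) ^ n from L.ϖlt n) ?_
    rw [← ht', ← pow_mul]
    exact pow_le_pow_of_le_one zero_le ht1.le (Nat.le_mul_of_pos_left _ hp.out.pos)
  · rintro ⟨x, hx⟩ hx0
    obtain ⟨a, rfl⟩ := adj_span hp.out.one_lt E hd hg hz hx
    obtain ⟨i, -, h1, -⟩ := hmax a
    have hai : a i ≠ 0 := by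
      intro h
      rw [h] at h1
      simp only [ZeroMemClass.coe_zero, zero_mul, map_zero, map_eq_zero] at h1
      exact hx0 (Subtype.ext h1)
    obtain ⟨n, m, h2, -⟩ := hval _ i hai
    refine ⟨n, m * p + s * i, ?_⟩
    change W (∑ j ∈ Finset.range p, (a j : Ω) * z ^ j) = W (ϖ : Ω) ^ n * W (t' : Ω) ^ _
    rw [h1, map_mul, map_pow, h2, hz', ← ht', zpow_add₀ ht0.ne', mul_comm m, zpow_mul, zpow_mul]
    simp only [zpow_natCast]
    rw [mul_assoc]
  · rintro ⟨x, hx⟩ hx1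
    obtain ⟨a, rfl⟩ := adj_span hp.out.one_lt E hd hg hz hx
    obtain ⟨y, hy, h⟩ := ℘sum (E' := adj E z) (p := p) (Finset.range p) (fun i => (a i : Ω) * z ^ i) (fun i hi =>
      hH2 (a i) i (lt_of_le_of_lt (horth a i (by simpa using hi)) hx1))
    exact ⟨⟨y, hy⟩, Subtype.ext h⟩
  · obtain ⟨R, hR⟩ := L.fin
    classical
    refine ⟨R.image (fun r : E => ⟨r, le_adj E z r.2⟩), ?_⟩
    rintro ⟨x, hx⟩ hx1
    obtain ⟨a, rfl⟩ := adj_span hp.out.one_lt E hd hg hz hx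
    have hx1 : W (∑ j ∈ Finset.range p, (a j : Ω) * z ^ j) ≤ 1 := hx1
    have h1 : ∀ i < p, W (a i * z ^ i) ≤ 1 := fun i hi => (horth a i hi).trans hx1
    have h0 : W (a 0 : Ω) ≤ 1 := by simpa using h1 0 hp.out.pos
    obtain ⟨r, hr, hr2⟩ := hR (a 0) h0
    refine ⟨⟨r, le_adj E z r.2⟩, Finset.mem_image_of_mem _ hr, ?_⟩
    change W ((∑ j ∈ Finset.range p, (a j : Ω) * z ^ j) - r) < 1
    rw [← Finset.add_sum_erase (Finset.range p) _ (Finset.mem_range.mpr hp.out.pos), pow_zero, mul_one, add_sub_right_comm]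
    refine W.map_add_lt hr2 (W.map_sum_lt one_ne_zero fun i hi => ?_)
    rw [Finset.mem_erase, Finset.mem_range] at hi
    refine lt_of_le_of_ne (h1 i hi.2) fun h => ?_
    have hai : a i ≠ 0 := by intro h'; simp [h'] at h
    obtain ⟨n, m, -, h3⟩ := hval _ i hai
    rw [h, one_pow] at h3
    have h4 := hlex (n := 0) (m := 0) (by simpa using h3)
    have h5 : (p : ℤ) ∣ s * i := ⟨-m, by linear_combination -h4.2⟩
    rcases (Nat.prime_iff_prime_int.mp hp.out).dvd_or_dvd h5 with h | h
    · exact hs h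
    · have := Nat.le_of_dvd (Nat.pos_of_ne_zero hi.1) (Int.natCast_dvd_natCast.mp h)
      omega
end Ram
end Tower

namespace Tower

lemma multiset_sum_as {M : Type} [Field M] (z : M) (S : Multiset M) (h : ∀ w ∈ S, ∃ i : ℕ, w = z + i) :
    ∃ N : ℕ, S.sum = (Multiset.card S : M) * z + N := by
  induction S using Multiset.induction_on with
  | empty => exact ⟨0, by simp⟩
  | cons a S ih =>
    obtain ⟨N, hN⟩ := ih fun w hw => h w (Multiset.mem_cons_of_mem hw)
    obtain ⟨i, hi⟩ := h a (Multiset.mem_cons_self a S)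
    refine ⟨i + N, ?_⟩
    rw [Multiset.sum_cons, hN, hi, Multiset.card_cons]
    push_cast
    ring

lemma as_degree {K M : Type} [Field K] [Field M] [Algebra K M] (p : ℕ) [hp : Fact p.Prime] [CharP K p]
    {z : M} {c : K} (hz : z ^ p - z = algebraMap K M c) (hc : ∀ y : K, y ^ p - y ≠ c) (Q : Polynomial K)
    (hQ : Q.natDegree < p) (hQz : Polynomial.aeval z Q = 0) : Q = 0 := by
  by_contra hQ0
  let N := AlgebraicClosure M
  have : CharP M p := charP_of_injective_algebraMap (algebraMap K M).injective p
  haveI : CharP N p := charP_of_injective_algebraMap (algebraMap M N).injective p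
  have halg : IsAlgebraic K z := ⟨Q, hQ0, hQz⟩
  have hinteg : IsIntegral K z := halg.isIntegral
  set P := minpoly K z
  have hdeg : P.natDegree < p := lt_of_le_of_lt (Polynomial.natDegree_le_of_degree_le ((minpoly.degree_le_of_ne_zero K z hQ0 hQz).trans Polynomial.degree_le_natDegree)) hQ
  have hpos : 0 < P.natDegree := minpoly.natDegree_pos hinteg
  have hmon : (P.map (algebraMap K N)).Monic := (minpoly.monic hinteg).map _
  have hspl : (P.map (algebraMap K N)).Splits := IsAlgClosed.splits _
  let Z : N := algebraMap M N z
  have hZ : Z ^ p - Z = algebraMap K N c := by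
    rw [IsScalarTower.algebraMap_apply K M N, ← hz]; simp [Z]
  have hdvd : P ∣ Polynomial.X ^ p - Polynomial.X - Polynomial.C c := minpoly.dvd K z (by simp [hz])
  obtain ⟨N0, hN⟩ := multiset_sum_as Z (P.map (algebraMap K N)).roots (by
    intro w hw
    have h1 : Polynomial.eval w (P.map (algebraMap K N)) = 0 := (Polynomial.mem_roots'.mp hw).2
    obtain ⟨R, hR⟩ := hdvd
    have h2 : w ^ p - w = algebraMap K N c := by
      have := congrArg (fun q => Polynomial.eval w (Polynomial.map (algebraMap K N) q)) hR
      simp only [Polynomial.map_sub, Polynomial.map_pow, Polynomial.map_X, Polynomial.map_C, Polynomial.eval_sub, Polynomial.eval_pow, Polynomial.eval_X, Polynomial.eval_C, Polynomial.map_mul, Polynomial.eval_mul, h1, zero_mul] at this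
      exact sub_eq_zero.mp this
    obtain ⟨i, hi⟩ := fp_of_pow p (x := w - Z) (by
      rw [sub_pow_char]
      linear_combination h2 - hZ)
    exact ⟨i, by rw [← hi]; ring⟩)
  have hcard : Multiset.card (P.map (algebraMap K N)).roots = P.natDegree := by
    rw [← hspl.natDegree_eq_card_roots, Polynomial.natDegree_map]
  have hnext := hspl.nextCoeff_eq_neg_sum_roots_of_monic hmon
  rw [hcard] at hN
  rw [hN, Polynomial.nextCoeff_map (algebraMap K N).injective] at hnext
  have hd0 : (P.natDegree : K) ≠ 0 := by
    intro h
    have := (CharP.cast_eq_zero_iff K p P.natDegree).mp h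
    exact absurd (Nat.le_of_dvd hpos this) (by omega)
  have hzK : Z = algebraMap K N ((-P.nextCoeff - N0) / P.natDegree) := by
    have hd1 : (P.natDegree : N) ≠ 0 := by
      have := (map_ne_zero (algebraMap K N)).mpr hd0
      simpa using this
    rw [map_div₀, map_sub, map_neg, hnext, map_natCast, map_natCast]
    rw [eq_div_iff hd1]
    ring
  apply hc ((-P.nextCoeff - N0) / P.natDegree)
  apply (algebraMap K N).injective
  rw [map_sub, map_pow, ← hzK, hZ]

section Unram
variable {F Ω Γ : Type} [Field F] [Field Ω] [Algebra F Ω] [LinearOrderedCommGroupWithZero Γ] {W : Valuation Ω Γ}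
  {p : ℕ} [hp : Fact p.Prime] [CharP F p]

lemma W_small {x : Ω} (hx : W x < 1) : W (x ^ p - x) = W x := by
  by_cases h0 : x = 0
  · simp [h0, hp.out.ne_zero]
  · rw [W.map_sub_swap]
    apply W.map_sub_eq_of_lt_left
    rw [map_pow]
    have := pow_lt_pow_right_of_lt_one₀ (zero_lt_iff.mpr ((map_ne_zero W).mpr h0)) hx hp.out.one_lt
    simpa using this

lemma W_big {x : Ω} (hx : 1 < W x) : W (x ^ p - x) = W x ^ p := by
  rw [W.map_sub_eq_of_lt_left, map_pow]
  rw [map_pow]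
  simpa using pow_lt_pow_right₀ hx hp.out.one_lt

lemma Loc1.H2' {E : IntermediateField F Ω} {t ϖ : E} (L : Loc1 p (VE W E) t ϖ) {a : E} (ha : W (a : Ω) < 1) :
    ∃ y : E, y ^ p - y = a ∧ W (y : Ω) = W (a : Ω) := by
  haveI : CharP E p := charP_of_injective_algebraMap (algebraMap F E).injective p
  obtain ⟨y, hy⟩ := L.H2 a ha
  have h1 := prod_add_natCast p y
  rw [hy] at h1
  have h2 : ∃ i ∈ Finset.range p, W ((y + (i : E) : E) : Ω) < 1 := by
    by_contra! h
    have : 1 ≤ W ((∏ i ∈ Finset.range p, (y + (i : E)) : E) : Ω) := by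
      have e : ((∏ i ∈ Finset.range p, (y + (i : E)) : E) : Ω) = ∏ i ∈ Finset.range p, ((y + (i : E) : E) : Ω) :=
        map_prod (algebraMap E Ω) _ _
      rw [e, map_prod]
      refine Finset.prod_induction _ (fun x => 1 ≤ x) (fun a b ha hb => one_le_mul_of_one_le_of_one_le ha hb) le_rfl h
    rw [h1] at this
    exact absurd ha (not_lt.mpr this)
  obtain ⟨i, -, hi⟩ := h2
  have h3 : (y + (i : E)) ^ p - (y + i) = a := by
    rw [add_pow_char, ← hy]
    have : (i : E) ^ p = i := map_natCast (frobenius E p) i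
    rw [this]; ring
  refine ⟨y + i, h3, ?_⟩
  rw [← W_small (p := p) hi, ← h3]
  push_cast
  rfl

lemma H2_as {E E' : IntermediateField F Ω} {t ϖ : E} (L : Loc1 p (VE W E) t ϖ) (hE : E ≤ E') {z : Ω} {f : E}
    (hz : z ^ p - z = f) (hz1 : 1 ≤ W z) (hzE : z ∈ E') (i : ℕ) :
    ∀ a : E, W (a * z ^ i) < 1 → ∃ y ∈ E', y ^ p - y = a * z ^ i := by
  haveI : CharP E p := charP_of_injective_algebraMap (algebraMap F E).injective p
  haveI : CharP Ω p := charP_of_injective_algebraMap (algebraMap F Ω).injective p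
  have hzp : W z ≤ W z ^ p := by simpa using pow_le_pow_right₀ hz1 hp.out.one_le
  have hf : W (f : Ω) ≤ W z ^ p := by
    rw [← hz]
    refine (W.map_sub _ _).trans (max_le (by rw [map_pow]) hzp)
  induction i using Nat.strong_induction_on with
  | _ i ih =>
    intro a ha
    have ha1 : W (a : Ω) < 1 := by
      refine lt_of_le_of_lt ?_ ha
      rw [map_mul, map_pow]
      exact le_mul_of_one_le_right zero_le (one_le_pow₀ hz1)
    obtain ⟨y, hy, hya⟩ := L.H2' ha1
    have hyz : W (y : Ω) * W z ^ i < 1 := by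
      rw [hya]; simpa using ha
    have hterm : ∀ j ∈ Finset.range i, ∃ w ∈ E', w ^ p - w = ((-(y ^ p * f ^ (i - j) * (i.choose j : E)) : E) : Ω) * z ^ j := by
      intro j hj
      rw [Finset.mem_range] at hj
      apply ih j hj
      have h1 : W ((i.choose j : E) : Ω) ≤ 1 := by
        have := L.V_int (i.choose j : ℤ)
        simpa using this
      push_cast
      rw [neg_mul, Valuation.map_neg, map_mul, map_mul, map_mul, map_pow, map_pow, map_pow]
      have h2 : W (y : Ω) ^ p * W (f : Ω) ^ (i - j) * W z ^ j ≤ (W (y : Ω) * W z ^ i) ^ p := by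
        rw [mul_pow, mul_assoc, ← pow_mul]
        refine mul_le_mul_right ?_ _
        calc W (f : Ω) ^ (i - j) * W z ^ j ≤ (W z ^ p) ^ (i - j) * (W z ^ p) ^ j := by gcongr
          _ = W z ^ (i * p) := by rw [← pow_add, ← pow_mul, mul_comm]; congr 2; omega
      have h3 : W (y : Ω) ^ p * W (f : Ω) ^ (i - j) * W (i.choose j : Ω) * W z ^ j ≤ W (y : Ω) ^ p * W (f : Ω) ^ (i - j) * 1 * W z ^ j := by
        gcongr
        simpa using h1
      refine lt_of_le_of_lt h3 ?_
      rw [mul_one]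
      exact lt_of_le_of_lt h2 (pow_lt_one₀ zero_le hyz hp.out.ne_zero)
    obtain ⟨w, hw, hw2⟩ := ℘sum (E' := E') (p := p) _ _ hterm
    refine ⟨y * z ^ i + w, add_mem (mul_mem (hE y.2) (pow_mem hzE i)) hw, ?_⟩
    have h5 : (y : Ω) ^ p - y = a := by rw [← hy]; push_cast; rfl
    have h6 : (z ^ i) ^ p = ∑ j ∈ Finset.range i, z ^ j * (f : Ω) ^ (i - j) * (i.choose j : Ω) + z ^ i := by
      rw [← pow_mul, mul_comm, pow_mul]
      have : z ^ p = z + f := by rw [← hz]; ring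
      rw [this, add_pow, Finset.sum_range_succ]
      simp
    have h7 : w ^ p - w = - ((y : Ω) ^ p * ∑ j ∈ Finset.range i, z ^ j * (f : Ω) ^ (i - j) * (i.choose j : Ω)) := by
      rw [hw2, Finset.mul_sum, ← Finset.sum_neg_distrib]
      refine Finset.sum_congr rfl fun j _ => ?_
      push_cast
      ring
    rw [add_pow_char, mul_pow, h6]
    linear_combination h7 + z ^ i * h5

lemma H2_insep {E E' : IntermediateField F Ω} {t ϖ : E} (L : Loc1 p (VE W E) t ϖ) (hE : E ≤ E') {z : Ω} {f : E}
    (hz : z ^ p = f) (hzE : z ∈ E') (i : ℕ) (a : E) (ha : W (a * z ^ i) < 1) : ∃ y ∈ E', y ^ p - y = a * z ^ i := by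
  haveI : CharP Ω p := charP_of_injective_algebraMap (algebraMap F Ω).injective p
  have h1 : (a * z ^ i) ^ p = ((a ^ p * f ^ i : E) : Ω) := by
    push_cast
    rw [← hz]; ring
  obtain ⟨w, hw⟩ := L.H2 (a ^ p * f ^ i) (by
    change W ((a ^ p * f ^ i : E) : Ω) < 1
    rw [← h1, map_pow]
    exact pow_lt_one₀ zero_le ha hp.out.ne_zero)
  refine ⟨w - a * z ^ i, sub_mem (hE w.2) (mul_mem (hE a.2) (pow_mem hzE i)), ?_⟩
  have hw : (w : Ω) ^ p - w = ((a ^ p * f ^ i : E) : Ω) := by rw [← hw]; push_cast; rfl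
  rw [sub_pow_char, h1]
  linear_combination hw

theorem unram_step {E : IntermediateField F Ω} {t ϖ : E} (L : Loc1 p (VE W E) t ϖ) {z : Ω} {c0 : E}
    (hz : z ^ p - z = c0) (hc1 : W (c0 : Ω) ≤ 1) (hc : ∀ y : E, W (y : Ω) ≤ 1 → ¬ W (y ^ p - y - c0 : Ω) < 1) :
    W z = 1 ∧ 
    (Loc1 p (VE W (adj E z)) ⟨t, le_adj E z t.2⟩ ⟨ϖ, le_adj E z ϖ.2⟩) ∧
    ∀ a : ℕ → E, ∀ i < p, W (a i * z ^ i) ≤ W (∑ j ∈ Finset.range p, (a j : Ω) * z ^ j) := by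
  haveI : CharP E p := charP_of_injective_algebraMap (algebraMap F E).injective p
  have hp0 := hp.out.ne_zero
  have hz1 : W z = 1 := by
    rcases lt_trichotomy (W z) 1 with h | h | h
    · exfalso
      refine hc 0 (by simp) ?_
      have := W_small (p := p) h
      have e : ((0 : E) : Ω) ^ p - ((0 : E) : Ω) - (c0 : Ω) = - (z ^ p - z) := by
        rw [hz]; simp [hp0]
      rw [e, Valuation.map_neg, this]
      exact h
    · exact h
    · exfalso
      have := W_big (p := p) h
      rw [hz] at this
      rw [this] at hc1
      exact absurd hc1 (not_le.mpr (one_lt_pow₀ h hp0))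
  have hzE := mem_adj E z
  have hzeq : z ^ p = 1 * z + c0 := by rw [← hz]; ring
  have horth : ∀ a : ℕ → E, ∀ i < p, W (a i * z ^ i) ≤ W (∑ j ∈ Finset.range p, (a j : Ω) * z ^ j) := by
    intro a i hi
    obtain ⟨i0, hi0, hmax⟩ := Finset.exists_max_image (Finset.range p) (fun q => W (a q : Ω)) ⟨i, by simpa using hi⟩
    rw [map_mul, map_pow, hz1, one_pow, mul_one]
    refine (hmax i (by simpa using hi)).trans ?_
    by_contra! hlt
    have ha0 : a i0 ≠ 0 := by
      intro h; rw [h] at hlt; simp at hlt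
    have ha0' : (a i0 : Ω) ≠ 0 := by simpa using ha0
    -- residue fields
    let V := VE W E
    let O := V.valuationSubring
    let OW := W.valuationSubring
    let ι : O →+* OW := ((algebraMap E Ω).comp O.subtype).codRestrict OW.toSubring (fun x => x.2)
    haveI : IsLocalHom ι := ⟨fun x hx => by
      by_contra hne
      have h1 : IsLocalRing.residue O x = 0 := by
        rw [IsLocalRing.residue_eq_zero_iff, IsLocalRing.mem_maximalIdeal]; exact hne
      have h2 : W (ι x : Ω) < 1 := (res_zero_iff (V := V) x).mp h1
      have h3 := (res_zero_iff (V := W) (ι x)).mpr h2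
      rw [IsLocalRing.residue_eq_zero_iff, IsLocalRing.mem_maximalIdeal] at h3
      exact h3 hx⟩
    let K := IsLocalRing.ResidueField O
    let M := IsLocalRing.ResidueField OW
    letI : Algebra K M := (IsLocalRing.ResidueField.map ι).toAlgebra
    have hmap : ∀ x : O, algebraMap K M (IsLocalRing.residue O x) = IsLocalRing.residue OW (ι x) := fun x => rfl
    haveI : CharP O p := (algebraMap O E).charP (IsFractionRing.injective O E) p
    haveI : CharP K p := CharP.of_ringHom_of_ne_zero (IsLocalRing.residue O) p hp.out.ne_zero
    let zO : OW := ⟨z, hz1.le⟩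
    let c : O := ⟨c0, hc1⟩
    have hb : ∀ j, j < p → W ((a j / a i0 : E) : Ω) ≤ 1 := by
      intro j hj
      push_cast
      rw [map_div₀]
      exact div_le_one_of_le₀ (hmax j (by simpa using hj)) zero_le
    let b : ℕ → O := fun j => if h : j < p then ⟨a j / a i0, hb j h⟩ else 0
    have hbv : ∀ j < p, ((b j : E) : Ω) = a j / a i0 := by
      intro j hj
      simp only [b, hj, dif_pos]
      push_cast
      rfl
    let Q : Polynomial K := ∑ j ∈ Finset.range p, Polynomial.C (IsLocalRing.residue O (b j)) * Polynomial.X ^ j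
    have hQc : ∀ j < p, Q.coeff j = IsLocalRing.residue O (b j) := by
      intro j hj
      simp only [Q, Polynomial.finsetSum_coeff, Polynomial.coeff_C_mul_X_pow]
      rw [Finset.sum_ite_eq]
      simp [hj]
    have hQ0 : Q = 0 := by
      refine as_degree p (z := IsLocalRing.residue OW zO) (c := IsLocalRing.residue O c) ?_ ?_ Q ?_ ?_
      · rw [hmap, ← map_pow, ← map_sub]
        congr 1
        exact Subtype.ext hz
      · intro y
        obtain ⟨y, rfl⟩ := IsLocalRing.residue_surjective y
        rw [← map_pow, ← map_sub]
        intro h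
        rw [← sub_eq_zero, ← map_sub, res_zero_iff (V := V)] at h
        refine hc y y.2 ?_
        exact h
      · have : Q.degree < p := by
          refine lt_of_le_of_lt (Polynomial.degree_sum_le _ _) ?_
          rw [Finset.sup_lt_iff (by exact WithBot.bot_lt_coe p)]
          intro j hj
          refine lt_of_le_of_lt (Polynomial.degree_C_mul_X_pow_le _ _) ?_
          exact_mod_cast Finset.mem_range.mp hj
        by_cases hQ : Q = 0
        · rw [hQ]; simpa using hp.out.pos
        · exact (Polynomial.natDegree_lt_iff_degree_lt hQ).mpr this
      · simp only [Q, map_sum, map_mul, map_pow, Polynomial.aeval_X, Polynomial.aeval_C, hmap]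
        have : ∑ x ∈ Finset.range p, (IsLocalRing.residue OW) (ι (b x)) * (IsLocalRing.residue OW) zO ^ x =
          IsLocalRing.residue OW (∑ x ∈ Finset.range p, ι (b x) * zO ^ x) := by
          simp only [map_sum, map_mul, map_pow]
        refine Eq.trans this ?_
        rw [res_zero_iff (V := W)]
        have h2 : ((∑ x ∈ Finset.range p, ι (b x) * zO ^ x : OW) : Ω) = (∑ j ∈ Finset.range p, (a j : Ω) * z ^ j) / a i0 := by
          have h3 := map_sum OW.subtype (fun x => ι (b x) * zO ^ x) (Finset.range p)
          refine h3.trans ?_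
          rw [Finset.sum_div]
          refine Finset.sum_congr rfl fun j hj => ?_
          rw [map_mul, map_pow]
          change ((b j : E) : Ω) * z ^ j = _
          rw [hbv j (Finset.mem_range.mp hj)]
          ring
        rw [h2, map_div₀]
        exact (div_lt_one₀ (zero_lt_iff.mpr ((map_ne_zero W).mpr ha0'))).mpr hlt
    have h1 := hQc i0 (by simpa using hi0)
    rw [hQ0, Polynomial.coeff_zero] at h1
    have h2 : b i0 = 1 := by
      apply Subtype.ext
      apply Subtype.ext
      rw [hbv i0 (by simpa using hi0)]
      exact div_self ha0'
    rw [h2, map_one] at h1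
    exact zero_ne_one h1
  refine ⟨hz1, ⟨?_, ?_, L.tlt, L.ϖlt, ?_, ?_, ?_⟩, horth⟩
  · intro h
    have := congrArg Subtype.val h
    exact L.t0 (Subtype.ext this)
  · intro h
    have := congrArg Subtype.val h
    exact L.ϖ0 (Subtype.ext this)
  · rintro ⟨x, hx⟩ hx0
    obtain ⟨a, rfl⟩ := adj_span hp.out.one_lt E (one_mem E) c0.2 hzeq hx
    have hex : ∃ i ∈ Finset.range p, W (a i : Ω) = W (∑ j ∈ Finset.range p, (a j : Ω) * z ^ j) := by
      obtain ⟨i0, hi0, hmax⟩ := Finset.exists_max_image (Finset.range p) (fun q => W (a q : Ω)) ⟨0, by simpa using hp.out.pos⟩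
      refine ⟨i0, hi0, le_antisymm ?_ ?_⟩
      · simpa [hz1] using horth a i0 (by simpa using hi0)
      · refine W.map_sum_le fun j hj => ?_
        simpa [hz1] using hmax j hj
    obtain ⟨i, -, hi⟩ := hex
    obtain ⟨n, s, h⟩ := L.val (a i) (by
      intro h
      rw [h] at hi
      have : (∑ j ∈ Finset.range p, (a j : Ω) * z ^ j) = 0 := by simpa using hi.symm
      exact hx0 (Subtype.ext this))
    refine ⟨n, s, ?_⟩
    change W (∑ j ∈ Finset.range p, (a j : Ω) * z ^ j) = _
    rw [← hi]
    exact h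
  · rintro ⟨x, hx⟩ hx1
    obtain ⟨a, rfl⟩ := adj_span hp.out.one_lt E (one_mem E) c0.2 hzeq hx
    obtain ⟨y, hy, h⟩ := ℘sum (E' := adj E z) (p := p) (Finset.range p) (fun i => (a i : Ω) * z ^ i) (fun i hi =>
      H2_as L (le_adj E z) hz hz1.ge hzE i (a i) (lt_of_le_of_lt (horth a i (by simpa using hi)) hx1))
    exact ⟨⟨y, hy⟩, Subtype.ext h⟩
  · obtain ⟨R, hR⟩ := L.fin
    classical
    let S : Finset (Fin p → E) := Fintype.piFinset (fun _ => R)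
    let ev : (Fin p → E) → adj E z := fun r => ∑ i : Fin p, ⟨r i, le_adj E z (r i).2⟩ * ⟨z, hzE⟩ ^ (i : ℕ)
    have hev : ∀ r, (ev r : Ω) = ∑ i : Fin p, (r i : Ω) * z ^ (i : ℕ) := by
      intro r
      refine (map_sum (algebraMap (adj E z) Ω) _ _).trans ?_
      refine Finset.sum_congr rfl fun i _ => ?_
      rw [map_mul, map_pow]; rfl
    refine ⟨S.image ev, ?_⟩
    rintro ⟨x, hx⟩ hx1
    obtain ⟨a, rfl⟩ := adj_span hp.out.one_lt E (one_mem E) c0.2 hzeq hx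
    have hx1 : W (∑ j ∈ Finset.range p, (a j : Ω) * z ^ j) ≤ 1 := hx1
    have h1 : ∀ i : Fin p, W (a i : Ω) ≤ 1 := fun i => by simpa [hz1] using (horth a i i.2).trans hx1
    choose r hr hr2 using fun i : Fin p => hR (a i) (h1 i)
    refine ⟨ev r, Finset.mem_image_of_mem _ (Fintype.mem_piFinset.mpr hr), ?_⟩
    change W ((∑ j ∈ Finset.range p, (a j : Ω) * z ^ j) - (ev r : Ω)) < 1
    rw [hev, Finset.sum_range, ← Finset.sum_sub_distrib]
    refine W.map_sum_lt one_ne_zero fun i _ => ?_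
    rw [← sub_mul, map_mul, map_pow, hz1, one_pow, mul_one]
    exact hr2 i
end Unram
end Tower

namespace Tower

section G5
variable {F Ω Γ Γ1 A : Type} [Field F] [Field Ω] [Algebra F Ω] [LinearOrderedCommGroupWithZero Γ] [LinearOrderedCommGroupWithZero Γ1]
  {W : Valuation Ω Γ} {W1 : Valuation Ω Γ1} [CommRing A] [Algebra A Ω]
  {p : ℕ} [hp : Fact p.Prime] [CharP F p]

/-- one step of the tower, with residue data -/
structure Step1 (p : ℕ) (W1 : Valuation Ω Γ1) (E E' : IntermediateField F Ω) : Prop where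
  le : E ≤ E'
  rank : Module.finrank F E' = p * Module.finrank F E
  ex : ∃ z ∈ E', W1 z = 1 ∧ (∀ x ∈ E', ∃ a : ℕ → E, x = ∑ j ∈ Finset.range p, (a j : Ω) * z ^ j) ∧
    (∀ a : ℕ → E, ∀ i < p, W1 (a i : Ω) ≤ W1 (∑ j ∈ Finset.range p, (a j : Ω) * z ^ j)) ∧
    ((∃ g ∈ E, W1 g ≤ 1 ∧ W1 (z ^ p - g) < 1) ∨ z ^ p - z ∈ E)

omit hp [CharP F p] in
lemma W1_eq (hmono : ∀ x y, W x ≤ W y → W1 x ≤ W1 y) {x y : Ω} (h : W x = W y) : W1 x = W1 y :=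
  le_antisymm (hmono _ _ h.le) (hmono _ _ h.ge)

omit [CharP F p] in
theorem mk_step (hmono : ∀ x y, W x ≤ W y → W1 x ≤ W1 y) {E : IntermediateField F Ω}
    (hinteg : ∀ x ∈ E, W1 x ≤ 1 → IsIntegral A x) {z d g : Ω} (hd : d ∈ E) (hg : g ∈ E)
    (hz : z ^ p = d * z + g) (hz1 : W1 z = 1) (hd1 : W1 d ≤ 1) (hg1 : W1 g ≤ 1)
    (horth : ∀ a : ℕ → E, ∀ i < p, W (a i * z ^ i) ≤ W (∑ j ∈ Finset.range p, (a j : Ω) * z ^ j))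
    (halt : (∃ g ∈ E, W1 g ≤ 1 ∧ W1 (z ^ p - g) < 1) ∨ z ^ p - z ∈ E) :
    Step1 p W1 E (adj E z) ∧ ∀ x ∈ adj E z, W1 x ≤ 1 → IsIntegral A x := by
  have hz0 : z ≠ 0 := by rintro rfl; simp at hz1
  have ho1 : ∀ a : ℕ → E, ∀ i < p, W1 (a i : Ω) ≤ W1 (∑ j ∈ Finset.range p, (a j : Ω) * z ^ j) := by
    intro a i hi
    have := hmono _ _ (horth a i hi)
    rwa [map_mul, map_pow, hz1, one_pow, mul_one] at this
  refine ⟨⟨le_adj E z, adj_finrank hp.out.one_lt E hd hg hz ?_, z, mem_adj E z, hz1,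
    fun x hx => adj_span hp.out.one_lt E hd hg hz hx, ho1, halt⟩, ?_⟩
  · intro a ha j hj
    have := horth a j hj
    rw [ha] at this
    simpa [hz0] using this
  · let C := integralClosure A Ω
    have hdC : d ∈ C := hinteg d hd hd1
    have hgC : g ∈ C := hinteg g hg hg1
    have hzC : IsIntegral A z := by
      have : IsIntegral C z := by
        let P : Polynomial C := Polynomial.X ^ p - (Polynomial.C ⟨d, hdC⟩ * Polynomial.X + Polynomial.C ⟨g, hgC⟩)
        refine ⟨P, Polynomial.monic_X_pow_sub (lt_of_le_of_lt Polynomial.degree_linear_le ?_), ?_⟩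
        · exact_mod_cast hp.out.one_lt
        · simp only [P, Polynomial.eval₂_sub, Polynomial.eval₂_add, Polynomial.eval₂_mul, Polynomial.eval₂_pow, Polynomial.eval₂_X, Polynomial.eval₂_C]
          change z ^ p - (d * z + g) = 0
          rw [hz, sub_self]
      exact isIntegral_trans (A := C) z this
    intro x hx hx1
    obtain ⟨a, rfl⟩ := adj_span hp.out.one_lt E hd hg hz hx
    refine IsIntegral.sum _ fun j hj => ?_
    exact (hinteg _ (a j).2 ((ho1 a j (by simpa using hj)).trans hx1)).mul (hzC.pow j)

theorem full_step (hmono : ∀ x y, W x ≤ W y → W1 x ≤ W1 y) {E : IntermediateField F Ω}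
    (hinteg : ∀ x ∈ E, W1 x ≤ 1 → IsIntegral A x) {t ϖ c0 : E} (L : Loc2 p (VE W E) t ϖ c0)
    (ht1 : W1 (t : Ω) = 1) (hϖ1 : W1 (ϖ : Ω) < 1) {f u : E} (hT : TypeOK p (VE W E) t ϖ c0 f u)
    {r s : Ω} (hr : r ^ p - r = f) (hs : s ^ p = u) :
    ∃ E' : IntermediateField F Ω, (r ∈ E' ∨ s ∈ E') ∧ Step1 p W1 E E' ∧
      (∃ t' ϖ' : E', W1 (t' : Ω) = 1 ∧ (ϖ' : Ω) = ϖ ∧ Loc1 p (VE W E') t' ϖ') ∧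
      ∀ x ∈ E', W1 x ≤ 1 → IsIntegral A x := by
  have hp0 := hp.out.ne_zero
  have hpow1 : ∀ {x : Ω}, W1 x ^ p = 1 → W1 x = 1 := fun {x} h => by
    refine (pow_left_inj₀ zero_le zero_le hp0).mp ?_
    rw [h, one_pow]
  obtain ⟨hu0, hC | ⟨N, sv, hf, hN, hsv, hpos⟩ | hA⟩ := hT
  · -- inseparable
    have hWu : W (u : Ω) = W (t : Ω) := hC
    have hz : s ^ p = 0 * s + u := by rw [hs]; ring
    have hz1 : W1 s = 1 := hpow1 (by rw [← map_pow, hs, W1_eq hmono hWu, ht1])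
    have hu1 : W1 (u : Ω) = 1 := by rw [W1_eq hmono hWu, ht1]
    obtain ⟨⟨t', ht', L'⟩, horth⟩ := ram_step L.toLoc1 (zero_mem E) u.2 hz (s := 1) (by
        intro h
        have := Int.le_of_dvd one_pos h
        have := hp.out.one_lt
        omega) (by rw [← map_pow, hs, hWu, zpow_one])
        (fun a i ha => H2_insep L.toLoc1 (le_adj E s) hs (mem_adj E s) i a ha)
    obtain ⟨hst, hi⟩ := mk_step (p := p) hmono hinteg (zero_mem E) u.2 hz hz1 (by simp) hu1.le horth
      (Or.inl ⟨u, u.2, hu1.le, by simp [hs]⟩)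
    refine ⟨adj E s, Or.inr (mem_adj E s), hst, ⟨t', _, hpow1 ?_, ?_, L'⟩, hi⟩
    · rw [← map_pow, W1_eq hmono ((map_pow W _ _).trans ht'), ht1]
    · rfl
  · obtain ⟨M, rfl⟩ := hN
    have hf : W (f : Ω) = W (ϖ : Ω) ^ (-(p * M : ℕ) : ℤ) * W (t : Ω) ^ sv := hf
    have hϖ0 : (ϖ : Ω) ≠ 0 := by simpa using L.ϖ0
    have hWϖ0 : W (ϖ : Ω) ≠ 0 := by simpa using L.ϖ0
    have hfbig : 1 < W (f : Ω) := by
      rw [hf]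
      have := (not_congr (L.lex (n := (-(p * M : ℕ) : ℤ)) (s := sv) (n' := 0) (s' := 0))).mpr (by omega)
      simpa using this
    have hrbig : 1 < W r := by
      by_contra! h
      rw [← hr] at hfbig
      refine absurd hfbig (not_lt.mpr ((W.map_sub _ _).trans (max_le ?_ h)))
      rw [map_pow]; exact pow_le_one₀ zero_le h
    have hWr : W r ^ p = W (f : Ω) := by rw [← W_big hrbig, hr]
    set z : Ω := r * (ϖ : Ω) ^ M with hzdef
    set d : E := ϖ ^ ((p - 1) * M) with hd
    set g : E := ϖ ^ (p * M) * f with hg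
    have hr' : r ^ p = r + f := by rw [← hr]; ring
    have hpM : p * M = (p - 1) * M + M := by
      obtain ⟨q, hq⟩ : ∃ q, p = q + 1 := ⟨p - 1, by have := hp.out.pos; omega⟩
      rw [hq]; simp; ring
    have hz : z ^ p = (d : Ω) * z + g := by
      rw [hd, hg, hzdef]
      push_cast
      rw [mul_pow, hr', ← pow_mul, mul_comm M p]
      rw [hpM, pow_add]; ring
    have hWg : W (g : Ω) = W (t : Ω) ^ sv := by
      rw [hg]; push_cast
      rw [map_mul, map_pow, hf, ← mul_assoc, zpow_neg, zpow_natCast, mul_inv_cancel₀ (pow_ne_zero _ hWϖ0), one_mul]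
    have hWz : W z ^ p = W (t : Ω) ^ sv := by
      rw [← hWg, hzdef, hg]; push_cast
      rw [map_mul, mul_pow, hWr, map_mul, map_pow, map_pow, ← pow_mul, mul_comm M p, mul_comm]
    have hg1 : W1 (g : Ω) = 1 := by
      have : W (g : Ω) = W ((t : Ω) ^ sv) := by rw [hWg, map_zpow₀]
      rw [W1_eq hmono this, map_zpow₀, ht1, one_zpow]
    have hz1 : W1 z = 1 := hpow1 (by
      have : W (z ^ p) = W (g : Ω) := by rw [map_pow, hWz, hWg]
      rw [← map_pow, W1_eq hmono this, hg1])
    have hd1 : W1 (d : Ω) ≤ 1 := by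
      rw [hd]; push_cast; rw [map_pow]; exact pow_le_one₀ zero_le hϖ1.le
    have hϖE : (ϖ : Ω) ∈ adj E z := le_adj E z ϖ.2
    have hrE : r ∈ adj E z := by
      have : r = z * ((ϖ : Ω) ^ M)⁻¹ := by
        rw [hzdef, mul_assoc, mul_inv_cancel₀ (pow_ne_zero _ hϖ0), mul_one]
      rw [this]
      exact mul_mem (mem_adj E z) (inv_mem (pow_mem hϖE M))
    obtain ⟨⟨t', ht', L'⟩, horth⟩ := ram_step L.toLoc1 d.2 g.2 hz hsv hWz (fun a i ha => by
      have e : (a : Ω) * z ^ i = ((a * ϖ ^ (M * i) : E) : Ω) * r ^ i := by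
        rw [hzdef]; push_cast; rw [mul_pow, pow_mul]; ring
      rw [e] at ha ⊢
      exact H2_as L.toLoc1 (le_adj E z) hr hrbig.le hrE i _ ha)
    have halt : (∃ g ∈ E, W1 g ≤ 1 ∧ W1 (z ^ p - g) < 1) ∨ z ^ p - z ∈ E := by
      rcases Nat.eq_zero_or_pos M with h0 | h0
      · right
        have : z = r := by rw [hzdef, h0]; simp
        rw [this, hr]; exact f.2
      · left
        refine ⟨g, g.2, hg1.le, ?_⟩
        have : z ^ p - g = d * z := by rw [hz]; ring
        rw [this, map_mul, hz1, mul_one, hd]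
        push_cast
        rw [map_pow]
        refine pow_lt_one₀ zero_le hϖ1 ?_
        have := hp.out.one_lt
        have : 0 < (p - 1) * M := Nat.mul_pos (by omega) h0
        omega
    obtain ⟨hst, hi⟩ := mk_step (p := p) hmono hinteg d.2 g.2 hz hz1 hd1 hg1.le horth halt
    refine ⟨adj E z, Or.inl hrE, hst, ⟨t', _, hpow1 ?_, ?_, L'⟩, hi⟩
    · rw [← map_pow, W1_eq hmono ((map_pow W _ _).trans ht'), ht1]
    · rfl
  · -- unramified
    rw [hA] at hr
    have hc1 : W (c0 : Ω) ≤ 1 := L.H4'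
    obtain ⟨hz1, L', horth⟩ := unram_step L.toLoc1 hr hc1 (fun y hy h => L.Hc y hy h)
    have hW11 : W1 r = 1 := by
      rw [W1_eq hmono (y := 1) (by rw [hz1, map_one]), map_one]
    have hz : r ^ p = 1 * r + c0 := by rw [← hr]; ring
    obtain ⟨hst, hi⟩ := mk_step (p := p) hmono hinteg (one_mem E) c0.2 hz hW11 (by simp) (by
      have := hmono c0 1 (by simpa using hc1)
      simpa using this) horth (Or.inr (by rw [hr]; exact c0.2))
    exact ⟨adj E r, Or.inl (mem_adj E r), hst, ⟨_, _, ht1, rfl, L'⟩, hi⟩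
end G5
end Tower

namespace Tower

section G6
variable {F Ω Γ Γ1 A : Type} [Field F] [Field Ω] [Algebra F Ω] [IsAlgClosure F Ω] [LinearOrderedCommGroupWithZero Γ] [LinearOrderedCommGroupWithZero Γ1]
  {W : Valuation Ω Γ} {W1 : Valuation Ω Γ1} [CommRing A] [Algebra A Ω]
  {p : ℕ} [hp : Fact p.Prime] [CharP F p]

theorem tower (hmono : ∀ x y, W x ≤ W y → W1 x ≤ W1 y)
    (g : Fin p × Fin p → F) (hg : ∀ x : F, ∃ f : Fin p × Fin p → F, x = ∑ q, f q ^ p * g q)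
    {ϖ0 : Ω} (hϖ1 : W1 ϖ0 < 1) (j : ℕ) : ∀ (E : IntermediateField F Ω) (β : (Ω ≃ₐ[F] Ω) → Ω),
    FiniteDimensional F E → (∀ x ∈ E, W1 x ≤ 1 → IsIntegral A x) →
    (∃ t ϖ : E, W1 (t : Ω) = 1 ∧ (ϖ : Ω) = ϖ0 ∧ Loc1 p (VE W E) t ϖ) → Cond p E β j →
    ∃ c : ℕ → IntermediateField F Ω, c 0 = E ∧ (∀ i < j, Step1 p W1 (c i) (c (i + 1))) ∧
      FiniteDimensional F (c j) ∧ (∀ x ∈ c j, W1 x ≤ 1 → IsIntegral A x) ∧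
      ∃ m : Ω, m ≠ 0 ∧ Cond p (c j) (fun σ => β σ * (m / σ m)) 0 := by
  induction j with
  | zero =>
    intro E β hfd hinteg _ C
    refine ⟨fun _ => E, rfl, fun i hi => absurd hi (by omega), hfd, hinteg, 1, one_ne_zero, ?_⟩
    simpa using C
  | succ j ih =>
    intro E β hfd hinteg hL C
    obtain ⟨t, ϖ, ht1, hϖ, L⟩ := hL
    haveI : CharP E p := charP_of_injective_algebraMap (algebraMap F E).injective p
    obtain ⟨H3, c0, H4, H4', Hc⟩ := L.exists_c0
    have L2 : Loc2 p (VE W E) t ϖ c0 := ⟨L, H3, H4, H4', Hc, L.H5_of g hg⟩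
    obtain ⟨f, u, hT, r, s, m, hr, hs, hm, hC⟩ := key_step E L2 C
    obtain ⟨E', hrs, hst, ⟨t', ϖ', ht', hϖ', L'⟩, hinteg'⟩ := full_step (A := A) hmono hinteg L2 ht1 (by rw [hϖ]; exact hϖ1) hT hr hs
    have hfd' : FiniteDimensional F E' := by
      apply FiniteDimensional.of_finrank_pos
      rw [hst.rank]
      exact Nat.mul_pos hp.out.pos Module.finrank_pos
    obtain ⟨c, hc0, hc1, hcfd, hc2, m', hm', hc3⟩ := ih E' _ hfd' hinteg' ⟨t', ϖ', ht', by rw [hϖ', hϖ], L'⟩ (hC E' hst.le hrs)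
    refine ⟨fun i => Nat.casesOn i E c, rfl, ?_, hcfd, hc2, m * m', mul_ne_zero hm hm', ?_⟩
    · intro i hi
      cases i with
      | zero =>
        show Step1 p W1 E (c 0)
        rw [hc0]
        exact hst
      | succ i => exact hc1 i (by omega)
    · convert hc3 using 2 with σ
      rw [map_mul, mul_div_mul_comm, mul_assoc]
end G6

section Res
variable {Γ1 L : Type} [Field L] [LinearOrderedCommGroupWithZero Γ1] {V : Valuation L Γ1}

/-- valuation ring of a subfield -/
lemma isLocal_of {O : Subring L} {S : Subfield L} (hO : ∀ x, x ∈ O ↔ x ∈ S ∧ V x ≤ 1) :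
    IsLocalRing O ∧ ∀ x : O, IsUnit x ↔ V (x : L) = 1 := by
  have hu : ∀ x : O, IsUnit x ↔ V (x : L) = 1 := by
    intro x
    constructor
    · rintro ⟨u, rfl⟩
      have h1 : V ((u : O) : L) ≤ 1 := ((hO _).mp (u : O).2).2
      have h2 : V ((u⁻¹ : Oˣ) : O) ≤ 1 := ((hO _).mp ((u⁻¹ : Oˣ) : O).2).2
      have h3 : (((u : O) : L)) * (((u⁻¹ : Oˣ) : O) : L) = 1 := by
        rw [← Subring.coe_mul, Units.mul_inv, Subring.coe_one]
      have h4 := congrArg V h3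
      rw [map_mul, map_one] at h4
      refine le_antisymm h1 ?_
      rw [← h4]
      exact mul_le_of_le_one_right zero_le h2
    · intro h
      have h0 : (x : L) ≠ 0 := by intro h0; rw [h0] at h; simp at h
      refine IsUnit.of_mul_eq_one ⟨(x : L)⁻¹, (hO _).mpr ⟨inv_mem ((hO _).mp x.2).1, by rw [map_inv₀, h, inv_one]⟩⟩ ?_
      apply Subtype.ext
      exact mul_inv_cancel₀ h0
  haveI : Nontrivial O := inferInstance
  refine ⟨IsLocalRing.of_nonunits_add fun a b ha hb => ?_, hu⟩
  rw [mem_nonunits_iff, hu] at *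
  have h1 : V (a : L) < 1 := lt_of_le_of_ne ((hO _).mp a.2).2 ha
  have h2 : V (b : L) < 1 := lt_of_le_of_ne ((hO _).mp b.2).2 hb
  exact (V.map_add_lt h1 h2).ne

theorem residueStep_of (p : ℕ) [hp : Fact p.Prime] [CharP L p] {O₁ O₂ : Subring L} {S₁ S₂ : Subfield L} (hS : S₁ ≤ S₂)
    (hO₁ : ∀ x, x ∈ O₁ ↔ x ∈ S₁ ∧ V x ≤ 1) (hO₂ : ∀ x, x ∈ O₂ ↔ x ∈ S₂ ∧ V x ≤ 1)
    {z : L} (hzS : z ∈ S₂) (hz1 : V z = 1)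
    (hspan : ∀ x ∈ S₂, ∃ a : ℕ → L, (∀ j, a j ∈ S₁) ∧ x = ∑ j ∈ Finset.range p, a j * z ^ j)
    (horth : ∀ a : ℕ → L, (∀ j, a j ∈ S₁) → ∀ i < p, V (a i) ≤ V (∑ j ∈ Finset.range p, a j * z ^ j))
    (halt : (∃ g ∈ S₁, V g ≤ 1 ∧ V (z ^ p - g) < 1) ∨ z ^ p - z ∈ S₁) :
    ResidueStep p O₁ O₂ := by
  obtain ⟨l₁, u₁⟩ := isLocal_of hO₁
  obtain ⟨l₂, u₂⟩ := isLocal_of hO₂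
  have r₁ : ∀ x : O₁, IsLocalRing.residue O₁ x = 0 ↔ V (x : L) < 1 := by
    intro x
    rw [IsLocalRing.residue_eq_zero_iff, IsLocalRing.mem_maximalIdeal, mem_nonunits_iff, u₁]
    exact ⟨fun h => lt_of_le_of_ne ((hO₁ _).mp x.2).2 h, fun h => h.ne⟩
  have r₂ : ∀ x : O₂, IsLocalRing.residue O₂ x = 0 ↔ V (x : L) < 1 := by
    intro x
    rw [IsLocalRing.residue_eq_zero_iff, IsLocalRing.mem_maximalIdeal, mem_nonunits_iff, u₂]
    exact ⟨fun h => lt_of_le_of_ne ((hO₂ _).mp x.2).2 h, fun h => h.ne⟩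
  have hle : O₁ ≤ O₂ := fun x hx => (hO₂ x).mpr ⟨hS ((hO₁ x).mp hx).1, ((hO₁ x).mp hx).2⟩
  let ι : O₁ →+* O₂ := Subring.inclusion hle
  haveI : IsLocalHom ι := ⟨fun x hx => by rw [u₁]; exact (u₂ _).mp hx⟩
  let φ := IsLocalRing.ResidueField.map ι
  have hφ : ∀ x : O₁, φ (IsLocalRing.residue O₁ x) = IsLocalRing.residue O₂ (ι x) := fun x => rfl
  let zO : O₂ := ⟨z, (hO₂ z).mpr ⟨hzS, hz1.le⟩⟩
  -- expansion of integral elements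
  have hex : ∀ x : O₂, ∃ a : ℕ → O₁, x = ∑ j ∈ Finset.range p, ι (a j) * zO ^ j := by
    intro x
    obtain ⟨hx1, hx2⟩ := (hO₂ _).mp x.2
    obtain ⟨a, ha, hxa⟩ := hspan x hx1
    refine ⟨fun j => if h : j < p then ⟨a j, (hO₁ _).mpr ⟨ha j, (horth a ha j h).trans (by rw [← hxa]; exact hx2)⟩⟩ else 0, ?_⟩
    apply Subtype.ext
    have h3 := map_sum O₂.subtype (fun j => ι (if h : j < p then ⟨a j, (hO₁ _).mpr ⟨ha j, (horth a ha j h).trans (by rw [← hxa]; exact hx2)⟩⟩ else 0) * zO ^ j) (Finset.range p)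
    refine hxa.trans (Eq.trans ?_ h3.symm)
    refine Finset.sum_congr rfl fun j hj => ?_
    rw [Finset.mem_range] at hj
    simp only [hj, dif_pos]
    rfl
  have hcoe : ∀ a : ℕ → O₁, ((∑ j ∈ Finset.range p, ι (a j) * zO ^ j : O₂) : L) = ∑ j ∈ Finset.range p, (a j : L) * z ^ j := by
    intro a
    exact map_sum O₂.subtype (fun j => ι (a j) * zO ^ j) (Finset.range p)
  have hmem1 : ∀ x : O₁, (x : L) ∈ S₁ := fun x => ((hO₁ _).mp x.2).1
  refine ⟨l₁, l₂, φ, ?_, ?_, ?_⟩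
  · intro x y hxy
    rw [hφ]
    congr 1
    exact Subtype.ext hxy
  · letI := φ.toAlgebra
    let v : Fin p → IsLocalRing.ResidueField O₂ := fun i => IsLocalRing.residue O₂ zO ^ (i : ℕ)
    have hcomb : ∀ a : Fin p → O₁, ∑ i, IsLocalRing.residue O₁ (a i) • v i =
        IsLocalRing.residue O₂ (∑ i, ι (a i) * zO ^ (i : ℕ)) := by
      intro a
      rw [map_sum]
      refine Finset.sum_congr rfl fun i _ => ?_
      rw [map_mul, map_pow, Algebra.smul_def]
      rfl
    have hli : LinearIndependent (IsLocalRing.ResidueField O₁) v := by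
      rw [Fintype.linearIndependent_iff]
      intro b hb i
      choose a ha using fun i => IsLocalRing.residue_surjective (b i)
      have hba : b = fun i => IsLocalRing.residue O₁ (a i) := funext fun i => (ha i).symm
      rw [hba] at hb ⊢
      rw [hcomb a, r₂] at hb
      let a' : ℕ → O₁ := fun j => if h : j < p then a ⟨j, h⟩ else 0
      have e : (∑ i, ι (a i) * zO ^ (i : ℕ) : O₂) = ∑ j ∈ Finset.range p, ι (a' j) * zO ^ j := by
        rw [Finset.sum_range]
        refine Finset.sum_congr rfl fun i _ => ?_
        simp [a']
      rw [e, hcoe] at hb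
      have h2 := horth (fun j => (a' j : L)) (fun j => hmem1 _) i i.2
      rw [r₁]
      have h3 : a' i = a i := by simp [a']
      rw [← h3]
      exact lt_of_le_of_lt h2 hb
    have hsp : ⊤ ≤ Submodule.span (IsLocalRing.ResidueField O₁) (Set.range v) := by
      rintro x -
      obtain ⟨x, rfl⟩ := IsLocalRing.residue_surjective x
      obtain ⟨a, ha⟩ := hex x
      rw [ha, Finset.sum_range, ← hcomb (fun i => a i)]
      exact Submodule.sum_mem _ fun i _ => Submodule.smul_mem _ _ (Submodule.subset_span ⟨i, rfl⟩)
    rw [Module.finrank_eq_card_basis (Module.Basis.mk hli hsp), Fintype.card_fin]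
  · rcases halt with ⟨g, hg, hg1, hzg⟩ | h
    · left
      haveI : CharP O₂ p := (O₂.subtype).charP (Subtype.val_injective) p
      haveI : CharP (IsLocalRing.ResidueField O₂) p := CharP.of_ringHom_of_ne_zero (IsLocalRing.residue O₂) p hp.out.ne_zero
      intro x
      obtain ⟨x, rfl⟩ := IsLocalRing.residue_surjective x
      obtain ⟨a, ha⟩ := hex x
      let gO : O₁ := ⟨g, (hO₁ g).mpr ⟨hg, hg1⟩⟩
      have hzr : IsLocalRing.residue O₂ zO ^ p = φ (IsLocalRing.residue O₁ gO) := by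
        rw [hφ, ← map_pow, ← sub_eq_zero, ← map_sub, r₂]
        exact hzg
      rw [ha, map_sum, sum_pow_char]
      refine sum_mem fun j _ => ?_
      rw [map_mul, map_pow, mul_pow, ← pow_mul, mul_comm j p, pow_mul, hzr, ← hφ]
      exact mul_mem (pow_mem (φ.mem_range_self _) _) (pow_mem (φ.mem_range_self _) _)
    · right
      refine ⟨IsLocalRing.residue O₂ zO, ?_, ?_⟩
      · rintro ⟨b, hb⟩
        obtain ⟨b, rfl⟩ := IsLocalRing.residue_surjective b
        rw [hφ, ← sub_eq_zero, ← map_sub, r₂] at hb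
        have h1 := horth (fun j => if j = 0 then b else if j = 1 then -1 else 0) (fun j => by
          split_ifs
          · exact hmem1 b
          · exact neg_mem (one_mem _)
          · exact zero_mem _) 1 hp.out.one_lt
        have h2 : (∑ j ∈ Finset.range p, (if j = 0 then (b : L) else if j = 1 then -1 else 0) * z ^ j) = b - z := by
          obtain ⟨q, hq⟩ : ∃ q, p = q + 2 := ⟨p - 2, by have := hp.out.two_le; omega⟩
          rw [hq, Finset.sum_range_succ', Finset.sum_range_succ']
          simp
          ring
        rw [h2] at h1
        have h3 : V ((b : L) - z) < 1 := hb
        simp at h1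
        exact absurd h3 (not_lt.mpr h1)
      · refine ⟨IsLocalRing.residue O₁ ⟨z ^ p - z, (hO₁ _).mpr ⟨h, (V.map_sub _ _).trans (max_le ?_ hz1.le)⟩⟩, ?_⟩
        · rw [map_pow, hz1, one_pow]
        · have e : IsLocalRing.residue O₂ (zO ^ p - zO) = IsLocalRing.residue O₂ zO ^ p - IsLocalRing.residue O₂ zO := by
            rw [map_sub, map_pow]
          rw [← e]
          exact hφ _
end Res
end Tower

namespace Tower

section Simple
variable {F K D : Type} [Field F] [Field K] [Algebra F K] [DivisionRing D] [Algebra F D]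

lemma coord_mul_left {κ : Type} [DecidableEq κ] (b : Module.Basis κ F K) (x : K ⊗[F] D) (a : D) (i : κ) :
    TensorProduct.equivFinsuppOfBasisLeft b (((1 : K) ⊗ₜ[F] a) * x) i = a * TensorProduct.equivFinsuppOfBasisLeft b x i := by
  induction x with
  | zero => simp
  | tmul k d =>
    rw [Algebra.TensorProduct.tmul_mul_tmul, one_mul]
    simp only [TensorProduct.equivFinsuppOfBasisLeft_apply_tmul_apply, mul_smul_comm]
  | add x y hx hy => rw [mul_add, map_add, map_add, Finsupp.add_apply, Finsupp.add_apply, hx, hy, mul_add]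

lemma coord_mul_right {κ : Type} [DecidableEq κ] (b : Module.Basis κ F K) (x : K ⊗[F] D) (a : D) (i : κ) :
    TensorProduct.equivFinsuppOfBasisLeft b (x * ((1 : K) ⊗ₜ[F] a)) i = TensorProduct.equivFinsuppOfBasisLeft b x i * a := by
  induction x with
  | zero => simp
  | tmul k d =>
    rw [Algebra.TensorProduct.tmul_mul_tmul, mul_one]
    simp only [TensorProduct.equivFinsuppOfBasisLeft_apply_tmul_apply, smul_mul_assoc]
  | add x y hx hy => rw [add_mul, map_add, map_add, Finsupp.add_apply, Finsupp.add_apply, hx, hy, add_mul]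

lemma comm_right (hc : Subalgebra.center F D = ⊥) (x : K ⊗[F] D)
    (hx : ∀ a : D, ((1 : K) ⊗ₜ[F] a) * x = x * ((1 : K) ⊗ₜ[F] a)) : ∃ k : K, x = k ⊗ₜ[F] (1 : D) := by
  classical
  let b := Module.Free.chooseBasis F K
  have h : ∀ i, ∃ f : F, TensorProduct.equivFinsuppOfBasisLeft b x i = algebraMap F D f := by
    intro i
    have : TensorProduct.equivFinsuppOfBasisLeft b x i ∈ Subalgebra.center F D := by
      rw [Subalgebra.mem_center_iff]
      intro a
      rw [← coord_mul_left, hx, coord_mul_right]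
    rw [hc, Algebra.mem_bot] at this
    obtain ⟨f, hf⟩ := this
    exact ⟨f, hf.symm⟩
  choose f hf using h
  have h2 := TensorProduct.equivFinsuppOfBasisLeft_symm_apply b (TensorProduct.equivFinsuppOfBasisLeft b x)
  rw [LinearEquiv.symm_apply_apply] at h2
  refine ⟨∑ i ∈ (TensorProduct.equivFinsuppOfBasisLeft b x).support, f i • b i, ?_⟩
  rw [TensorProduct.sum_tmul]
  refine h2.trans ?_
  rw [Finsupp.sum]
  refine Finset.sum_congr rfl fun i _ => ?_
  rw [hf, Algebra.algebraMap_eq_smul_one, TensorProduct.tmul_smul, TensorProduct.smul_tmul']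

lemma simple_bc (hc : Subalgebra.center F D = ⊥) : IsSimpleRing (K ⊗[F] D) := by
  classical
  let b := Module.Free.chooseBasis F K
  let q := TensorProduct.equivFinsuppOfBasisLeft (N := D) b
  refine ⟨⟨fun I => ?_⟩⟩
  by_cases hI : ∃ x ∈ I, x ≠ 0
  swap
  · left
    rw [eq_bot_iff]
    intro x hx
    by_contra h
    exact hI ⟨x, hx, fun h0 => h (by rw [h0]; exact zero_mem _)⟩
  right
  have hex : ∃ n : ℕ, ∃ x ∈ I, x ≠ 0 ∧ (q x).support.card = n := by
    obtain ⟨x, hx, h0⟩ := hI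
    exact ⟨_, x, hx, h0, rfl⟩
  classical
  obtain ⟨x, hxI, hx0, hxn⟩ := Nat.find_spec hex
  have hmin : ∀ y ∈ I, (q y).support.card < (q x).support.card → y = 0 := by
    intro y hy hlt
    by_contra h0
    rw [hxn] at hlt
    exact Nat.find_min hex hlt ⟨y, hy, h0, rfl⟩
  have hq0 : q x ≠ 0 := by simpa using hx0
  obtain ⟨i, hi⟩ := Finsupp.support_nonempty_iff.mpr hq0
  rw [Finsupp.mem_support_iff] at hi
  set y := ((1 : K) ⊗ₜ[F] (q x i)⁻¹) * x with hy
  have hyI : y ∈ I := I.mul_mem_left _ _ hxI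
  have hyc : ∀ j, q y j = (q x i)⁻¹ * q x j := fun j => coord_mul_left b x _ j
  have hcomm : ∀ a : D, ((1 : K) ⊗ₜ[F] a) * y = y * ((1 : K) ⊗ₜ[F] a) := by
    intro a
    rw [← sub_eq_zero]
    apply hmin
    · exact sub_mem (I.mul_mem_left _ _ hyI) (I.mul_mem_right _ _ hyI)
    · have hz : ∀ j, q (((1 : K) ⊗ₜ[F] a) * y - y * ((1 : K) ⊗ₜ[F] a)) j = a * q y j - q y j * a := by
        intro j
        rw [map_sub, Finsupp.sub_apply]
        exact congrArg₂ _ (coord_mul_left b y a j) (coord_mul_right b y a j)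
      apply Finset.card_lt_card
      rw [Finset.ssubset_iff_of_subset]
      · refine ⟨i, by simpa using hi, ?_⟩
        rw [Finsupp.notMem_support_iff, hz, hyc, inv_mul_cancel₀ hi, mul_one, one_mul, sub_self]
      · intro j hj
        rw [Finsupp.mem_support_iff] at hj ⊢
        intro h0
        apply hj
        rw [hz, hyc, h0]
        simp
  obtain ⟨k, hk⟩ := comm_right hc y hcomm
  have hk0 : k ≠ 0 := by
    rintro rfl
    have h1 := hyc i
    rw [hk, inv_mul_cancel₀ hi, TensorProduct.zero_tmul, map_zero] at h1
    simp at h1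
  rw [eq_top_iff]
  rintro z -
  have : z = (z * (k⁻¹ ⊗ₜ[F] (1 : D))) * y := by
    rw [hk, mul_assoc, Algebra.TensorProduct.tmul_mul_tmul, inv_mul_cancel₀ hk0, one_mul, ← Algebra.TensorProduct.one_def, mul_one]
  rw [this]
  exact I.mul_mem_left _ _ hyI

/-- splitting over a separably closed field -/
lemma split_sepclosed (hc : Subalgebra.center F D = ⊥) [FiniteDimensional F D] [IsSepClosed K] :
    ∃ (n : ℕ), 0 < n ∧ Nonempty (K ⊗[F] D ≃ₐ[K] Matrix (Fin n) (Fin n) K) := by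
  haveI := simple_bc (K := K) hc
  haveI : IsArtinianRing (K ⊗[F] D) := IsArtinianRing.of_finite K _
  obtain ⟨n, hn, D', i1, i2, i3, ⟨e⟩⟩ := IsSimpleRing.exists_algEquiv_matrix_divisionRing_finite K (K ⊗[F] D)
  have hcen : Algebra.IsCentral K D' := by
    constructor
    intro z hz
    rw [Subalgebra.mem_center_iff] at hz
    obtain ⟨k, hk⟩ := comm_right hc (e.symm (Matrix.scalar (Fin n) z)) (by
      intro a
      apply e.injective
      rw [map_mul, map_mul, e.apply_symm_apply]
      ext i j
      simp [hz])
    have h2 : k ⊗ₜ[F] (1 : D) = algebraMap K (K ⊗[F] D) k := by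
      rw [Algebra.TensorProduct.algebraMap_apply]; rfl
    rw [h2, AlgEquiv.symm_apply_eq, AlgEquiv.commutes] at hk
    have h3 := congrFun (congrFun hk ⟨0, Nat.pos_of_ne_zero hn.out⟩) ⟨0, Nat.pos_of_ne_zero hn.out⟩
    rw [Algebra.mem_bot]
    refine ⟨k, ?_⟩
    simpa [Matrix.algebraMap_matrix_apply] using h3.symm
  have htop : (⊥ : Subalgebra K D') = ⊤ := by
    by_contra hne
    obtain ⟨x, hx, hs⟩ := JacobsonNoether.exists_separable_and_not_isCentral' hne
    apply hx
    have hinteg : IsIntegral K x := Algebra.IsIntegral.isIntegral x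
    have hd : (minpoly K x).degree = 1 := IsSepClosed.degree_eq_one_of_irreducible K (minpoly.irreducible hinteg) hs
    rw [Algebra.mem_bot]
    exact minpoly.mem_range_of_degree_eq_one K x hd
  refine ⟨n, Nat.pos_of_ne_zero hn.out, ⟨e.trans (AlgEquiv.mapMatrix (AlgEquiv.symm (AlgEquiv.ofBijective (Algebra.ofId K D') ⟨(algebraMap K D').injective, ?_⟩)))⟩⟩
  intro y
  have : y ∈ (⊥ : Subalgebra K D') := by rw [htop]; trivial
  rwa [Algebra.mem_bot] at this

end Simple

section Bc
variable {F K A ι : Type} [Field F] [Field K] [Algebra F K] [Ring A] [Algebra F A] [FiniteDimensional F A]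
  [Fintype ι] [DecidableEq ι]

lemma bc_equiv (f : A →ₐ[F] Matrix ι ι K) (hf : Submodule.span K (Set.range f) = ⊤)
    (hcard : Module.finrank F A = Fintype.card ι ^ 2) :
    ∃ e : K ⊗[F] A ≃ₐ[K] Matrix ι ι K, ∀ a, e (1 ⊗ₜ a) = f a := by
  let g : K ⊗[F] A →ₐ[K] Matrix ι ι K := Algebra.TensorProduct.lift (Algebra.ofId K _) f (fun k a => Algebra.commutes k (f a))
  have hg : ∀ a, g (1 ⊗ₜ a) = f a := fun a => (Algebra.TensorProduct.lift_tmul _ _ _ _ _).trans (by rw [map_one, one_mul])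
  have hsurj : Function.Surjective g.toLinearMap := by
    rw [← LinearMap.range_eq_top, eq_top_iff, ← hf, Submodule.span_le]
    rintro _ ⟨a, rfl⟩
    exact ⟨1 ⊗ₜ a, hg a⟩
  have hinj : Function.Injective g.toLinearMap := by
    rw [LinearMap.injective_iff_surjective_of_finrank_eq_finrank]
    · exact hsurj
    · rw [Module.finrank_baseChange, hcard, Module.finrank_matrix, Module.finrank_self, sq, mul_one]
  exact ⟨AlgEquiv.ofBijective g ⟨hinj, hsurj⟩, hg⟩

lemma skolem (f g : A →ₐ[F] Matrix ι ι K) (hf : Submodule.span K (Set.range f) = ⊤)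
    (hg : Submodule.span K (Set.range g) = ⊤)
    (hcard : Module.finrank F A = Fintype.card ι ^ 2) :
    ∃ U : Matrix ι ι K, IsUnit U ∧ ∀ a, f a * U = U * g a := by
  obtain ⟨e1, h1⟩ := bc_equiv f hf hcard
  obtain ⟨e2, h2⟩ := bc_equiv g hg hcard
  let φ : Matrix ι ι K ≃ₐ[K] Matrix ι ι K := e2.symm.trans e1
  let T := Matrix.toLinAlgEquiv' (R := K) (n := ι)
  obtain ⟨S, hS⟩ := AlgEquiv.eq_linearEquivConjAlgEquiv ((T.symm.trans φ).trans T)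
  refine ⟨T.symm S.toLinearMap, ?_, fun a => ?_⟩
  · have h1 : T.symm S.toLinearMap * T.symm S.symm.toLinearMap = 1 := by
      rw [← map_mul, ← map_one T.symm]
      exact congrArg T.symm (LinearMap.ext fun x => S.apply_symm_apply x)
    exact IsUnit.of_mul_eq_one _ h1
  · have h3 := congrArg (fun q => q (T (g a))) hS
    have h4 : φ (g a) = f a := by
      rw [← h1, ← h2]
      exact congrArg e1 (e2.symm_apply_apply _)
    simp only [AlgEquiv.trans_apply, AlgEquiv.symm_apply_apply, h4] at h3
    apply T.injective
    rw [map_mul, map_mul, h3, AlgEquiv.apply_symm_apply]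
    apply LinearMap.ext
    intro x
    simp [LinearEquiv.conjAlgEquiv]

end Bc
end Tower

namespace Tower

section Full
variable {F K A ι : Type} [Field F] [Field K] [Algebra F K] [Ring A] [Algebra F A] [FiniteDimensional F A]
  [Fintype ι] [DecidableEq ι]

lemma full_li (f : A →ₐ[F] Matrix ι ι K) (hf : Submodule.span K (Set.range f) = ⊤)
    (hcard : Module.finrank F A = Fintype.card ι ^ 2) :
    LinearIndependent K (fun i => f (Module.finBasis F A i)) := by
  apply linearIndependent_of_top_le_span_of_card_eq_finrank
  · rw [← hf, Submodule.span_le]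
    rintro _ ⟨a, rfl⟩
    rw [← (Module.finBasis F A).sum_repr a, map_sum]
    refine Submodule.sum_mem _ fun i _ => ?_
    rw [map_smul, ← algebraMap_smul K]
    exact Submodule.smul_mem _ _ (Submodule.subset_span ⟨i, rfl⟩)
  · rw [Fintype.card_fin, hcard, Module.finrank_matrix, Module.finrank_self, sq, mul_one]

lemma li_full (f : A →ₐ[F] Matrix ι ι K) (hf : LinearIndependent K (fun i => f (Module.finBasis F A i)))
    (hcard : Module.finrank F A = Fintype.card ι ^ 2) : Submodule.span K (Set.range f) = ⊤ := by
  rw [eq_top_iff, ← hf.span_eq_top_of_card_eq_finrank' (by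
    rw [Fintype.card_fin, hcard, Module.finrank_matrix, Module.finrank_self, sq, mul_one])]
  apply Submodule.span_mono
  rintro _ ⟨i, rfl⟩
  exact ⟨_, rfl⟩

lemma full_inj (f : A →ₐ[F] Matrix ι ι K) (hf : Submodule.span K (Set.range f) = ⊤)
    (hcard : Module.finrank F A = Fintype.card ι ^ 2) : Function.Injective f := by
  obtain ⟨e, he⟩ := bc_equiv f hf hcard
  intro a b hab
  rw [← he, ← he] at hab
  exact Algebra.TensorProduct.includeRight_injective (algebraMap F K).injective (e.injective hab)

omit [FiniteDimensional F A] in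
lemma full_cent (f : A →ₐ[F] Matrix ι ι K) (hf : Submodule.span K (Set.range f) = ⊤)
    [Nonempty ι] (X : Matrix ι ι K) (hX : ∀ a, f a * X = X * f a) : ∃ c : K, X = c • 1 := by
  have h : ∀ Y : Matrix ι ι K, Y * X = X * Y := by
    intro Y
    have hY : Y ∈ Submodule.span K (Set.range f) := by rw [hf]; trivial
    induction hY using Submodule.span_induction with
    | mem x hx => obtain ⟨a, rfl⟩ := hx; exact hX a
    | zero => simp
    | add x y _ _ hx hy => rw [add_mul, mul_add, hx, hy]
    | smul c x _ hx => rw [smul_mul_assoc, mul_smul_comm, hx]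
  have h2 : X ∈ Subalgebra.center K (Matrix ι ι K) := by
    rw [Subalgebra.mem_center_iff]; exact h
  rw [Algebra.IsCentral.center_eq_bot, Algebra.mem_bot] at h2
  obtain ⟨c, hc⟩ := h2
  exact ⟨c, by rw [← hc, Algebra.algebraMap_eq_smul_one]⟩

variable {Ω : Type} [Field Ω] [Algebra F Ω] [Algebra K Ω] [IsScalarTower F K Ω]

omit [FiniteDimensional F A] in
lemma descend0 (f0 : A →ₐ[F] Matrix ι ι Ω) (hK : ∀ a i j, ∃ e : K, algebraMap K Ω e = f0 a i j) :
    ∃ f : A →ₐ[F] Matrix ι ι K, ∀ a i j, algebraMap K Ω (f a i j) = f0 a i j := by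
  let J : Matrix ι ι K →ₐ[F] Matrix ι ι Ω := (IsScalarTower.toAlgHom F K Ω).mapMatrix
  have hJ : Function.Injective J := by
    intro X Y h
    ext i j
    exact (algebraMap K Ω).injective (congrFun (congrFun h i) j)
  have hr : ∀ a, f0 a ∈ J.range := by
    intro a
    choose e he using hK a
    exact ⟨Matrix.of fun i j => e i j, by ext i j; exact he i j⟩
  let f : A →ₐ[F] Matrix ι ι K := (AlgEquiv.ofInjective J hJ).symm.toAlgHom.comp (f0.codRestrict J.range hr)
  refine ⟨f, fun a i j => ?_⟩
  have h1 : J (f a) = f0 a := by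
    have := (AlgEquiv.ofInjective J hJ).apply_symm_apply (f0.codRestrict J.range hr a)
    exact congrArg Subtype.val this
  exact congrFun (congrFun h1 i) j

lemma descend (f0 : A →ₐ[F] Matrix ι ι Ω) (hK : ∀ a i j, ∃ e : K, algebraMap K Ω e = f0 a i j)
    (hf : Submodule.span Ω (Set.range f0) = ⊤) (hcard : Module.finrank F A = Fintype.card ι ^ 2) :
    ∃ f : A →ₐ[F] Matrix ι ι K, (∀ a i j, algebraMap K Ω (f a i j) = f0 a i j) ∧
      Submodule.span K (Set.range f) = ⊤ := by
  obtain ⟨f, h⟩ := descend0 f0 hK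
  refine ⟨f, h, li_full f ?_ hcard⟩
  have h1 := (full_li f0 hf hcard).restrict_scalars (R := K) (by
    intro x y hxy
    simpa [Algebra.smul_def] using hxy)
  let J : Matrix ι ι K →ₗ[K] Matrix ι ι Ω := (Algebra.linearMap K Ω).mapMatrix
  refine LinearIndependent.of_comp J ?_
  convert h1 using 1
  funext x
  ext i j
  exact h _ i j

end Full

section Rep
variable {F Ω A ι : Type} [Field F] [Field Ω] [Algebra F Ω] [Ring A] [Algebra F A]
  [Fintype ι] [DecidableEq ι]

structure Rep (ρ : A →ₐ[F] Matrix ι ι Ω) : Prop where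
  sep : ∀ a i j, IsSeparable F (ρ a i j)
  full : Submodule.span Ω (Set.range ρ) = ⊤
  card : Module.finrank F A = Fintype.card ι ^ 2

lemma Rep.skolem [FiniteDimensional F A] {ρ₁ ρ₂ : A →ₐ[F] Matrix ι ι Ω} (h1 : Rep ρ₁) (h2 : Rep ρ₂) :
    ∃ U : Matrix ι ι Ω, IsUnit U ∧ (∀ i j, IsSeparable F (U i j)) ∧ ∀ a, ρ₁ a * U = U * ρ₂ a := by
  obtain ⟨f, hf, hff⟩ := descend (K := separableClosure F Ω) ρ₁ (fun a i j => ⟨⟨_, mem_separableClosure_iff.mpr (h1.sep a i j)⟩, rfl⟩) h1.full h1.card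
  obtain ⟨g, hg, hgf⟩ := descend (K := separableClosure F Ω) ρ₂ (fun a i j => ⟨⟨_, mem_separableClosure_iff.mpr (h2.sep a i j)⟩, rfl⟩) h2.full h2.card
  obtain ⟨U, hU, h⟩ := Tower.skolem f g hff hgf h1.card
  let J : Matrix ι ι (separableClosure F Ω) →+* Matrix ι ι Ω := (algebraMap (separableClosure F Ω) Ω).mapMatrix
  refine ⟨J U, hU.map J, fun i j => mem_separableClosure_iff.mp (U i j).2, fun a => ?_⟩
  have e1 : ρ₁ a = J (f a) := by ext i j; exact (hf a i j).symm
  have e2 : ρ₂ a = J (g a) := by ext i j; exact (hg a i j).symm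
  rw [e1, e2, ← map_mul, ← map_mul, h]

/-- twist of a representation -/
def tw (ρ : A →ₐ[F] Matrix ι ι Ω) (σ : Ω ≃ₐ[F] Ω) : A →ₐ[F] Matrix ι ι Ω :=
  (σ : Ω →ₐ[F] Ω).mapMatrix.comp ρ

lemma tw_apply (ρ : A →ₐ[F] Matrix ι ι Ω) (σ : Ω ≃ₐ[F] Ω) (a : A) : tw ρ σ a = (ρ a).map σ := rfl

lemma Rep.tw {ρ : A →ₐ[F] Matrix ι ι Ω} (h : Rep ρ) (σ : Ω ≃ₐ[F] Ω) : Rep (tw ρ σ) := by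
  refine ⟨fun a i j => ?_, ?_, h.card⟩
  · have := h.sep a i j
    rw [IsSeparable] at this ⊢
    rwa [tw_apply, Matrix.map_apply, minpoly.algEquiv_eq σ]
  · have key : ∀ Y ∈ Submodule.span Ω (Set.range ρ), Y.map σ ∈ Submodule.span Ω (Set.range (Tower.tw ρ σ)) := by
      intro Y hY
      induction hY using Submodule.span_induction with
      | mem x hx => obtain ⟨a, rfl⟩ := hx; exact Submodule.subset_span ⟨a, rfl⟩
      | zero => rw [Matrix.map_zero _ (map_zero σ)]; exact zero_mem _
      | add x y _ _ hx hy => rw [Matrix.map_add _ (map_add σ)]; exact add_mem hx hy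
      | smul c x _ hx =>
        have : (c • x).map σ = σ c • x.map σ := by ext i j; simp
        rw [this]; exact Submodule.smul_mem _ _ hx
    rw [eq_top_iff]
    rintro X -
    have h1 := key (X.map σ.symm) (by rw [h.full]; trivial)
    rw [Matrix.map_map] at h1
    convert h1
    ext i j
    simp

lemma smooth_tw [FiniteDimensional F A] (ρ : A →ₐ[F] Matrix ι ι Ω) : Smooth (fun σ => tw ρ σ) := by
  refine ⟨Set.range (fun x : Fin (Module.finrank F A) × ι × ι => ρ (Module.finBasis F A x.1) x.2.1 x.2.2), Set.finite_range _, fun σ τ h => ?_⟩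
  apply AlgHom.toLinearMap_injective
  apply (Module.finBasis F A).ext
  intro x
  ext i j
  exact h _ ⟨(x, i, j), rfl⟩

structure UData (ρ : A →ₐ[F] Matrix ι ι Ω) (U : (Ω ≃ₐ[F] Ω) → Matrix ι ι Ω) : Prop where
  sm : Smooth U
  unit : ∀ σ, IsUnit (U σ)
  sep : ∀ σ i j, IsSeparable F (U σ i j)
  int : ∀ σ a, ρ a * U σ = U σ * (ρ a).map σ

lemma Rep.exists_U [FiniteDimensional F A] {ρ : A →ₐ[F] Matrix ι ι Ω} (h : Rep ρ) : ∃ U, UData ρ U := by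
  classical
  let P : (A →ₐ[F] Matrix ι ι Ω) → Matrix ι ι Ω → Prop := fun ρ' U =>
    IsUnit U ∧ (∀ i j, IsSeparable F (U i j)) ∧ ∀ a, ρ a * U = U * ρ' a
  let pick : (A →ₐ[F] Matrix ι ι Ω) → Matrix ι ι Ω := fun ρ' => if h : ∃ U, P ρ' U then h.choose else 1
  have hp : ∀ σ, P (Tower.tw ρ σ) (pick (Tower.tw ρ σ)) := by
    intro σ
    have h1 : ∃ U, P (Tower.tw ρ σ) U := h.skolem (h.tw σ)
    simp only [pick, dif_pos h1]
    exact h1.choose_spec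
  exact ⟨fun σ => pick (Tower.tw ρ σ), (smooth_tw ρ).comp pick, fun σ => (hp σ).1, fun σ => (hp σ).2.1, fun σ => (hp σ).2.2⟩

lemma map_mulM (X Y : Matrix ι ι Ω) (σ : Ω ≃ₐ[F] Ω) : (X * Y).map σ = X.map σ * Y.map σ :=
  map_mul (σ : Ω →ₐ[F] Ω).mapMatrix X Y

lemma map_unitM {X : Matrix ι ι Ω} (hX : IsUnit X) (σ : Ω ≃ₐ[F] Ω) : IsUnit (X.map σ) :=
  hX.map (σ : Ω →ₐ[F] Ω).mapMatrix

lemma unit_ne_zero [Nonempty ι] {X : Matrix ι ι Ω} (hX : IsUnit X) : ∃ i j, X i j ≠ 0 := by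
  by_contra h
  push Not at h
  exact hX.ne_zero (by ext i j; exact h i j)

lemma cent_unit [Nonempty ι] {ρ : A →ₐ[F] Matrix ι ι Ω} (h : Submodule.span Ω (Set.range ρ) = ⊤)
    {X Y : Matrix ι ι Ω} {ρ' : A → Matrix ι ι Ω} (hX : IsUnit X) (hY : IsUnit Y)
    (h1 : ∀ a, ρ a * X = X * ρ' a) (h2 : ∀ a, ρ a * Y = Y * ρ' a) : ∃ c : Ω, c ≠ 0 ∧ X = c • Y := by
  obtain ⟨y, rfl⟩ := hY
  have h3 : ∀ a, ρ' a * (↑y⁻¹ : Matrix ι ι Ω) = (↑y⁻¹ : Matrix ι ι Ω) * ρ a := by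
    intro a
    rw [Units.eq_inv_mul_iff_mul_eq, ← mul_assoc, ← h2, mul_assoc, Units.mul_inv, mul_one]
  obtain ⟨c, hc⟩ := full_cent ρ h (X * (↑y⁻¹ : Matrix ι ι Ω)) (fun a => by
    rw [← mul_assoc, h1, mul_assoc, h3, mul_assoc])
  have hXe : X = c • (y : Matrix ι ι Ω) := by
    rw [Units.mul_inv_eq_iff_eq_mul] at hc
    rw [hc, smul_mul_assoc, one_mul]
  refine ⟨c, ?_, hXe⟩
  rintro rfl
  rw [zero_smul] at hXe
  exact hX.ne_zero hXe

lemma UData.coc [Nonempty ι] {ρ : A →ₐ[F] Matrix ι ι Ω} (h : Rep ρ) {U : (Ω ≃ₐ[F] Ω) → Matrix ι ι Ω} (u : UData ρ U)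
    (σ τ : Ω ≃ₐ[F] Ω) : ∃ c : Ω, c ≠ 0 ∧ IsSeparable F c ∧ U σ * (U τ).map σ = c • U (σ * τ) := by
  obtain ⟨c, hc, he⟩ := cent_unit (ρ' := fun a => (ρ a).map ((σ * τ : Ω ≃ₐ[F] Ω) : Ω → Ω)) h.full ((u.unit σ).mul (map_unitM (u.unit τ) σ)) (u.unit (σ * τ))
    (fun a => by
      rw [← mul_assoc, u.int, mul_assoc, ← map_mulM, u.int, map_mulM, mul_assoc, Matrix.map_map]; rfl)
    (fun a => u.int _ a)
  refine ⟨c, hc, ?_, he⟩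
  obtain ⟨i, j, hij⟩ := unit_ne_zero (u.unit (σ * τ))
  have h1 : c = (U σ * (U τ).map σ) i j / U (σ * τ) i j := by
    rw [he, Matrix.smul_apply, smul_eq_mul, mul_div_cancel_right₀ _ hij]
  rw [← mem_separableClosure_iff, h1]
  refine div_mem ?_ (mem_separableClosure_iff.mpr (u.sep _ _ _))
  rw [Matrix.mul_apply]
  refine sum_mem fun x _ => mul_mem (mem_separableClosure_iff.mpr (u.sep _ _ _)) ?_
  rw [mem_separableClosure_iff, Matrix.map_apply]
  have h2 := u.sep τ x j
  rw [IsSeparable] at h2 ⊢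
  rwa [minpoly.algEquiv_eq σ]

end Rep
end Tower

namespace Tower

section Kr
variable {F Ω A ι : Type} [Field F] [Field Ω] [Algebra F Ω] [Ring A] [Algebra F A]
  [Fintype ι] [DecidableEq ι] {N : ℕ}

/-- Kronecker product of a family of matrices -/
def krM (Ω ι : Type) [Field Ω] [Fintype ι] [DecidableEq ι] (N : ℕ) :
    MultilinearMap Ω (fun _ : Fin N => Matrix ι ι Ω) (Matrix (Fin N → ι) (Fin N → ι) Ω) :=
  (Matrix.ofLinearEquiv Ω).toLinearMap.compMultilinearMap (MultilinearMap.pi fun x : Fin N → ι => MultilinearMap.pi fun y : Fin N → ι =>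
    (MultilinearMap.mkPiAlgebra Ω (Fin N) Ω).compLinearMap (fun i => Matrix.entryLinearMap Ω Ω (x i) (y i)))

lemma krM_apply (X : Fin N → Matrix ι ι Ω) (x y : Fin N → ι) : krM Ω ι N X x y = ∏ i, X i (x i) (y i) := by
  simp [krM]

lemma krM_mul (X Y : Fin N → Matrix ι ι Ω) : krM Ω ι N (X * Y) = krM Ω ι N X * krM Ω ι N Y := by
  ext x y
  rw [krM_apply, Matrix.mul_apply]
  simp only [krM_apply, Pi.mul_apply, Matrix.mul_apply, ← Finset.prod_mul_distrib]
  rw [Finset.prod_univ_sum, Fintype.piFinset_univ]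

lemma krM_one : krM Ω ι N 1 = 1 := by
  ext x y
  rw [krM_apply]
  by_cases h : x = y
  · subst h; simp
  · rw [Matrix.one_apply_ne h]
    obtain ⟨i, hi⟩ := Function.ne_iff.mp h
    exact Finset.prod_eq_zero (Finset.mem_univ i) (by simp [Matrix.one_apply_ne hi])

lemma krM_map (X : Fin N → Matrix ι ι Ω) (σ : Ω ≃ₐ[F] Ω) :
    (krM Ω ι N X).map σ = krM Ω ι N (fun i => (X i).map σ) := by
  ext x y
  rw [Matrix.map_apply, krM_apply, krM_apply, map_prod]
  rfl

/-- constant Kronecker power -/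
def kp (N : ℕ) (X : Matrix ι ι Ω) : Matrix (Fin N → ι) (Fin N → ι) Ω := krM Ω ι N (fun _ => X)

lemma kp_mul (X Y : Matrix ι ι Ω) : kp N (X * Y) = kp N X * kp N Y := krM_mul _ _
lemma kp_one : kp N (1 : Matrix ι ι Ω) = 1 := krM_one
lemma kp_map (X : Matrix ι ι Ω) (σ : Ω ≃ₐ[F] Ω) : (kp N X).map σ = kp N (X.map σ) := krM_map _ _
lemma kp_smul (c : Ω) (X : Matrix ι ι Ω) : kp N (c • X) = c ^ N • kp N X := by
  have := (krM Ω ι N).map_smul_univ (fun _ => c) (fun _ => X)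
  rw [Finset.prod_const, Finset.card_univ, Fintype.card_fin] at this
  exact this
lemma kp_unit {X : Matrix ι ι Ω} (hX : IsUnit X) : IsUnit (kp N X) := by
  obtain ⟨u, rfl⟩ := hX
  refine IsUnit.of_mul_eq_one (kp N (↑u⁻¹ : Matrix ι ι Ω)) ?_
  rw [← kp_mul, Units.mul_inv, kp_one]

/-- the tensor power representation -/
def tpow (ρ : A →ₐ[F] Matrix ι ι Ω) (N : ℕ) : (⨂[F] _ : Fin N, A) →ₐ[F] Matrix (Fin N → ι) (Fin N → ι) Ω :=
  PiTensorProduct.liftAlgHom (((krM Ω ι N).restrictScalars F).compLinearMap (fun _ => ρ.toLinearMap))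
    (by
      refine Eq.trans ?_ (krM_one (Ω := Ω) (ι := ι) (N := N))
      show krM Ω ι N _ = _
      congr 1
      funext i
      exact map_one ρ)
    (by
      intro x y
      refine Eq.trans ?_ (krM_mul (fun i => ρ (x i)) (fun i => ρ (y i)))
      show krM Ω ι N _ = _
      congr 1
      funext i
      exact map_mul ρ _ _)

lemma tpow_tprod (ρ : A →ₐ[F] Matrix ι ι Ω) (a : Fin N → A) :
    tpow ρ N (PiTensorProduct.tprod F a) = krM Ω ι N (fun i => ρ (a i)) := by
  rw [tpow, PiTensorProduct.liftAlgHom_apply, PiTensorProduct.lift.tprod]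
  rfl

instance tfin [FiniteDimensional F A] : FiniteDimensional F (⨂[F] _ : Fin N, A) :=
  Module.Basis.finiteDimensional_of_finite (Basis.piTensorProduct (fun _ : Fin N => Module.finBasis F A))

lemma trank [FiniteDimensional F A] : Module.finrank F (⨂[F] _ : Fin N, A) = Module.finrank F A ^ N := by
  rw [Module.finrank_eq_card_basis (Basis.piTensorProduct (fun _ : Fin N => Module.finBasis F A))]
  simp

lemma Rep.tpow [FiniteDimensional F A] {ρ : A →ₐ[F] Matrix ι ι Ω} (h : Rep ρ) (N : ℕ) : Rep (tpow ρ N) := by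
  refine ⟨fun a x y => ?_, ?_, ?_⟩
  · rw [← mem_separableClosure_iff]
    induction a using PiTensorProduct.induction_on with
    | smul_tprod r a =>
      rw [map_smul, tpow_tprod, Matrix.smul_apply, krM_apply]
      refine (separableClosure F Ω).smul_mem (prod_mem fun i _ => mem_separableClosure_iff.mpr (h.sep _ _ _))
    | add a b ha hb => rw [map_add]; exact add_mem ha hb
  · have hk : ∀ X : Fin N → Matrix ι ι Ω, krM Ω ι N X ∈ Submodule.span Ω (Set.range (Tower.tpow ρ N)) := by
      intro X
      have hb : Submodule.span Ω (Set.range fun i => ρ (Module.finBasis F A i)) = ⊤ :=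
        (full_li ρ h.full h.card).span_eq_top_of_card_eq_finrank' (by
          rw [Fintype.card_fin, h.card, Module.finrank_matrix, Module.finrank_self, sq, mul_one])
      have hX : ∀ i, ∃ c : Fin (Module.finrank F A) → Ω, ∑ j, c j • ρ (Module.finBasis F A j) = X i := by
        intro i
        have : X i ∈ Submodule.span Ω (Set.range fun i => ρ (Module.finBasis F A i)) := by rw [hb]; trivial
        exact (Submodule.mem_span_range_iff_exists_fun Ω).mp this
      choose c hc using hX
      have e : X = fun i => ∑ j, c i j • ρ (Module.finBasis F A j) := funext fun i => (hc i).symm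
      rw [e, MultilinearMap.map_sum]
      refine Submodule.sum_mem _ fun r _ => ?_
      rw [(krM Ω ι N).map_smul_univ (fun i => c i (r i)) (fun i => ρ (Module.finBasis F A (r i)))]
      exact Submodule.smul_mem _ _ (Submodule.subset_span ⟨_, tpow_tprod ρ _⟩)
    rw [eq_top_iff]
    rintro X -
    rw [Matrix.matrix_eq_sum_single X]
    refine Submodule.sum_mem _ fun x _ => Submodule.sum_mem _ fun y _ => ?_
    have : Matrix.single x y (X x y) = X x y • krM Ω ι N (fun i => Matrix.single (x i) (y i) 1) := by
      ext a b
      rw [Matrix.smul_apply, krM_apply]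
      by_cases hab : x = a ∧ y = b
      · obtain ⟨rfl, rfl⟩ := hab
        simp
      · rw [Matrix.single_apply_of_ne _ _ _ _ _ hab]
        have : ∃ i, ¬ (x i = a i ∧ y i = b i) := by
          by_contra hh
          push Not at hh
          exact hab ⟨funext fun i => (hh i).1, funext fun i => (hh i).2⟩
        obtain ⟨i, hi⟩ := this
        have h0 : (∏ i, Matrix.single (x i) (y i) (1 : Ω) (a i) (b i)) = 0 :=
          Finset.prod_eq_zero (Finset.mem_univ i) (Matrix.single_apply_of_ne _ _ _ _ _ hi)
        rw [h0, smul_zero]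
    rw [this]
    exact Submodule.smul_mem _ _ (hk _)
  · rw [trank, h.card, Fintype.card_fun, Fintype.card_fin, ← pow_mul, ← pow_mul, mul_comm]

lemma tpow_int {ρ : A →ₐ[F] Matrix ι ι Ω} {U : Matrix ι ι Ω} {σ : Ω ≃ₐ[F] Ω} (h : ∀ a, ρ a * U = U * (ρ a).map σ)
    (a : ⨂[F] _ : Fin N, A) : tpow ρ N a * kp N U = kp N U * (tpow ρ N a).map σ := by
  induction a using PiTensorProduct.induction_on with
  | smul_tprod r a =>
    have e : (tpow ρ N (r • PiTensorProduct.tprod F a)).map σ = r • (tpow ρ N (PiTensorProduct.tprod F a)).map σ := by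
      rw [map_smul]; ext i j; simp
    rw [e, map_smul, smul_mul_assoc, mul_smul_comm, tpow_tprod, krM_map]
    congr 1
    rw [kp, ← krM_mul, ← krM_mul]
    congr 1
    funext i
    exact h (a i)
  | add a b ha hb => rw [map_add, Matrix.map_add _ (map_add σ), add_mul, mul_add, ha, hb]

end Kr
end Tower

namespace Tower

section Desc
variable {F Ω A ι : Type} [Field F] [Field Ω] [Algebra F Ω] [Ring A] [Algebra F A]
  [Fintype ι] [DecidableEq ι]

/-- conjugated representation -/
def conjRep (ρ : A →ₐ[F] Matrix ι ι Ω) (q : (Matrix ι ι Ω)ˣ) : A →ₐ[F] Matrix ι ι Ω where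
  toFun a := (↑q⁻¹ : Matrix ι ι Ω) * ρ a * q
  map_one' := by simp
  map_mul' a b := by
    rw [map_mul]
    simp only [mul_assoc, Units.mul_inv_cancel_left]
  map_zero' := by simp
  map_add' a b := by rw [map_add, mul_add, add_mul]
  commutes' r := by
    rw [AlgHom.commutes, ← Algebra.commutes, mul_assoc, Units.inv_mul, mul_one]

lemma conjRep_apply (ρ : A →ₐ[F] Matrix ι ι Ω) (q : (Matrix ι ι Ω)ˣ) (a : A) :
    conjRep ρ q a = (↑q⁻¹ : Matrix ι ι Ω) * ρ a * q := rfl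

lemma conjRep_full {ρ : A →ₐ[F] Matrix ι ι Ω} (h : Submodule.span Ω (Set.range ρ) = ⊤) (q : (Matrix ι ι Ω)ˣ) :
    Submodule.span Ω (Set.range (conjRep ρ q)) = ⊤ := by
  have key : ∀ Y ∈ Submodule.span Ω (Set.range ρ), (↑q⁻¹ : Matrix ι ι Ω) * Y * q ∈ Submodule.span Ω (Set.range (conjRep ρ q)) := by
    intro Y hY
    induction hY using Submodule.span_induction with
    | mem x hx => obtain ⟨a, rfl⟩ := hx; exact Submodule.subset_span ⟨a, rfl⟩
    | zero => simp
    | add x y _ _ hx hy => rw [mul_add, add_mul]; exact add_mem hx hy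
    | smul c x _ hx => rw [mul_smul_comm, smul_mul_assoc]; exact Submodule.smul_mem _ _ hx
  rw [eq_top_iff]
  rintro X -
  have h1 := key (q * X * (↑q⁻¹ : Matrix ι ι Ω)) (by rw [h]; trivial)
  simpa [mul_assoc] using h1

lemma inv_sep {E : Type} [Field E] [Algebra E Ω] (q : (Matrix ι ι Ω)ˣ) (hq : ∀ i j, IsSeparable E ((q : Matrix ι ι Ω) i j)) :
    ∀ i j, IsSeparable E ((↑q⁻¹ : Matrix ι ι Ω) i j) := by
  let J : Matrix ι ι (separableClosure E Ω) →+* Matrix ι ι Ω := (algebraMap (separableClosure E Ω) Ω).mapMatrix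
  let Q : Matrix ι ι (separableClosure E Ω) := Matrix.of fun i j => ⟨_, mem_separableClosure_iff.mpr (hq i j)⟩
  have hJ : J Q = q := rfl
  have hu : IsUnit Q := by
    rw [Matrix.isUnit_iff_isUnit_det, isUnit_iff_ne_zero]
    intro h0
    have h1 : (q : Matrix ι ι Ω).det = 0 := by
      rw [← hJ, ← RingHom.map_det, h0, map_zero]
    have h2 := (Matrix.isUnit_iff_isUnit_det _).mp q.isUnit
    rw [h1] at h2
    exact not_isUnit_zero h2
  obtain ⟨u, hu⟩ := hu
  have h3 : (↑q⁻¹ : Matrix ι ι Ω) = J (↑u⁻¹) := by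
    apply Units.inv_eq_of_mul_eq_one_right
    rw [← hJ, ← hu, ← map_mul, Units.mul_inv, map_one]
  intro i j
  rw [h3]
  exact mem_separableClosure_iff.mp ((↑u⁻¹ : Matrix ι ι (separableClosure E Ω)) i j).2

lemma det_sep {E : Type} [Field E] [Algebra E Ω] (q : Matrix ι ι Ω) (hq : ∀ i j, IsSeparable E (q i j)) :
    IsSeparable E q.det := by
  let J : Matrix ι ι (separableClosure E Ω) →+* Matrix ι ι Ω := (algebraMap (separableClosure E Ω) Ω).mapMatrix
  let Q : Matrix ι ι (separableClosure E Ω) := Matrix.of fun i j => ⟨_, mem_separableClosure_iff.mpr (hq i j)⟩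
  have hJ : J Q = q := rfl
  rw [← hJ, ← RingHom.map_det]
  exact mem_separableClosure_iff.mp Q.det.2

lemma mul_sep {E : Type} [Field E] [Algebra E Ω] {X Y : Matrix ι ι Ω} (hX : ∀ i j, IsSeparable E (X i j))
    (hY : ∀ i j, IsSeparable E (Y i j)) (i j : ι) : IsSeparable E ((X * Y) i j) := by
  rw [← mem_separableClosure_iff, Matrix.mul_apply]
  exact sum_mem fun x _ => mul_mem (mem_separableClosure_iff.mpr (hX _ _)) (mem_separableClosure_iff.mpr (hY _ _))

theorem desc (p : ℕ) [Fact p.Prime] {E : Type} [Field E] [CharP E p] [Algebra F E] [Algebra E Ω] [IsScalarTower F E Ω]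
    [IsAlgClosure E Ω] [FiniteDimensional F A] {ρ : A →ₐ[F] Matrix ι ι Ω} (h : Rep ρ)
    {V : (Ω ≃ₐ[E] Ω) → Matrix ι ι Ω} (hs : Smooth V) (hu : ∀ σ, IsUnit (V σ)) (hsep : ∀ σ i j, IsSeparable E (V σ i j))
    (hc : ∀ σ τ, V (σ * τ) = V σ * (V τ).map σ) (hinteg : ∀ σ a, ρ a * V σ = V σ * (ρ a).map σ) :
    Nonempty (E ⊗[F] A ≃ₐ[E] Matrix ι ι E) := by
  obtain ⟨Q, hQu, hQs, hQ⟩ := gl_h90 p hs hu hsep hc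
  obtain ⟨q, rfl⟩ := hQu
  have hE : ∀ a i j, ∃ e : E, algebraMap E Ω e = conjRep ρ q a i j := by
    intro a i j
    apply mem_base_of_fixed
    · rw [conjRep_apply]
      exact mul_sep (mul_sep (inv_sep q hQs) (fun i j => (h.sep a i j).tower_top E)) hQs i j
    · intro σ
      set Y := conjRep ρ q a with hYd
      have hY : (q : Matrix ι ι Ω) * Y = ρ a * q := by
        rw [hYd, conjRep_apply, ← mul_assoc, Units.mul_inv_cancel_left]
      have h1 : (q : Matrix ι ι Ω).map σ * Y.map σ = (ρ a).map σ * (q : Matrix ι ι Ω).map σ := by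
        rw [← map_mulM, hY, map_mulM]
      have h2 : (q : Matrix ι ι Ω) * Y.map σ = q * Y := by
        rw [hY]
        calc (q : Matrix ι ι Ω) * Y.map σ = V σ * (q : Matrix ι ι Ω).map σ * Y.map σ := by rw [hQ]
          _ = V σ * (ρ a).map σ * (q : Matrix ι ι Ω).map σ := by rw [mul_assoc, h1, mul_assoc]
          _ = ρ a * q := by rw [← hinteg, mul_assoc, hQ]
      have h3 : Y.map σ = Y := q.isUnit.mul_left_cancel h2
      exact congrFun (congrFun h3 i) j
  obtain ⟨f, _, hf⟩ := descend (K := E) (conjRep ρ q) hE (conjRep_full h.full q) h.card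
  obtain ⟨e, -⟩ := bc_equiv f hf h.card
  exact ⟨e⟩

end Desc

section Split
variable {F Ω A ι : Type} [Field F] [Field Ω] [Algebra F Ω] [IsAlgClosure F Ω] [Ring A] [Algebra F A] [FiniteDimensional F A]
  [Fintype ι] [DecidableEq ι]

theorem split_deg (p : ℕ) [hp : Fact p.Prime] [CharP F p] [Nonempty ι] {ρ : A →ₐ[F] Matrix ι ι Ω} (h : Rep ρ) :
    IsSplit F (⨂[F] _ : Fin (Fintype.card ι), A) := by
  obtain ⟨U, u⟩ := h.exists_U
  have hdet : ∀ σ, (U σ).det ≠ 0 := fun σ => ((Matrix.isUnit_iff_isUnit_det _).mp (u.unit σ)).ne_zero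
  obtain ⟨e⟩ := desc (E := F) p (h.tpow (Fintype.card ι)) (V := fun σ => (U σ).det⁻¹ • kp (Fintype.card ι) (U σ))
    (u.sm.comp fun X => X.det⁻¹ • kp (Fintype.card ι) X)
    (fun σ => by
      have := (kp_unit (N := Fintype.card ι) (u.unit σ)).smul (Units.mk0 _ (inv_ne_zero (hdet σ)))
      exact this)
    (fun σ x y => by
      rw [← mem_separableClosure_iff, Matrix.smul_apply, smul_eq_mul, kp, krM_apply]
      exact mul_mem (inv_mem (mem_separableClosure_iff.mpr (det_sep _ (u.sep σ))))
        (prod_mem fun i _ => mem_separableClosure_iff.mpr (u.sep _ _ _)))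
    (fun σ τ => by
      obtain ⟨c, hc, -, he⟩ := u.coc h σ τ
      have h1 : (U σ).det * σ (U τ).det = c ^ Fintype.card ι * (U (σ * τ)).det := by
        rw [← Matrix.det_smul, ← he, Matrix.det_mul]
        congr 1
        exact AlgEquiv.map_det σ (U τ)
      have h2 : kp (Fintype.card ι) (U σ) * (kp (Fintype.card ι) (U τ)).map σ = c ^ Fintype.card ι • kp (Fintype.card ι) (U (σ * τ)) := by
        rw [kp_map, ← kp_mul, he, kp_smul]
      have h3 : ((U τ).det⁻¹ • kp (Fintype.card ι) (U τ)).map σ = (σ (U τ).det)⁻¹ • (kp (Fintype.card ι) (U τ)).map σ := by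
        ext i j; simp
      rw [h3, smul_mul_smul_comm, h2, smul_smul, ← mul_inv, h1, mul_inv, mul_comm (_)⁻¹, mul_assoc, inv_mul_cancel₀ (pow_ne_zero _ hc), mul_one])
    (fun σ a => by
      rw [mul_smul_comm, smul_mul_assoc, tpow_int (u.int σ)])
  refine ⟨Fintype.card (Fin (Fintype.card ι) → ι), Fintype.card_pos, ⟨?_⟩⟩
  exact ((Algebra.TensorProduct.lid F _).symm.trans e).trans (Matrix.reindexAlgEquiv F F (Fintype.equivFin _))

theorem exists_beta (p : ℕ) [hp : Fact p.Prime] [CharP F p] [Nonempty ι] {ρ : A →ₐ[F] Matrix ι ι Ω} (h : Rep ρ) {U : (Ω ≃ₐ[F] Ω) → Matrix ι ι Ω} (u : UData ρ U)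
    {n : ℕ} (hs : IsSplit F (⨂[F] _ : Fin (p ^ n), A)) :
    ∃ β : (Ω ≃ₐ[F] Ω) → Ω, Smooth β ∧ (∀ σ, β σ ≠ 0) ∧ (∀ σ, IsSeparable F (β σ ^ p ^ n)) ∧
      ∀ σ τ, U σ * (U τ).map σ = (β σ * σ (β τ) / β (σ * τ)) • U (σ * τ) := by
  obtain ⟨m, hm, ⟨θ⟩⟩ := hs
  haveI := isAlgClosedE F Ω
  haveI : CharP Ω p := charP_of_injective_algebraMap (algebraMap F Ω).injective p
  set N := p ^ n with hN
  let T := ⨂[F] _ : Fin N, A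
  have hT := h.tpow N
  have hcard : m = Fintype.card (Fin N → ι) := by
    have h1 : Module.finrank F T = m ^ 2 := by
      rw [θ.toLinearEquiv.finrank_eq, Module.finrank_matrix, Module.finrank_self, Fintype.card_fin, sq, mul_one]
    rw [hT.card] at h1
    exact (Nat.pow_left_injective (n := 2) (by norm_num) h1).symm
  let ε : Fin m ≃ (Fin N → ι) := (finCongr hcard).trans (Fintype.equivFin _).symm
  let θ1 : T ≃ₐ[F] Matrix (Fin N → ι) (Fin N → ι) F := θ.trans (Matrix.reindexAlgEquiv F F ε)
  let θ2 : T →ₐ[F] Matrix (Fin N → ι) (Fin N → ι) Ω := (Algebra.ofId F Ω).mapMatrix.comp θ1.toAlgHom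
  have hθ : ∀ a x y, θ2 a x y = algebraMap F Ω (θ1 a x y) := fun a x y => rfl
  have hR : Rep θ2 := by
    refine ⟨fun a x y => ?_, ?_, hT.card⟩
    · rw [hθ]; exact isSeparable_algebraMap _
    · rw [eq_top_iff]
      rintro X -
      rw [Matrix.matrix_eq_sum_single X]
      refine Submodule.sum_mem _ fun x _ => Submodule.sum_mem _ fun y _ => ?_
      have : Matrix.single x y (X x y) = X x y • θ2 (θ1.symm (Matrix.single x y 1)) := by
        ext a b
        rw [Matrix.smul_apply, hθ, AlgEquiv.apply_symm_apply]
        by_cases hab : x = a ∧ y = b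
        · obtain ⟨rfl, rfl⟩ := hab
          simp
        · rw [Matrix.single_apply_of_ne _ _ _ _ _ hab, Matrix.single_apply_of_ne _ _ _ _ _ hab, map_zero, smul_zero]
      rw [this]
      exact Submodule.smul_mem _ _ (Submodule.subset_span ⟨_, rfl⟩)
  obtain ⟨P, hPu, hPs, hP⟩ := hT.skolem hR
  have hθσ : ∀ a (σ : Ω ≃ₐ[F] Ω), (θ2 a).map σ = θ2 a := by
    intro a σ; ext x y; rw [Matrix.map_apply, hθ, σ.commutes]
  have hb : ∀ σ, ∃ b : Ω, b ≠ 0 ∧ kp N (U σ) * P.map σ = b • P := by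
    intro σ
    refine cent_unit (ρ' := fun a => θ2 a) hT.full ((kp_unit (u.unit σ)).mul (map_unitM hPu σ)) hPu ?_ hP
    intro a
    rw [← mul_assoc, tpow_int (u.int σ), mul_assoc, ← map_mulM, hP, map_mulM, hθσ, mul_assoc]
  obtain ⟨x0, y0, hxy⟩ := unit_ne_zero hPu
  let b : (Ω ≃ₐ[F] Ω) → Ω := fun σ => (kp N (U σ) * P.map σ) x0 y0 / P x0 y0
  have hb0 : ∀ σ, b σ ≠ 0 ∧ kp N (U σ) * P.map σ = b σ • P := by
    intro σ
    obtain ⟨b', h0, h1⟩ := hb σ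
    have : b σ = b' := by
      simp only [b]
      rw [h1, Matrix.smul_apply, smul_eq_mul, mul_div_cancel_right₀ _ hxy]
    rw [this]; exact ⟨h0, h1⟩
  have hbs : ∀ σ, IsSeparable F (b σ) := by
    intro σ
    rw [← mem_separableClosure_iff]
    refine div_mem ?_ (mem_separableClosure_iff.mpr (hPs _ _))
    rw [mem_separableClosure_iff]
    apply mul_sep
    · intro i j
      rw [← mem_separableClosure_iff, kp, krM_apply]
      exact prod_mem fun i _ => mem_separableClosure_iff.mpr (u.sep _ _ _)
    · intro i j
      have h2 := hPs i j
      rw [IsSeparable] at h2 ⊢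
      rwa [Matrix.map_apply, minpoly.algEquiv_eq σ]
  have hPsm : Smooth (E := F) (fun σ : Ω ≃ₐ[F] Ω => P.map σ) := by
    refine ⟨Set.range (fun z : (Fin N → ι) × (Fin N → ι) => P z.1 z.2), Set.finite_range _, fun σ τ hst => ?_⟩
    ext i j
    exact hst _ ⟨(i, j), rfl⟩
  have hbsm : Smooth b := u.sm.comp₂ hPsm (fun X Y => (kp N X * Y) x0 y0 / P x0 y0)
  have hN0 : 0 < N := pow_pos hp.out.pos n
  have hroot : ∀ x : Ω, ∃ y, y ^ N = x := fun x => IsAlgClosed.exists_pow_nat_eq x hN0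
  choose rt hrt using hroot
  have hne : ∀ σ, rt (b σ) ≠ 0 := by
    intro σ h0
    have := hrt (b σ)
    rw [h0, zero_pow hN0.ne'] at this
    exact (hb0 σ).1 this.symm
  have hinj : ∀ x y : Ω, x ^ N = y ^ N → x = y := by
    intro x y hxy
    exact (iterateFrobenius_inj Ω p n) (by simpa [iterateFrobenius_def] using hxy)
  refine ⟨fun σ => rt (b σ), hbsm.comp rt, hne, fun σ => by rw [hrt]; exact hbs σ, fun σ τ => ?_⟩
  obtain ⟨c, hc, -, he⟩ := u.coc h σ τ
  rw [he]
  congr 1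
  apply hinj
  rw [div_pow, mul_pow, ← map_pow, hrt, hrt, hrt, eq_div_iff (hb0 _).1]
  have h1 : kp N (U σ) * (kp N (U τ)).map σ = c ^ N • kp N (U (σ * τ)) := by
    rw [kp_map, ← kp_mul, he, kp_smul]
  have h2 : (kp N (U σ) * (kp N (U τ)).map σ) * P.map (σ * τ : Ω ≃ₐ[F] Ω) = (b σ * σ (b τ)) • P := by
    have e1 : P.map (σ * τ : Ω ≃ₐ[F] Ω) = (P.map τ).map σ := by rw [Matrix.map_map]; rfl
    have e2 : (b τ • P).map σ = σ (b τ) • P.map σ := by ext i j; simp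
    rw [e1, mul_assoc, ← map_mulM, (hb0 τ).2, e2, mul_smul_comm, (hb0 σ).2, smul_smul, mul_comm]
  rw [h1, smul_mul_assoc, (hb0 (σ * τ)).2, smul_smul] at h2
  have h3 := congrFun (congrFun h2 x0) y0
  rw [Matrix.smul_apply, Matrix.smul_apply, smul_eq_mul, smul_eq_mul] at h3
  exact mul_right_cancel₀ hxy h3

theorem split_over (p : ℕ) [hp : Fact p.Prime] [CharP F p] [Nonempty ι] {ρ : A →ₐ[F] Matrix ι ι Ω} (h : Rep ρ) {U : (Ω ≃ₐ[F] Ω) → Matrix ι ι Ω} (u : UData ρ U)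
    {β : (Ω ≃ₐ[F] Ω) → Ω} (hβ : ∀ σ τ, U σ * (U τ).map σ = (β σ * σ (β τ) / β (σ * τ)) • U (σ * τ))
    (E : IntermediateField F Ω) {m : Ω} (hm : m ≠ 0) (C : Cond p E (fun σ => β σ * (m / σ m)) 0) :
    Nonempty (E ⊗[F] A ≃ₐ[E] Matrix ι ι E) := by
  haveI := algClosure_inter E
  haveI : CharP E p := charP_of_injective_algebraMap (algebraMap F E).injective p
  let r : (Ω ≃ₐ[E] Ω) → (Ω ≃ₐ[F] Ω) := fun σ => σ.restrictScalars F
  have hr : ∀ σ, ∀ x ∈ E, r σ x = x := fun σ x hx => σ.commutes ⟨x, hx⟩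
  have hrm : ∀ σ τ, r (σ * τ) = r σ * r τ := fun σ τ => rfl
  have hrc : ∀ σ, (r σ : Ω → Ω) = σ := fun σ => rfl
  set γ : (Ω ≃ₐ[F] Ω) → Ω := fun σ => β σ * (m / σ m) with hγ
  have hsr : ∀ {X : Type} {f : (Ω ≃ₐ[F] Ω) → X}, Smooth f → Smooth (fun σ : Ω ≃ₐ[E] Ω => f (r σ)) := by
    rintro X f ⟨S, hS, hf⟩
    exact ⟨S, hS, fun σ τ hst => hf _ _ hst⟩
  refine desc p h (V := fun σ => (γ (r σ))⁻¹ • U (r σ)) ((hsr C.sm).comp₂ (hsr u.sm) (fun x X => x⁻¹ • X)) ?_ ?_ ?_ ?_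
  · intro σ
    exact (u.unit (r σ)).smul (Units.mk0 _ (inv_ne_zero (C.ne (r σ))))
  · intro σ i j
    rw [← mem_separableClosure_iff, Matrix.smul_apply, smul_eq_mul]
    refine mul_mem (inv_mem ?_) ?_
    · have := C.pow (r σ) (hr σ)
      rw [pow_zero, pow_one] at this
      exact mem_separableClosure_iff.mpr this
    · exact mem_separableClosure_iff.mpr ((u.sep _ _ _).tower_top E)
  · intro σ τ
    have h1 := hβ (r σ) (r τ)
    have h3 : ((γ (r τ))⁻¹ • U (r τ)).map σ = (r σ (γ (r τ)))⁻¹ • (U (r τ)).map (r σ) := by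
      ext i j; simp [hrc]
    rw [h3, smul_mul_smul_comm, h1, smul_smul, hrm]
    congr 1
    have n1 : β (r σ) ≠ 0 := fun h0 => C.ne (r σ) (by simp only [hγ, h0, zero_mul])
    have n2 : β (r τ) ≠ 0 := fun h0 => C.ne (r τ) (by simp only [hγ, h0, zero_mul])
    have n3 : β (r σ * r τ) ≠ 0 := fun h0 => C.ne (r σ * r τ) (by simp only [hγ, h0, zero_mul])
    have n4 : r σ (β (r τ)) ≠ 0 := by simpa using n2
    have n5 : r σ m ≠ 0 := by simpa using hm
    have n6 : r σ (r τ m) ≠ 0 := by simpa using hm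
    simp only [hγ, map_mul, map_div₀, AlgEquiv.mul_apply]
    field_simp
  · intro σ a
    rw [mul_smul_comm, smul_mul_assoc, u.int]
    rfl

end Split
end Tower

namespace Tower

section H5
variable {F D : Type} [Field F] [DivisionRing D] [Algebra F D]

lemma deg_dvd {E : Type} [Field E] [Algebra F E] {d : ℕ} (hd : 0 < d)
    (hD : Module.finrank F D = d ^ 2) (f : D →ₐ[F] Matrix (Fin d) (Fin d) E) : d ∣ Module.finrank F E := by
  by_cases hfd : Module.Finite F E
  swap
  · rw [Module.finrank_of_not_finite hfd]; exact dvd_zero _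
  let V := Fin d → E
  let g : D →+* Module.End E V := ((Matrix.toLinAlgEquiv' : Matrix (Fin d) (Fin d) E ≃ₐ[E] _) : _ →+* _).comp f.toRingHom
  letI : Module D V := Module.compHom V g
  have hsm : ∀ (a : D) (v : V), a • v = (f a).mulVec v := fun a v => rfl
  haveI : IsScalarTower F D V := ⟨fun a x v => by
    rw [hsm, hsm, map_smul, Matrix.smul_mulVec]⟩
  have h1 := Module.finrank_mul_finrank F D V
  have h2 : Module.finrank F V = d * Module.finrank F E := by
    rw [Module.finrank_pi_fintype]; simp
  rw [h2, hD] at h1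
  refine ⟨Module.finrank D V, ?_⟩
  have : d * Module.finrank F E = d * (d * Module.finrank D V) := by rw [← h1]; ring
  exact Nat.eq_of_mul_eq_mul_left hd this

theorem exists_rep {Ω : Type} [Field Ω] [Algebra F Ω] [IsAlgClosure F Ω] [FiniteDimensional F D]
    (hc : Subalgebra.center F D = ⊥) :
    ∃ d : ℕ, 0 < d ∧ Module.finrank F D = d ^ 2 ∧ ∃ ρ : D →ₐ[F] Matrix (Fin d) (Fin d) Ω, Rep ρ := by
  haveI := isAlgClosedE F Ω
  let K := separableClosure F Ω
  haveI : IsSepClosed K := (separableClosure.isSepClosure (F := F) (E := Ω)).sep_closed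
  obtain ⟨d, hd, ⟨e⟩⟩ := split_sepclosed (K := K) hc
  have hcard : Module.finrank F D = d ^ 2 := by
    have h1 : Module.finrank K (K ⊗[F] D) = Module.finrank F D := Module.finrank_baseChange
    rw [e.toLinearEquiv.finrank_eq] at h1
    rw [← h1, Module.finrank_matrix, Module.finrank_self]; simp [sq]
  let f : D →ₐ[F] Matrix (Fin d) (Fin d) K := (e.toAlgHom.restrictScalars F).comp Algebra.TensorProduct.includeRight
  let J : Matrix (Fin d) (Fin d) K →ₐ[F] Matrix (Fin d) (Fin d) Ω := K.val.mapMatrix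
  have hJ : ∀ X i j, J X i j = (X i j : Ω) := fun X i j => rfl
  have key : ∀ x : K ⊗[F] D, J (e x) ∈ Submodule.span Ω (Set.range (J.comp f)) := by
    intro x
    induction x using TensorProduct.induction_on with
    | zero => rw [map_zero, map_zero]; exact zero_mem _
    | add x y hx hy => rw [map_add, map_add]; exact add_mem hx hy
    | tmul a b =>
      have h1 : (a ⊗ₜ[F] b : K ⊗[F] D) = a • ((1 : K) ⊗ₜ[F] b) := by rw [TensorProduct.smul_tmul', smul_eq_mul, mul_one]
      rw [h1, map_smul]
      have h2 : J (a • e ((1 : K) ⊗ₜ[F] b)) = (a : Ω) • J (f b) := by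
        ext i j; rfl
      rw [h2]
      exact Submodule.smul_mem _ _ (Submodule.subset_span ⟨b, rfl⟩)
  refine ⟨d, hd, hcard, J.comp f, ?_, ?_, ?_⟩
  · intro a i j
    exact mem_separableClosure_iff.mp (f a i j).2
  · rw [eq_top_iff]
    rintro X -
    have hX : X = ∑ i, ∑ j, X i j • J (Matrix.single i j (1 : K)) := by
      conv_lhs => rw [Matrix.matrix_eq_sum_single X]
      refine Finset.sum_congr rfl fun i _ => Finset.sum_congr rfl fun j _ => ?_
      ext a b
      rw [Matrix.smul_apply, hJ, Matrix.single_apply, Matrix.single_apply]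
      split_ifs <;> simp
    rw [hX]
    refine Submodule.sum_mem _ fun i _ => Submodule.sum_mem _ fun j _ => Submodule.smul_mem _ _ ?_
    have := key (e.symm (Matrix.single i j (1 : K)))
    rwa [AlgEquiv.apply_symm_apply] at this
  · rw [hcard]; simp

theorem H_main (p : ℕ) [hp : Fact p.Prime] [CharP F p] (Ω : Type) [Field Ω] [Algebra F Ω] [IsAlgClosure F Ω]
    [FiniteDimensional F D] (hc : Subalgebra.center F D = ⊥) {n : ℕ} (hper : period F D = p ^ n) :
    ∃ d : ℕ, 0 < d ∧ Module.finrank F D = d ^ 2 ∧ p ^ n ≤ d ∧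
      ∃ β, Cond p (⊥ : IntermediateField F Ω) β n ∧
      ∀ (E : IntermediateField F Ω) (m : Ω), m ≠ 0 → Cond p E (fun σ => β σ * (m / σ m)) 0 →
        Nonempty (E ⊗[F] D ≃ₐ[E] Matrix (Fin d) (Fin d) E) ∧ d ∣ Module.finrank F E := by
  obtain ⟨d, hd, hcard, ρ, h⟩ := exists_rep (Ω := Ω) hc
  haveI : Nonempty (Fin d) := ⟨⟨0, hd⟩⟩
  obtain ⟨U, u⟩ := h.exists_U
  have hne : (sInf {n : ℕ | 0 < n ∧ IsSplit F (⨂[F] _ : Fin n, D)}) ≠ 0 := by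
    have : sInf {n : ℕ | 0 < n ∧ IsSplit F (⨂[F] _ : Fin n, D)} = p ^ n := hper
    rw [this]; exact pow_ne_zero _ hp.out.ne_zero
  have hmem := Nat.sInf_mem (Nat.nonempty_of_sInf_eq_succ (Nat.succ_pred_eq_of_ne_zero hne).symm)
  have hp1 : sInf {n : ℕ | 0 < n ∧ IsSplit F (⨂[F] _ : Fin n, D)} = p ^ n := hper
  rw [hp1] at hmem
  have hle : p ^ n ≤ d := by
    rw [← hp1]
    refine Nat.sInf_le ⟨hd, ?_⟩
    have := split_deg p h
    rwa [Fintype.card_fin] at this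
  obtain ⟨β, h1, h2, h3, h4⟩ := exists_beta p h u hmem.2
  refine ⟨d, hd, hcard, hle, β, ⟨h1, h2, ?_, ?_⟩, ?_⟩
  · intro σ τ _ _
    obtain ⟨c, hc0, hcs, hce⟩ := u.coc h σ τ
    rw [h4] at hce
    obtain ⟨i, j, hij⟩ := unit_ne_zero (u.unit (σ * τ))
    have h5 := congrFun (congrFun hce i) j
    rw [Matrix.smul_apply, Matrix.smul_apply, smul_eq_mul, smul_eq_mul] at h5
    rw [mul_right_cancel₀ hij h5]
    exact hcs.tower_top _
  · intro σ _
    exact (h3 σ).tower_top _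
  · intro E m hm C
    obtain ⟨e⟩ := split_over p h u h4 E hm C
    exact ⟨⟨e⟩, deg_dvd hd hcard ((e.toAlgHom.restrictScalars F).comp Algebra.TensorProduct.includeRight)⟩

end H5
end Tower

namespace Tower

section I1
variable {κ : Type} [Field κ] (p : ℕ) [hp : Fact p.Prime] [CharP κ p]

lemma coeff_pow_p (f : PowerSeries κ) (n : ℕ) :
    PowerSeries.coeff n (f ^ p) = if p ∣ n then (PowerSeries.coeff (n / p) f) ^ p else 0 := by
  haveI : CharP (PowerSeries κ) p := charP_of_injective_ringHom (f := PowerSeries.C (R := κ)) PowerSeries.C_injective p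
  have h0 := PowerSeries.eq_X_pow_mul_shift_add_trunc (n + 1) f
  set g : PowerSeries κ := PowerSeries.mk fun i => PowerSeries.coeff (i + (n + 1)) f with hg
  set t := PowerSeries.trunc (n + 1) f with ht
  have h1 : f ^ p = PowerSeries.X ^ ((n + 1) * p) * g ^ p + ((t ^ p : Polynomial κ) : PowerSeries κ) := by
    conv_lhs => rw [h0]
    rw [add_pow_char, mul_pow, ← pow_mul, Polynomial.coe_pow]
  have h2 : t ^ p = Polynomial.expand κ p (t.map (frobenius κ p)) := by
    rw [← Polynomial.map_expand, Polynomial.map_frobenius_expand]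
  rw [h1, map_add, PowerSeries.coeff_X_pow_mul', if_neg, zero_add, Polynomial.coeff_coe, h2, Polynomial.coeff_expand hp.out.pos]
  · split_ifs with h
    · rw [Polynomial.coeff_map, ht, PowerSeries.coeff_trunc, if_pos, frobenius_def]
      have := Nat.div_le_self n p
      omega
    · rfl
  · have := hp.out.two_le
    nlinarith

/-- recursive solution of `y ^ p - y = x` -/
def asol {p : ℕ} (hp : p.Prime) (x : ℕ → κ) (n : ℕ) : κ :=
  if h : 0 < n ∧ p ∣ n then (asol hp x (n / p)) ^ p - x n else - x n
termination_by n
decreasing_by exact Nat.div_lt_self h.1 hp.one_lt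

lemma as_ps (x : PowerSeries κ) (hx : PowerSeries.constantCoeff x = 0) :
    ∃ y : PowerSeries κ, y ^ p - y = x := by
  refine ⟨PowerSeries.mk (asol hp.out fun n => PowerSeries.coeff n x), ?_⟩
  ext n
  have hr := fun m => asol.eq_1 hp.out (fun n => PowerSeries.coeff n x) m
  rw [map_sub, coeff_pow_p, PowerSeries.coeff_mk, PowerSeries.coeff_mk, hr n]
  by_cases hn : 0 < n
  · by_cases h : p ∣ n
    · rw [if_pos h, dif_pos ⟨hn, h⟩]; ring
    · rw [if_neg h, dif_neg (fun h' => h h'.2)]; ring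
  · obtain rfl : n = 0 := by omega
    have hx' : PowerSeries.coeff 0 x = 0 := by rw [PowerSeries.coeff_zero_eq_constantCoeff_apply, hx]
    rw [if_pos (dvd_zero _), dif_neg (by simp), Nat.zero_div, hr 0, dif_neg (by simp), hx']
    simp [hp.out.ne_zero]

lemma span_ps {ι : Type} [Fintype ι] (g : ι → κ) (hg : ∀ x : κ, ∃ f : ι → κ, x = ∑ j, f j ^ p * g j)
    (x : PowerSeries κ) : ∃ f : Fin p × ι → PowerSeries κ,
      x = ∑ q, f q ^ p * (PowerSeries.X ^ (q.1 : ℕ) * PowerSeries.C (g q.2)) := by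
  choose f hf using fun n => hg (PowerSeries.coeff n x)
  refine ⟨fun q => PowerSeries.mk fun n => f (n * p + q.1) q.2, ?_⟩
  have hpp := hp.out.pos
  ext n
  rw [map_sum, hf n, Fintype.sum_prod_type, Finset.sum_eq_single (⟨n % p, Nat.mod_lt _ hpp⟩ : Fin p)]
  · refine Finset.sum_congr rfl fun j _ => ?_
    rw [← mul_assoc, PowerSeries.coeff_mul_C, PowerSeries.coeff_mul_X_pow', if_pos (Nat.mod_le _ _), coeff_pow_p, if_pos (Nat.dvd_sub_mod n), PowerSeries.coeff_mk]
    congr 4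
    have h1 : (n - n % p) / p * p = n - n % p := Nat.div_mul_cancel (Nat.dvd_sub_mod n)
    have := Nat.mod_le n p
    simp only
    omega
  · intro i _ hi
    refine Finset.sum_eq_zero fun j _ => ?_
    rw [← mul_assoc, PowerSeries.coeff_mul_C, PowerSeries.coeff_mul_X_pow', coeff_pow_p]
    split_ifs with h1 h2
    · exfalso
      apply hi
      ext
      simp only
      have h3 : n ≡ i [MOD p] := ((Nat.modEq_iff_dvd' h1).mpr h2).symm
      have h4 : n % p = i % p := h3
      rw [h4, Nat.mod_eq_of_lt i.2]
    · simp
    · simp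
  · simp

lemma span_laurent {ι : Type} [Fintype ι] (g : ι → κ) (hg : ∀ x : κ, ∃ f : ι → κ, x = ∑ j, f j ^ p * g j) :
    ∃ G : Fin p × ι → LaurentSeries κ, ∀ x : LaurentSeries κ, ∃ f : Fin p × ι → LaurentSeries κ, x = ∑ q, f q ^ p * G q := by
  refine ⟨fun q => ((PowerSeries.X ^ (q.1 : ℕ) * PowerSeries.C (g q.2) : PowerSeries κ) : LaurentSeries κ), fun x => ?_⟩
  have key : ∀ y : PowerSeries κ, ∃ f : Fin p × ι → LaurentSeries κ, (y : LaurentSeries κ) = ∑ q, f q ^ p * ((PowerSeries.X ^ (q.1 : ℕ) * PowerSeries.C (g q.2) : PowerSeries κ) : LaurentSeries κ) := by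
    intro y
    obtain ⟨f, hf⟩ := span_ps p g hg y
    refine ⟨fun q => (f q : LaurentSeries κ), ?_⟩
    have h1 := congrArg (HahnSeries.ofPowerSeries ℤ κ) hf
    rw [map_sum] at h1
    refine h1.trans (Finset.sum_congr rfl fun q _ => ?_)
    rw [map_mul, map_pow]
  have hx : ∃ (N : ℕ) (y : PowerSeries κ), x * (((PowerSeries.X : PowerSeries κ) : LaurentSeries κ) ^ N) ^ p = y := by
    have h0 := LaurentSeries.single_order_mul_powerSeriesPart x
    have hX0 : ((PowerSeries.X : PowerSeries κ) : LaurentSeries κ) ≠ 0 := by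
      rw [PowerSeries.coe_X]; simp
    have h2 : HahnSeries.single x.order (1 : κ) = ((PowerSeries.X : PowerSeries κ) : LaurentSeries κ) ^ x.order := by
      rw [PowerSeries.coe_X]; exact (RatFunc.single_zpow x.order)
    refine ⟨x.order.natAbs, PowerSeries.X ^ (x.order + x.order.natAbs * p).toNat * x.powerSeriesPart, ?_⟩
    rw [h2] at h0
    have h6 : ∀ M : LaurentSeries κ, x * M = (((PowerSeries.X : PowerSeries κ) : LaurentSeries κ) ^ x.order * (x.powerSeriesPart : LaurentSeries κ)) * M := fun M => by rw [h0]
    rw [h6, PowerSeries.coe_mul, PowerSeries.coe_pow, ← zpow_natCast _ (Int.toNat _), ← pow_mul, ← zpow_natCast _ (_ * p), mul_right_comm, ← zpow_add₀ hX0]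
    congr 2
    rw [Int.toNat_of_nonneg]
    · push_cast; rfl
    · have := hp.out.pos
      have h3 : (x.order.natAbs : ℤ) ≤ x.order.natAbs * p := by
        exact_mod_cast Nat.le_mul_of_pos_right _ this
      omega
  obtain ⟨N, y, hy⟩ := hx
  obtain ⟨f, hf⟩ := key y
  have hX0 : (((PowerSeries.X : PowerSeries κ) : LaurentSeries κ) ^ N) ≠ 0 := by
    apply pow_ne_zero
    rw [PowerSeries.coe_X]; simp
  refine ⟨fun q => f q * (((PowerSeries.X : PowerSeries κ) : LaurentSeries κ) ^ N)⁻¹, ?_⟩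
  have h5 : x = y * ((((PowerSeries.X : PowerSeries κ) : LaurentSeries κ) ^ N)⁻¹) ^ p := by
    rw [← hy, mul_assoc, ← mul_pow, mul_inv_cancel₀ hX0, one_pow, mul_one]
  rw [h5, hf, Finset.sum_mul]
  refine Finset.sum_congr rfl fun q _ => ?_
  rw [mul_pow]; ring

end I1
end Tower

namespace Tower

section I2
/-- decomposition of Laurent series -/
lemma laurent_dec {κ : Type} [Field κ] (x : LaurentSeries κ) (hx : x ≠ 0) :
    ∃ (n : ℤ) (f : PowerSeries κ), PowerSeries.constantCoeff f ≠ 0 ∧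
      x = (PowerSeries.X : PowerSeries κ) ^ n * (f : LaurentSeries κ) := by
  refine ⟨x.order, x.powerSeriesPart, ?_, ?_⟩
  · rw [← PowerSeries.coeff_zero_eq_constantCoeff_apply, LaurentSeries.powerSeriesPart_coeff]
    simpa using HahnSeries.coeff_order_eq_zero.not.mpr hx
  · have h0 := LaurentSeries.single_order_mul_powerSeriesPart x
    have h2 : HahnSeries.single x.order (1 : κ) = ((PowerSeries.X : PowerSeries κ) : LaurentSeries κ) ^ x.order := by
      rw [PowerSeries.coe_X]; exact (RatFunc.single_zpow x.order)
    rw [h2] at h0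
    exact h0.symm

lemma coe_inv_ps {κ : Type} [Field κ] (f : PowerSeries κ) (hf : PowerSeries.constantCoeff f ≠ 0) :
    ((f⁻¹ : PowerSeries κ) : LaurentSeries κ) = (f : LaurentSeries κ)⁻¹ := by
  apply eq_inv_of_mul_eq_one_left
  rw [← PowerSeries.coe_mul, PowerSeries.inv_mul_cancel f hf, PowerSeries.coe_one]

lemma coe_ps_inj {κ : Type} [Field κ] {f g : PowerSeries κ} (h : (f : LaurentSeries κ) = g) : f = g :=
  HahnSeries.ofPowerSeries_injective h

structure KData (p : ℕ) {k : Type} [Field k] (O : Subring k) (s : k) : Prop where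
  s0 : s ≠ 0
  sO : s ∈ O
  sinv : s⁻¹ ∉ O
  dec : ∀ c, c ≠ 0 → ∃ (m : ℤ) (v : k), v ≠ 0 ∧ v ∈ O ∧ v⁻¹ ∈ O ∧ c = s ^ m * v
  res : ∃ R : Finset k, ∀ x ∈ O, ∃ r ∈ R, ∃ y ∈ O, x - r = s * y
  as : ∀ x ∈ O, ∃ y, y ^ p - y = s * x
  span : ∃ g : Fin p → k, ∀ x : k, ∃ f : Fin p → k, x = ∑ j, f j ^ p * g j

lemma exists_kdata (p : ℕ) [hp : Fact p.Prime] {Fq k : Type} [Field Fq] [Fintype Fq] [CharP Fq p] [Field k]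
    (e : k ≃+* LaurentSeries Fq) : ∃ (O : Subring k) (s : k), KData p O s := by
  let R0 : Subring (LaurentSeries Fq) := (HahnSeries.ofPowerSeries ℤ Fq).range
  let X : LaurentSeries Fq := ((PowerSeries.X : PowerSeries Fq) : LaurentSeries Fq)
  have hX0 : X ≠ 0 := by
    show ((PowerSeries.X : PowerSeries Fq) : LaurentSeries Fq) ≠ 0
    rw [PowerSeries.coe_X]; simp
  have hmem : ∀ x : k, x ∈ R0.comap (e : k →+* LaurentSeries Fq) ↔ ∃ f : PowerSeries Fq, (f : LaurentSeries Fq) = e x := fun x => Iff.rfl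
  refine ⟨R0.comap (e : k →+* LaurentSeries Fq), e.symm X, ?_, ?_, ?_, ?_, ?_, ?_, ?_⟩
  · simpa using hX0
  · rw [hmem]; exact ⟨PowerSeries.X, by simp [X]⟩
  · rw [hmem]
    rintro ⟨f, hf⟩
    rw [map_inv₀, RingEquiv.apply_symm_apply] at hf
    have h1 : (f : LaurentSeries Fq) * X = 1 := by rw [hf, inv_mul_cancel₀ hX0]
    have h2 : f * PowerSeries.X = 1 := coe_ps_inj (by rw [PowerSeries.coe_mul, PowerSeries.coe_one]; exact h1)
    have h3 := congrArg PowerSeries.constantCoeff h2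
    simp at h3
  · intro c hc
    obtain ⟨m, f, hf, hm⟩ := laurent_dec (e c) (by simpa using hc)
    have hf0 : (f : LaurentSeries Fq) ≠ 0 := by
      intro h
      have : f = 0 := coe_ps_inj (by rw [h, PowerSeries.coe_zero])
      rw [this] at hf; simp at hf
    refine ⟨m, e.symm f, by simpa using hf0, ?_, ?_, ?_⟩
    · rw [hmem]; exact ⟨f, by simp⟩
    · rw [hmem]; exact ⟨f⁻¹, by rw [map_inv₀, RingEquiv.apply_symm_apply, coe_inv_ps f hf]⟩
    · apply e.injective
      rw [map_mul, map_zpow₀, RingEquiv.apply_symm_apply, RingEquiv.apply_symm_apply, hm]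
  · classical
    refine ⟨Finset.univ.image fun a : Fq => e.symm ((PowerSeries.C a : PowerSeries Fq) : LaurentSeries Fq), ?_⟩
    intro x hx
    rw [hmem] at hx
    obtain ⟨f, hf⟩ := hx
    refine ⟨_, Finset.mem_image_of_mem _ (Finset.mem_univ (PowerSeries.constantCoeff f)), ?_⟩
    have h1 : PowerSeries.X ∣ f - PowerSeries.C (PowerSeries.constantCoeff f) := by
      rw [PowerSeries.X_dvd_iff]; simp
    obtain ⟨g, hg⟩ := h1
    refine ⟨e.symm g, ?_, ?_⟩
    · rw [hmem]; exact ⟨g, by simp⟩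
    · apply e.injective
      rw [map_sub, map_mul, ← hf, RingEquiv.apply_symm_apply, RingEquiv.apply_symm_apply, RingEquiv.apply_symm_apply, ← PowerSeries.coe_sub, hg, PowerSeries.coe_mul]
  · intro x hx
    rw [hmem] at hx
    obtain ⟨f, hf⟩ := hx
    obtain ⟨y, hy⟩ := as_ps p (PowerSeries.X * f) (by simp)
    refine ⟨e.symm y, ?_⟩
    apply e.injective
    rw [map_sub, map_pow, map_mul, RingEquiv.apply_symm_apply, RingEquiv.apply_symm_apply, ← hf, ← PowerSeries.coe_pow, ← PowerSeries.coe_sub, hy, PowerSeries.coe_mul]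
  · haveI : PerfectRing Fq p := inferInstance
    obtain ⟨G, hG⟩ := span_laurent p (fun _ : Unit => (1 : Fq)) (fun x => by
      obtain ⟨y, hy⟩ := (bijective_frobenius Fq p).2 x
      exact ⟨fun _ => y, by simp [← hy, frobenius_def]⟩)
    refine ⟨fun i => e.symm (G (i, ())), fun x => ?_⟩
    obtain ⟨f, hf⟩ := hG (e x)
    refine ⟨fun i => e.symm (f (i, ())), ?_⟩
    apply e.injective
    rw [hf, map_sum, Fintype.sum_prod_type]
    refine Finset.sum_congr rfl fun i _ => ?_
    simp

end I2
end Tower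

namespace Tower

section I3
variable {A F : Type} [CommRing A] [Field F] [Algebra A F]

structure FData (p : ℕ) (A : Type) {F : Type} [CommRing A] [Field F] [Algebra A F] (O : Subring F) (t ϖ : F) : Prop where
  t0 : t ≠ 0
  ϖ0 : ϖ ≠ 0
  tO : t ∈ O
  tinv : t⁻¹ ∉ O
  piO : ∀ n : ℕ, ϖ * (t ^ n)⁻¹ ∈ O
  dec : ∀ x, x ≠ 0 → ∃ (n m : ℤ) (u : F), u ≠ 0 ∧ u ∈ O ∧ u⁻¹ ∈ O ∧ x = ϖ ^ n * t ^ m * u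
  res : ∃ R : Finset F, ∀ x ∈ O, ∃ r ∈ R, ∃ y ∈ O, x - r = t * y
  as : ∀ x ∈ O, ∃ y, y ^ p - y = t * x
  span : ∃ g : Fin p × Fin p → F, ∀ x : F, ∃ f : Fin p × Fin p → F, x = ∑ j, f j ^ p * g j
  ps1 : ∀ a : A, ∃ m : ℕ, t ^ m * algebraMap A F a ∈ O
  ps2 : ∀ x ∈ O, x ∈ (algebraMap A F).range
  ps3 : t⁻¹ ∈ (algebraMap A F).range

variable {p : ℕ} {O : Subring F} {t ϖ : F}

lemma FData.tpow (d : FData p A O t ϖ) (n : ℕ) : t ^ n ∈ O := pow_mem d.tO n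

lemma FData.mem_pos (d : FData p A O t ϖ) {n m : ℤ} (hn : 0 < n) : ϖ ^ n * t ^ m ∈ O := by
  obtain ⟨n, rfl⟩ := Int.eq_succ_of_zero_lt hn
  have h1 : ϖ ∈ O := by simpa using d.piO 0
  have h2 : ϖ * t ^ m ∈ O := by
    obtain ⟨a, rfl | rfl⟩ := m.eq_nat_or_neg
    · rw [zpow_natCast]; exact mul_mem h1 (d.tpow a)
    · rw [zpow_neg, zpow_natCast]; exact d.piO a
  have h3 : ϖ ^ ((n : ℤ) + 1) * t ^ m = ϖ ^ n * (ϖ * t ^ m) := by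
    rw [zpow_add_one₀ d.ϖ0, zpow_natCast, mul_assoc]
  rw [h3]
  exact mul_mem (pow_mem h1 n) h2

/-- cases -/
lemma FData.cases (d : FData p A O t ϖ) (x : F) (hx : x ≠ 0) :
    (∃ y ∈ O, x = t * y) ∨ (∃ y ∈ O, x⁻¹ = t * y) ∨ (x ∈ O ∧ x⁻¹ ∈ O) := by
  obtain ⟨n, m, u, hu0, hu, hu', rfl⟩ := d.dec x hx
  have key : ∀ (n m : ℤ) (u : F), u ∈ O → (0 < n ∨ n = 0 ∧ 0 < m) → ∃ y ∈ O, ϖ ^ n * t ^ m * u = t * y := by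
    intro n m u hu h
    refine ⟨ϖ ^ n * t ^ (m - 1) * u, ?_, ?_⟩
    · refine mul_mem ?_ hu
      rcases h with h | ⟨rfl, h⟩
      · exact d.mem_pos h
      · rw [zpow_zero, one_mul]
        obtain ⟨a, ha⟩ := Int.eq_ofNat_of_zero_le (show 0 ≤ m - 1 by omega)
        rw [ha, zpow_natCast]
        exact d.tpow a
    · rw [zpow_sub_one₀ d.t0]
      have := d.t0
      field_simp
  have hinv : (ϖ ^ n * t ^ m * u)⁻¹ = ϖ ^ (-n) * t ^ (-m) * u⁻¹ := by
    rw [mul_inv, mul_inv, zpow_neg, zpow_neg]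
  by_cases h1 : 0 < n ∨ n = 0 ∧ 0 < m
  · left; exact key n m u hu h1
  by_cases h2 : 0 < -n ∨ -n = 0 ∧ 0 < -m
  · right; left; rw [hinv]; exact key _ _ _ hu' h2
  · right; right
    obtain rfl : n = 0 := by omega
    obtain rfl : m = 0 := by omega
    simp [hu, hu']

def FData.A2 (d : FData p A O t ϖ) : ValuationSubring F :=
  { O with
    mem_or_inv_mem' := by
      intro x
      by_cases hx : x = 0
      · left; rw [hx]; exact O.zero_mem
      rcases d.cases x hx with ⟨y, hy, h⟩ | ⟨y, hy, h⟩ | h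
      · left; rw [h]; exact O.mul_mem d.tO hy
      · right; rw [h]; exact O.mul_mem d.tO hy
      · exact Or.inl h.1 }

lemma FData.exists_B (d : FData p A O t ϖ) (Ω : Type) [Field Ω] [Algebra F Ω] :
    ∃ B : ValuationSubring Ω, (∀ x ∈ O, algebraMap F Ω x ∈ B) ∧
      (∀ x ∈ O, x ≠ 0 → (algebraMap F Ω x)⁻¹ ∈ B → x⁻¹ ∈ O) := by
  obtain ⟨B, hB⟩ := (d.A2.toLocalSubring.map (algebraMap F Ω)).exists_le_valuationSubring
  rw [LocalSubring.le_def] at hB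
  obtain ⟨h, hl⟩ := hB
  refine ⟨B, fun x hx => h ⟨x, hx, rfl⟩, fun x hx hx0 hxi => ?_⟩
  have hx1 : algebraMap F Ω x ∈ (d.A2.toLocalSubring.map (algebraMap F Ω)).toSubring := ⟨x, hx, rfl⟩
  have hne : algebraMap F Ω x ≠ 0 := by simpa using hx0
  have hu : IsUnit (Subring.inclusion h ⟨_, hx1⟩) := by
    refine isUnit_iff_exists_inv.mpr ⟨⟨_, hxi⟩, Subtype.ext ?_⟩
    exact mul_inv_cancel₀ hne
  obtain ⟨⟨_, y, hy, rfl⟩, hy1⟩ := isUnit_iff_exists_inv.mp (hl.map_nonunit _ hu)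
  have h2 : algebraMap F Ω x * algebraMap F Ω y = 1 := congrArg Subtype.val hy1
  rw [← map_mul, ← map_one (algebraMap F Ω)] at h2
  have h3 := (algebraMap F Ω).injective h2
  rw [inv_eq_of_mul_eq_one_right h3]
  exact hy

end I3
end Tower

namespace Tower

section I4
variable {A F : Type} [CommRing A] [Field F] [Algebra A F] {p : ℕ} {O : Subring F} {t ϖ : F}

/-- the coarsening -/
def O1 {Ω : Type} [Field Ω] (B : ValuationSubring Ω) (τ : Ω) (hτ : τ ∈ B) : ValuationSubring Ω :=
  B.ofLE
    { carrier := {x | ∃ m : ℕ, τ ^ m * x ∈ B}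
      mul_mem' := by
        rintro a b ⟨m, hm⟩ ⟨n, hn⟩
        refine ⟨m + n, ?_⟩
        have : τ ^ (m + n) * (a * b) = (τ ^ m * a) * (τ ^ n * b) := by ring
        rw [this]; exact mul_mem hm hn
      one_mem' := ⟨0, by simpa using B.one_mem⟩
      add_mem' := by
        rintro a b ⟨m, hm⟩ ⟨n, hn⟩
        refine ⟨m + n, ?_⟩
        have : τ ^ (m + n) * (a + b) = τ ^ n * (τ ^ m * a) + τ ^ m * (τ ^ n * b) := by ring
        rw [this]; exact add_mem (mul_mem (pow_mem hτ _) hm) (mul_mem (pow_mem hτ _) hn)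
      zero_mem' := ⟨0, by simpa using B.zero_mem⟩
      neg_mem' := by
        rintro a ⟨m, hm⟩
        exact ⟨m, by rw [mul_neg]; exact neg_mem hm⟩ }
    (fun x hx => ⟨0, by simpa using hx⟩)

lemma mem_O1 {Ω : Type} [Field Ω] (B : ValuationSubring Ω) (τ : Ω) (hτ : τ ∈ B) (x : Ω) :
    x ∈ O1 B τ hτ ↔ ∃ m : ℕ, τ ^ m * x ∈ B := Iff.rfl

theorem FData.exists_val (d : FData p A O t ϖ) (Ω : Type) [Field Ω] [Algebra F Ω] [Algebra A Ω] [IsScalarTower A F Ω] :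
    ∃ B C : ValuationSubring Ω, B ≤ C ∧ C.valuation (algebraMap F Ω ϖ) < 1 ∧ C.valuation (algebraMap F Ω t) = 1 ∧
      Loc1 p (B.valuation.comap (algebraMap F Ω)) t ϖ ∧
      (∀ x : F, C.valuation (algebraMap F Ω x) ≤ 1 → ∃ a : A, algebraMap A F a = x) ∧ ∀ a : A, algebraMap A Ω a ∈ C := by
  obtain ⟨B, hB1, hB2⟩ := d.exists_B Ω
  set V := B.valuation.comap (algebraMap F Ω) with hV
  have hVB : ∀ x : F, V x ≤ 1 ↔ algebraMap F Ω x ∈ B := fun x => B.valuation_le_one_iff _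
  have hlt : ∀ x ∈ O, x ≠ 0 → x⁻¹ ∉ O → V x < 1 := by
    intro x hx hx0 hxi
    rw [lt_iff_not_ge]
    intro h
    apply hxi
    refine hB2 x hx hx0 ?_
    rw [← map_inv₀, ← hVB, map_inv₀]
    exact inv_le_one_of_one_le₀ h
  have hle : ∀ x ∈ O, V x ≤ 1 := fun x hx => (hVB x).mpr (hB1 x hx)
  have htlt : V t < 1 := hlt t d.tO d.t0 d.tinv
  have hϖlt : ∀ n : ℕ, V ϖ < V t ^ n := by
    intro n
    have h1 : V (ϖ * (t ^ n)⁻¹) < 1 := by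
      refine hlt _ (d.piO n) (mul_ne_zero d.ϖ0 (inv_ne_zero (pow_ne_zero _ d.t0))) ?_
      intro h
      apply d.tinv
      have h2 := mul_mem (d.piO (n + 1)) h
      convert h2 using 1
      have := d.t0
      have := d.ϖ0
      field_simp
      try ring
    rw [map_mul, map_inv₀, map_pow] at h1
    have h0 : 0 < V t ^ n := pow_pos (by rw [zero_lt_iff, Valuation.ne_zero_iff]; exact d.t0) n
    rwa [← div_eq_mul_inv, div_lt_one₀ h0] at h1
  have hmem : ∀ x, V x ≤ 1 → x ∈ O := by
    intro x hx
    by_cases hx0 : x = 0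
    · rw [hx0]; exact zero_mem _
    rcases d.cases x hx0 with ⟨y, hy, h⟩ | ⟨y, hy, h⟩ | h
    · rw [h]; exact mul_mem d.tO hy
    · exfalso
      have h1 : V x⁻¹ < 1 := by rw [h, map_mul]; exact mul_lt_one_of_lt_of_le htlt (hle y hy)
      have h2 : V x * V x⁻¹ = 1 := by rw [← map_mul, mul_inv_cancel₀ hx0, map_one]
      have h3 : V x * V x⁻¹ < 1 := by rw [mul_comm]; exact mul_lt_one_of_lt_of_le h1 hx
      exact h3.ne h2
    · exact h.1
  have hmem' : ∀ x, V x < 1 → ∃ y ∈ O, x = t * y := by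
    intro x hx
    by_cases hx0 : x = 0
    · exact ⟨0, zero_mem _, by rw [hx0, mul_zero]⟩
    have h2 : V x * V x⁻¹ = 1 := by rw [← map_mul, mul_inv_cancel₀ hx0, map_one]
    rcases d.cases x hx0 with h | ⟨y, hy, h⟩ | h
    · exact h
    · exfalso
      have h1 : V x⁻¹ ≤ 1 := hle _ (by rw [h]; exact mul_mem d.tO hy)
      exact (mul_lt_one_of_lt_of_le hx h1).ne h2
    · exact absurd h2 (mul_lt_one_of_lt_of_le hx (hle _ h.2)).ne
  have hL : Loc1 p V t ϖ := by
    refine ⟨d.t0, d.ϖ0, htlt, hϖlt, ?_, ?_, ?_⟩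
    · intro x hx
      obtain ⟨n, m, u, hu0, hu, hu', rfl⟩ := d.dec x hx
      refine ⟨n, m, ?_⟩
      have h1 : V u = 1 := by
        refine le_antisymm (hle u hu) ?_
        have h2 : V u * V u⁻¹ = 1 := by rw [← map_mul, mul_inv_cancel₀ hu0, map_one]
        rw [← h2]
        exact mul_le_of_le_one_right' (hle _ hu')
      rw [map_mul, map_mul, map_zpow₀, map_zpow₀, h1, mul_one]
    · intro x hx
      obtain ⟨y, hy, rfl⟩ := hmem' x hx
      exact d.as y hy
    · obtain ⟨R, hR⟩ := d.res
      refine ⟨R, fun x hx => ?_⟩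
      obtain ⟨r, hr, y, hy, h⟩ := hR x (hmem x hx)
      refine ⟨r, hr, ?_⟩
      rw [h, map_mul]
      exact mul_lt_one_of_lt_of_le htlt (hle y hy)
  have hτ := hB1 t d.tO
  have hτ0 : algebraMap F Ω t ≠ 0 := by simpa using d.t0
  refine ⟨B, O1 B _ hτ, fun x hx => ⟨0, by simpa using hx⟩, ?_, ?_, hL, ?_, ?_⟩
  · rw [lt_iff_not_ge]
    intro h
    have h1 : (algebraMap F Ω ϖ)⁻¹ ∈ O1 B _ hτ := by
      rw [← ValuationSubring.valuation_le_one_iff, map_inv₀]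
      exact inv_le_one_of_one_le₀ h
    obtain ⟨m, hm⟩ := (mem_O1 _ _ _ _).mp h1
    rw [← map_inv₀, ← map_pow, ← map_mul, ← hVB, map_mul, map_inv₀, map_pow] at hm
    have h0 : 0 < V ϖ := by rw [zero_lt_iff, Valuation.ne_zero_iff]; exact d.ϖ0
    rw [← div_eq_mul_inv, div_le_one₀ h0] at hm
    exact absurd (hϖlt m) (not_lt.mpr hm)
  · apply le_antisymm
    · rw [ValuationSubring.valuation_le_one_iff]
      exact ⟨0, by simpa using hτ⟩
    · have h1 : (O1 B _ hτ).valuation (algebraMap F Ω t)⁻¹ ≤ 1 := by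
        rw [ValuationSubring.valuation_le_one_iff, mem_O1]
        exact ⟨1, by rw [pow_one, mul_inv_cancel₀ hτ0]; exact B.one_mem⟩
      rw [map_inv₀] at h1
      have h0 : 0 < (O1 B _ hτ).valuation (algebraMap F Ω t) := by rw [zero_lt_iff, Valuation.ne_zero_iff]; exact hτ0
      exact (inv_le_one₀ h0).mp h1
  · intro x hx
    rw [ValuationSubring.valuation_le_one_iff, mem_O1] at hx
    obtain ⟨m, hm⟩ := hx
    rw [← map_pow, ← map_mul, ← hVB] at hm
    have h1 := mul_mem (pow_mem d.ps3 m) (d.ps2 _ (hmem _ hm))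
    rw [inv_pow, inv_mul_cancel_left₀ (pow_ne_zero _ d.t0)] at h1
    exact h1
  · intro a
    obtain ⟨m, hm⟩ := d.ps1 a
    rw [mem_O1]
    refine ⟨m, ?_⟩
    have := hB1 _ hm
    rwa [map_mul, map_pow, ← IsScalarTower.algebraMap_apply] at this

lemma loc1_bot {Ω Γ : Type} [Field Ω] [Algebra F Ω] [LinearOrderedCommGroupWithZero Γ] {W : Valuation Ω Γ}
    (L : Loc1 p (W.comap (algebraMap F Ω)) t ϖ) :
    Loc1 p (VE W (⊥ : IntermediateField F Ω)) (algebraMap F (⊥ : IntermediateField F Ω) t) (algebraMap F (⊥ : IntermediateField F Ω) ϖ) := by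
  classical
  have hs : ∀ x : (⊥ : IntermediateField F Ω), ∃ y, algebraMap F (⊥ : IntermediateField F Ω) y = x := by
    rintro ⟨x, hx⟩
    obtain ⟨y, rfl⟩ := IntermediateField.mem_bot.mp hx
    exact ⟨y, rfl⟩
  have hV : ∀ y, VE W (⊥ : IntermediateField F Ω) (algebraMap F _ y) = W.comap (algebraMap F Ω) y := fun y => rfl
  refine ⟨?_, ?_, L.tlt, L.ϖlt, ?_, ?_, ?_⟩
  · simpa using L.t0
  · simpa using L.ϖ0
  · intro x hx
    obtain ⟨y, rfl⟩ := hs x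
    exact L.val y (by rintro rfl; simp at hx)
  · intro x hx
    obtain ⟨y, rfl⟩ := hs x
    obtain ⟨z, hz⟩ := L.H2 y hx
    exact ⟨algebraMap F _ z, by rw [← map_pow, ← map_sub, hz]⟩
  · obtain ⟨R, hR⟩ := L.fin
    refine ⟨R.image (algebraMap F (⊥ : IntermediateField F Ω)), fun x hx => ?_⟩
    obtain ⟨y, rfl⟩ := hs x
    obtain ⟨r, hr, h⟩ := hR y hx
    exact ⟨_, Finset.mem_image_of_mem _ hr, by rw [← map_sub]; exact h⟩

end I4
end Tower

namespace Tower

section I5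
theorem exists_fdata (p : ℕ) [hp : Fact p.Prime] {k : Type} [Field k] [CharP k p] {O : Subring k} {s : k} (d : KData p O s) :
    ∃ (O2 : Subring (LaurentSeries k)) (t ϖ : LaurentSeries k), FData p (PowerSeries k) O2 t ϖ := by
  let j : PowerSeries k →+* LaurentSeries k := HahnSeries.ofPowerSeries ℤ k
  have hj : ∀ f, algebraMap (PowerSeries k) (LaurentSeries k) f = j f := fun f => rfl
  have hji : Function.Injective j := HahnSeries.ofPowerSeries_injective
  let O2 : Subring (LaurentSeries k) := (O.comap (PowerSeries.constantCoeff (R := k))).map j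
  have hmem : ∀ f : PowerSeries k, PowerSeries.constantCoeff f ∈ O → j f ∈ O2 := fun f hf => ⟨f, hf, rfl⟩
  have hmem' : ∀ x ∈ O2, ∃ f : PowerSeries k, PowerSeries.constantCoeff f ∈ O ∧ j f = x := by
    rintro _ ⟨f, hf, rfl⟩
    exact ⟨f, hf, rfl⟩
  let t : LaurentSeries k := j (PowerSeries.C s)
  let ϖ : LaurentSeries k := j PowerSeries.X
  let C : k →+* LaurentSeries k := j.comp PowerSeries.C
  have hC : ∀ c, j (PowerSeries.C c) = C c := fun c => rfl
  have htC : t = C s := rfl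
  have hCi : Function.Injective C := C.injective
  haveI : CharP (LaurentSeries k) p := charP_of_injective_ringHom hCi p
  have ht0 : t ≠ 0 := by rw [htC]; simpa using d.s0
  have hϖ0 : ϖ ≠ 0 := by
    intro h
    have := hji (h.trans (map_zero j).symm)
    exact PowerSeries.X_ne_zero this
  refine ⟨O2, t, ϖ, ht0, hϖ0, ?_, ?_, ?_, ?_, ?_, ?_, ?_, ?_, ?_, ?_⟩
  · exact hmem _ (by simpa using d.sO)
  · intro h
    obtain ⟨f, hf, h⟩ := hmem' _ h
    have h1 : f = PowerSeries.C s⁻¹ := by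
      apply hji
      rw [h, hC, map_inv₀, htC]
    rw [h1] at hf
    exact d.sinv (by simpa using hf)
  · intro n
    have h1 : ϖ * (t ^ n)⁻¹ = j (PowerSeries.X * PowerSeries.C (s ^ n)⁻¹) := by
      rw [map_mul, hC, map_inv₀, map_pow, htC]
    rw [h1]
    exact hmem _ (by simpa using O.zero_mem)
  · intro x hx
    obtain ⟨n, f, hf, hn⟩ := laurent_dec x hx
    obtain ⟨m, v, hv0, hv, hv', hm⟩ := d.dec _ hf
    have hsm : s ^ m ≠ 0 := zpow_ne_zero _ d.s0
    have hsm' : s ^ (-m) ≠ 0 := zpow_ne_zero _ d.s0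
    have hg : PowerSeries.constantCoeff (f * PowerSeries.C (s ^ (-m))) = v := by
      rw [map_mul, hm, PowerSeries.constantCoeff_C, zpow_neg]
      field_simp
    have hg0 : PowerSeries.constantCoeff (f * PowerSeries.C (s ^ (-m))) ≠ 0 := by rw [hg]; exact hv0
    refine ⟨n, m, j (f * PowerSeries.C (s ^ (-m))), ?_, ?_, ?_, ?_⟩
    · intro h
      have := hji (h.trans (map_zero j).symm)
      rw [this] at hg0
      simp at hg0
    · exact hmem _ (by rw [hg]; exact hv)
    · have h3 : (j (f * PowerSeries.C (s ^ (-m))))⁻¹ = j ((f * PowerSeries.C (s ^ (-m)))⁻¹) := (coe_inv_ps _ hg0).symm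
      rw [h3]
      exact hmem _ (by rw [PowerSeries.constantCoeff_inv, hg]; exact hv')
    · rw [map_mul, hC, map_zpow₀, ← htC, hn, zpow_neg]
      have h4 : (t ^ m) ≠ 0 := zpow_ne_zero _ ht0
      show ϖ ^ n * j f = _
      field_simp
  · classical
    obtain ⟨R, hR⟩ := d.res
    refine ⟨R.image C, fun x hx => ?_⟩
    obtain ⟨f, hf, rfl⟩ := hmem' x hx
    obtain ⟨r, hr, y, hy, h⟩ := hR _ hf
    refine ⟨_, Finset.mem_image_of_mem _ hr, j (PowerSeries.C s⁻¹ * (f - PowerSeries.C r)), hmem _ ?_, ?_⟩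
    · rw [map_mul, map_sub, PowerSeries.constantCoeff_C, PowerSeries.constantCoeff_C, h, inv_mul_cancel_left₀ d.s0]
      exact hy
    · rw [map_mul, hC, map_inv₀, ← htC, mul_inv_cancel_left₀ ht0, map_sub, hC]
  · intro x hx
    obtain ⟨f, hf, rfl⟩ := hmem' x hx
    obtain ⟨y, hy⟩ := d.as _ hf
    obtain ⟨z, hz⟩ := as_ps p (PowerSeries.C s * (f - PowerSeries.C (PowerSeries.constantCoeff f))) (by simp)
    refine ⟨C y + j z, ?_⟩
    have h1 : j z ^ p - j z = t * (j f - C (PowerSeries.constantCoeff f)) := by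
      rw [← map_pow, ← map_sub, hz, map_mul, map_sub]; rfl
    have h2 : C y ^ p - C y = t * C (PowerSeries.constantCoeff f) := by
      rw [← map_pow, ← map_sub, hy, map_mul, htC]
    rw [add_pow_char]
    linear_combination h1 + h2
  · obtain ⟨g, hg⟩ := d.span
    exact span_laurent p g hg
  · intro a
    by_cases ha : PowerSeries.constantCoeff a = 0
    · exact ⟨0, by rw [pow_zero, one_mul, hj]; exact hmem _ (by rw [ha]; exact O.zero_mem)⟩
    obtain ⟨m, v, hv0, hv, hv', hm⟩ := d.dec _ ha
    refine ⟨m.natAbs, ?_⟩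
    have h1 : t ^ m.natAbs * algebraMap (PowerSeries k) (LaurentSeries k) a = j (PowerSeries.C (s ^ m.natAbs) * a) := by
      rw [map_mul, hC, map_pow, ← htC, hj]
    rw [h1]
    apply hmem
    rw [map_mul, hm, PowerSeries.constantCoeff_C, ← mul_assoc, ← zpow_natCast, ← zpow_add₀ d.s0]
    refine mul_mem ?_ hv
    obtain ⟨b, hb⟩ := Int.eq_ofNat_of_zero_le (show 0 ≤ (m.natAbs : ℤ) + m by omega)
    rw [hb, zpow_natCast]
    exact pow_mem d.sO b
  · intro x hx
    obtain ⟨f, hf, rfl⟩ := hmem' x hx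
    exact ⟨f, rfl⟩
  · exact ⟨PowerSeries.C s⁻¹, by rw [hj, hC, map_inv₀, htC]⟩

end I5
end Tower

namespace Tower

section I6
lemma mem_of_int {A Ω : Type} [CommRing A] [Field Ω] [Algebra A Ω] (C : ValuationSubring Ω)
    (h : ∀ a : A, algebraMap A Ω a ∈ C) {x : Ω} (hx : IsIntegral A x) : C.valuation x ≤ 1 := by
  have h1 : IsIntegral C (RingHom.id Ω x) :=
    hx.map_of_comp_eq ((algebraMap A Ω).codRestrict C.toSubring h) (RingHom.id Ω) (by ext a; rfl)
  obtain ⟨y, hy⟩ := IsIntegrallyClosed.isIntegral_iff.mp h1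
  rw [ValuationSubring.valuation_le_one_iff]
  rw [RingHom.id_apply] at hy
  rw [← hy]
  exact y.2

theorem final_abs {A F : Type} [CommRing A] [Field F] [Algebra A F] {p : ℕ} [hp : Fact p.Prime] [CharP F p]
    {O : Subring F} {t ϖ : F} (d : FData p A O t ϖ)
    (Ω : Type) [Field Ω] [Algebra F Ω] [IsAlgClosure F Ω] [Algebra A Ω] [IsScalarTower A F Ω]
    (n : ℕ) (D : Type) [DivisionRing D] [Algebra F D]
    (hcentral : Subalgebra.center F D = ⊥)
    (hfin : FiniteDimensional F D)
    (hper : period F D = p ^ n) :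
    Module.finrank F D = (p ^ n) ^ 2 ∧
    ∃ (L : Type) (_ : Field L) (_ : Algebra F L)
      (_ : Algebra A L)
      (_ : IsScalarTower A F L),
      Nonempty ((L ⊗[F] D) ≃ₐ[L] Matrix (Fin (p ^ n)) (Fin (p ^ n)) L) ∧
      ∃ c : Fin (n + 1) → IntermediateField F L,
        c 0 = ⊥ ∧ c (Fin.last n) = ⊤ ∧ Monotone c ∧
        (∀ i : Fin n,
          Module.finrank F (c i.succ) =
            p * Module.finrank F (c i.castSucc)) ∧
        (∀ i : Fin n,
          ResidueStep p
            ((integralClosure A L).toSubring ⊓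
              (c i.castSucc).toSubfield.toSubring)
            ((integralClosure A L).toSubring ⊓
              (c i.succ).toSubfield.toSubring)) := by
  obtain ⟨B, C, hBC, hϖC, htC, hL, hinteg, hAC⟩ := d.exists_val Ω
  obtain ⟨e, he, hcard, hle, β, hβ, hsplit⟩ := H_main p Ω hcentral hper
  obtain ⟨g, hg⟩ := d.span
  have hmono : ∀ x y, B.valuation x ≤ B.valuation y → C.valuation x ≤ C.valuation y := by
    intro x y h
    by_cases hy : y = 0
    · rw [hy, map_zero, le_zero_iff, map_eq_zero] at h
      rw [h, hy]
    · have hy1 : 0 < B.valuation y := by rw [zero_lt_iff, Valuation.ne_zero_iff]; exact hy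
      have hy2 : 0 < C.valuation y := by rw [zero_lt_iff, Valuation.ne_zero_iff]; exact hy
      rw [← div_le_one₀ hy1, ← map_div₀, ValuationSubring.valuation_le_one_iff] at h
      rw [← div_le_one₀ hy2, ← map_div₀, ValuationSubring.valuation_le_one_iff]
      exact hBC h
  obtain ⟨c, hc0, hstep, hcfd, hcint, m, hm, hcond⟩ := tower (A := A) hmono g hg hϖC n ⊥ β inferInstance
    (by
      intro x hx h
      obtain ⟨y, rfl⟩ := IntermediateField.mem_bot.mp hx
      obtain ⟨a, rfl⟩ := hinteg y h
      rw [← IsScalarTower.algebraMap_apply]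
      exact isIntegral_algebraMap)
    ⟨algebraMap F _ t, algebraMap F _ ϖ, htC, rfl, loc1_bot hL⟩ hβ
  obtain ⟨⟨E⟩, hdvd⟩ := hsplit (c n) m hm hcond
  have hrank : ∀ i ≤ n, Module.finrank F (c i) = p ^ i := by
    intro i
    induction i with
    | zero => intro _; rw [hc0, pow_zero]; exact IntermediateField.finrank_bot
    | succ i ih => intro hi; rw [(hstep i (by omega)).rank, ih (by omega), pow_succ']
  have hep : e = p ^ n := by
    rw [hrank n le_rfl] at hdvd
    exact le_antisymm (Nat.le_of_dvd (pow_pos hp.out.pos _) hdvd) hle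
  subst hep
  refine ⟨hcard, ?_⟩
  have hcm : ∀ i j, i ≤ j → j ≤ n → c i ≤ c j := by
    intro i j hij
    induction j, hij using Nat.le_induction with
    | base => intro _; exact le_rfl
    | succ j hij ih => intro hj; exact (ih (by omega)).trans (hstep j (by omega)).le
  let L := ↥(c n)
  letI algAL : Algebra A L := ((algebraMap F L).comp (algebraMap A F)).toAlgebra
  haveI tAFL : IsScalarTower A F L := IsScalarTower.of_algebraMap_eq fun _ => rfl
  haveI tALΩ : IsScalarTower A L Ω := IsScalarTower.of_algebraMap_eq fun a => by
    rw [IsScalarTower.algebraMap_apply A F Ω]; rfl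
  haveI : CharP L p := charP_of_injective_algebraMap (algebraMap F L).injective p
  have hcn : ∀ i : Fin (n + 1), c i ≤ c n := fun i => hcm _ _ (by omega) le_rfl
  let c' : Fin (n + 1) → IntermediateField F L := fun i => IntermediateField.restrict (hcn i)
  have hmem : ∀ i (x : L), x ∈ c' i ↔ (x : Ω) ∈ c i := fun i x => IntermediateField.mem_restrict (hcn i) x
  have hrk : ∀ i, Module.finrank F (c' i) = Module.finrank F (c i) := fun i =>
    (IntermediateField.restrictAlgEquiv (hcn i)).toLinearEquiv.finrank_eq.symm
  let V : Valuation L C.ValueGroup := C.valuation.comap (algebraMap L Ω)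
  have hV : ∀ x : L, V x = C.valuation (x : Ω) := fun x => rfl
  have hO : ∀ i (x : L), x ∈ ((integralClosure A L).toSubring ⊓ (c' i).toSubfield.toSubring) ↔ x ∈ (c' i).toSubfield ∧ V x ≤ 1 := by
    intro i x
    have h1 : x ∈ ((integralClosure A L).toSubring ⊓ (c' i).toSubfield.toSubring) ↔ IsIntegral A x ∧ x ∈ (c' i).toSubfield := Iff.rfl
    rw [h1, and_comm]
    refine and_congr_right fun _ => ⟨fun h => ?_, fun h => ?_⟩
    · have h2 : IsIntegral A (algebraMap L Ω x) := h.algebraMap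
      exact mem_of_int C hAC h2
    · have h2 : IsIntegral A (algebraMap L Ω x) := hcint x x.2 h
      exact (isIntegral_algebraMap_iff (algebraMap L Ω).injective).mp h2
  refine ⟨L, inferInstance, inferInstance, algAL, tAFL, ⟨E⟩, c', ?_, ?_, ?_, ?_, ?_⟩
  · ext x
    rw [hmem]
    show (x : Ω) ∈ c 0 ↔ _
    rw [hc0, IntermediateField.mem_bot, IntermediateField.mem_bot]
    constructor
    · rintro ⟨y, hy⟩; exact ⟨y, Subtype.ext hy⟩
    · rintro ⟨y, hy⟩; exact ⟨y, congrArg Subtype.val hy⟩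
  · rw [eq_top_iff]
    rintro x -
    rw [hmem]
    exact x.2
  · intro i j hij x
    rw [hmem, hmem]
    exact fun h => hcm i j hij (by omega) h
  · intro i
    rw [hrk, hrk]
    exact (hstep i i.2).rank
  · intro i
    have S := hstep i i.2
    obtain ⟨z, hz, hz1, hspan, horth, halt⟩ := S.ex
    have hci : c i ≤ c n := hcm _ _ (by omega) le_rfl
    have hci1 : c (i + 1) ≤ c n := hcm _ _ (by omega) le_rfl
    have hm1 : ∀ x : L, x ∈ (c' i.castSucc).toSubfield ↔ (x : Ω) ∈ c i := fun x => hmem i.castSucc x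
    have hm2 : ∀ x : L, x ∈ (c' i.succ).toSubfield ↔ (x : Ω) ∈ c (i + 1) := fun x => hmem i.succ x
    refine residueStep_of (V := V) p (S₁ := (c' i.castSucc).toSubfield) (S₂ := (c' i.succ).toSubfield) ?_ (hO _) (hO _) (z := ⟨z, hci1 hz⟩) ?_ hz1 ?_ ?_ ?_
    · intro x hx
      rw [hm1] at hx
      rw [hm2]
      exact S.le hx
    · rw [hm2]; exact hz
    · intro x hx
      rw [hm2] at hx
      obtain ⟨a, ha⟩ := hspan x hx
      refine ⟨fun j => ⟨a j, hci (a j).2⟩, fun j => (hm1 _).mpr (a j).2, ?_⟩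
      apply (algebraMap L Ω).injective
      rw [map_sum]
      refine ha.trans (Finset.sum_congr rfl fun j _ => ?_)
      rw [map_mul, map_pow]; rfl
    · intro a ha j hj
      have h1 := horth (fun j => ⟨a j, (hm1 _).mp (ha j)⟩) j hj
      have h2 : algebraMap L Ω (∑ j ∈ Finset.range p, a j * (⟨z, hci1 hz⟩ : L) ^ j) = ∑ j ∈ Finset.range p, (a j : Ω) * z ^ j := by
        rw [map_sum]
        refine Finset.sum_congr rfl fun j _ => ?_
        rw [map_mul, map_pow]; rfl
      show C.valuation (a j : Ω) ≤ C.valuation (algebraMap L Ω _)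
      rw [h2]
      exact h1
    · rcases halt with ⟨g, hg, hg1, hg2⟩ | h
      · left
        exact ⟨⟨g, hci hg⟩, (hm1 _).mpr hg, hg1, hg2⟩
      · right
        rw [hm1]
        exact h

end I6
end Tower

/-- Let `p` be a prime, `q` a power of `p`, and `k = 𝔽_q((s))` a local
field of characteristic `p`.  Let `F = k((π))` and let `D` be a central division
`F`-algebra of period `p^n`.  Then `deg(D) = p^n`, and there is a tower
`F = E_0 ⊂ E_1 ⊂ ⋯ ⊂ E_n` of degree-`p` steps (realized as a chain of intermediate
fields of a splitting field `L`, `E_n = L`) such that `E_n` splits `D` and each residue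
field extension (for the unique extension of the `π`-adic valuation, whose valuation
ring is the integral closure of `k[[π]]`) has degree `p` and is either an Artin–Schreier
extension or a purely inseparable extension. -/
theorem division_algebra_over_local_laurent_series_splitting_tower
    (p : ℕ) [Fact p.Prime] (n : ℕ)
    (Fq : Type) [Field Fq] [Fintype Fq] [CharP Fq p]
    (k : Type) [Field k] [CharP k p] (hk : Nonempty (k ≃+* LaurentSeries Fq))
    (D : Type) [DivisionRing D] [Algebra (LaurentSeries k) D]
    (hcentral : Subalgebra.center (LaurentSeries k) D = ⊥)
    (hfin : FiniteDimensional (LaurentSeries k) D)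
    (hper : period (LaurentSeries k) D = p ^ n) :
    Module.finrank (LaurentSeries k) D = (p ^ n) ^ 2 ∧
    ∃ (L : Type) (_ : Field L) (_ : Algebra (LaurentSeries k) L)
      (_ : Algebra (PowerSeries k) L)
      (_ : IsScalarTower (PowerSeries k) (LaurentSeries k) L),
      Nonempty ((L ⊗[LaurentSeries k] D) ≃ₐ[L] Matrix (Fin (p ^ n)) (Fin (p ^ n)) L) ∧
      ∃ c : Fin (n + 1) → IntermediateField (LaurentSeries k) L,
        c 0 = ⊥ ∧ c (Fin.last n) = ⊤ ∧ Monotone c ∧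
        (∀ i : Fin n,
          Module.finrank (LaurentSeries k) (c i.succ) =
            p * Module.finrank (LaurentSeries k) (c i.castSucc)) ∧
        (∀ i : Fin n,
          ResidueStep p
            ((integralClosure (PowerSeries k) L).toSubring ⊓
              (c i.castSucc).toSubfield.toSubring)
            ((integralClosure (PowerSeries k) L).toSubring ⊓
              (c i.succ).toSubfield.toSubring)) := by
  obtain ⟨e⟩ := hk
  obtain ⟨O, s, d⟩ := Tower.exists_kdata p e
  obtain ⟨O2, t, ϖ, d2⟩ := Tower.exists_fdata p d
  haveI : CharP (LaurentSeries k) p :=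
    charP_of_injective_ringHom (f := (HahnSeries.C : k →+* LaurentSeries k)) HahnSeries.C_injective p
  obtain ⟨Ω, _, _, _⟩ : ∃ (Ω : Type) (_ : Field Ω) (_ : Algebra (LaurentSeries k) Ω),
      IsAlgClosure (LaurentSeries k) Ω :=
    ⟨AlgebraicClosure (LaurentSeries k), inferInstance, inferInstance, inferInstance⟩
  haveI : IsAlgClosed Ω := IsAlgClosure.isAlgClosed (LaurentSeries k)
  haveI : Algebra.IsAlgebraic (LaurentSeries k) Ω := IsAlgClosure.isAlgebraic
  letI : Algebra (PowerSeries k) Ω := ((algebraMap (LaurentSeries k) Ω).comp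
    (algebraMap (PowerSeries k) (LaurentSeries k))).toAlgebra
  haveI : IsScalarTower (PowerSeries k) (LaurentSeries k) Ω :=
    IsScalarTower.of_algebraMap_eq fun _ => rfl
  exact Tower.final_abs d2 Ω n D hcentral hfin hper
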